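/- A finitely generated group G has decidable word problem if and only if there exist a finitely presented group K, a finitely generated simple subgroup S of K whose inclusion into K is a quasi-isometric embedding, and a quasi-isometric embedding of G into S. -/

import Mathlib

-- The sign (−1, 0, or 1) of a group element relative to the identity,
-- with respect to a linear order `l`.
open Classical in
noncomputable def orderSign {H : Type*} [Group H] (l : LinearOrder H) (h : H) : ℤ :=
  if l.lt h 1 then -1 else if h = 1 then 0 else 1

/-- A group is left-orderable if it carries a left-invariant linear order. -/
def IsLeftOrderable (G : Type*) [Group G] : Prop :=
  ∃ l : LinearOrder G, ∀ a b c : G, l.le b c → l.le (a * b) (a * c)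

/-- A Frattini embedding: an injective homomorphism preserving and reflecting conjugacy. -/
def IsFrattini {G H : Type*} [Group G] [Group H] (φ : G →* H) : Prop :=
  Function.Injective φ ∧ ∀ a b : G, IsConj a b ↔ IsConj (φ a) (φ b)

/-- `X` is a (finite) generating set of the group. -/
def Generates {G : Type*} [Group G] (X : Finset G) : Prop :=
  Subgroup.closure (X : Set G) = ⊤

/-- Word length of `g` with respect to the finite set `X`: the least length of a word
over `X ∪ X⁻¹` representing `g`. -/
noncomputable def wordLength {G : Type*} [Group G] (X : Finset G) (g : G) : ℕ :=
  sInf {n | ∃ w : List G, w.length = n ∧ (∀ a ∈ w, a ∈ X ∨ a⁻¹ ∈ X) ∧ w.prod = g}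

/-- Quasi-isometric embedding with respect to finite generating sets `X` and `Y`. -/
noncomputable def IsQIEmbedding {G H : Type*} [Group G] [Group H]
    (X : Finset G) (Y : Finset H) (φ : G →* H) : Prop :=
  Function.Injective φ ∧ ∃ C k : ℝ, 0 < C ∧ 0 < k ∧ ∀ g : G,
    (1 / C) * (wordLength X g : ℝ) - k ≤ (wordLength Y (φ g) : ℝ) ∧
    (wordLength Y (φ g) : ℝ) ≤ C * (wordLength X g : ℝ) + k

/-- Evaluation of a formal word (list of pairs (index, sign)) over the
enumerated sequence `x : ℕ → G`. -/
def evalWord {G : Type*} [Group G] (x : ℕ → G) (w : List (ℕ × Bool)) : G :=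
  (w.map (fun p => if p.2 then x p.1 else (x p.1)⁻¹)).prod

/-- A computable left order on a countable group with respect to an enumerated
generating sequence `x : ℕ → G`. -/
def ComputableLeftOrderWrt {G : Type*} [Group G] (x : ℕ → G) : Prop :=
  ∃ l : LinearOrder G, (∀ a b c : G, l.le b c → l.le (a * b) (a * c)) ∧
    Computable (fun w : List (ℕ × Bool) => orderSign l (evalWord x w))

/-- A computable left order on a finitely generated group, presented by
a surjection `π` from a free group of finite rank. -/
def ComputableLeftOrderVia {H : Type*} [Group H] {m : ℕ}
    (π : FreeGroup (Fin m) →* H) : Prop :=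
  ∃ l : LinearOrder H, (∀ a b c : H, l.le b c → l.le (a * b) (a * c)) ∧
    Computable (fun w : List (Fin m × Bool) => orderSign l (π (FreeGroup.mk w)))

/-- The embedding `φ` is computable: one can compute, for each `i`, a word over the
generators of `H` representing `φ (x i)`. -/
def ComputableEmbedding {G H : Type*} [Group G] [Group H] (x : ℕ → G) {m : ℕ}
    (π : FreeGroup (Fin m) →* H) (φ : G →* H) : Prop :=
  ∃ f : ℕ → List (Fin m × Bool), Computable f ∧ ∀ i, π (FreeGroup.mk (f i)) = φ (x i)

/-- Decidable membership problem for the image of `φ` in `H`, presented via `π`. -/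
def DecidableMembership {G H : Type*} [Group G] [Group H] {m : ℕ}
    (π : FreeGroup (Fin m) →* H) (φ : G →* H) : Prop :=
  ComputablePred (fun w : List (Fin m × Bool) => π (FreeGroup.mk w) ∈ φ.range)

/-- Decidable word problem for `H`, presented via `π`. -/
def DecidableWordProblemVia {H : Type*} [Group H] {m : ℕ}
    (π : FreeGroup (Fin m) →* H) : Prop :=
  ComputablePred (fun w : List (Fin m × Bool) => π (FreeGroup.mk w) = 1)

/-- A group is finitely presented: quotient of a finite-rank free group by the
normal closure of finitely many relators. -/
def IsFinitelyPresented (K : Type*) [Group K] : Prop :=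
  ∃ (m : ℕ) (π : FreeGroup (Fin m) →* K) (R : Finset (FreeGroup (Fin m))),
    Function.Surjective π ∧ π.ker = Subgroup.normalClosure (R : Set (FreeGroup (Fin m)))

set_option linter.unusedSectionVars false

namespace QISimple

/-! ### Part 0 : closure properties of r.e. predicates -/

section RE

variable {α β : Type*} [Primcodable α] [Primcodable β]

theorem re_comp {p : β → Prop} (hp : REPred p) {f : α → β} (hf : Computable f) :
    REPred fun a => p (f a) :=
  Partrec.comp (f := fun b => Part.assert (p b) fun _ => Part.some ()) hp hf

/-- An r.e. predicate is a projection of a computable one. -/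
theorem re_exists_fun {p : α → Prop} (hp : REPred p) :
    ∃ f : α → ℕ → Bool, Computable₂ f ∧ ∀ a, p a ↔ ∃ n, f a n = true := by
  obtain ⟨c, hc⟩ := Nat.Partrec.Code.exists_code.1 hp
  refine ⟨fun a k => (c.evaln k (Encodable.encode a)).isSome, ?_, fun a => ?_⟩
  · exact (Primrec.option_isSome.comp (Nat.Partrec.Code.primrec_evaln.comp
      ((Primrec.snd.pair (Primrec.const c)).pair (Primrec.encode.comp Primrec.fst)))).to_comp
  · have h1 : p a ↔ (c.eval (Encodable.encode a)).Dom := by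
      rw [hc]
      simp [Part.assert]
    rw [h1, Part.dom_iff_mem]
    simp only [Nat.Partrec.Code.evaln_complete, Option.isSome_iff_exists]
    exact ⟨fun ⟨x, k, h⟩ => ⟨k, x, h⟩, fun ⟨k, x, h⟩ => ⟨x, k, h⟩⟩

theorem re_of_fun {f : α → ℕ → Bool} (hf : Computable₂ f) :
    REPred fun a => ∃ n, f a n = true := by
  have h : Partrec fun a => Nat.rfind (fun n => (Part.some (f a n))) :=
    Partrec.rfind (p := fun a n => Part.some (f a n)) hf
  refine h.dom_re.of_eq fun a => ?_
  refine Nat.rfind_dom.trans ?_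
  constructor
  · rintro ⟨n, hn, -⟩
    exact ⟨n, (Part.mem_some_iff.1 hn).symm⟩
  · rintro ⟨n, hn⟩
    exact ⟨n, Part.mem_some_iff.2 hn.symm, fun _ => trivial⟩

/-- r.e. predicates are closed under existential quantification. -/
theorem re_exists {p : α → β → Prop} (hp : REPred fun x : α × β => p x.1 x.2) :
    REPred fun a => ∃ b, p a b := by
  obtain ⟨f, hf, h⟩ := re_exists_fun hp
  have hg : Computable₂ fun (a : α) (n : ℕ) =>
      ((Encodable.decode (α := β) n.unpair.1).map fun b => f (a, b) n.unpair.2).getD false := by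
    refine Computable.option_getD (Computable.option_map (Computable.decode.comp
      (Computable.fst.comp (Computable.unpair.comp Computable.snd))) ?_) (Computable.const _)
    exact hf.comp ((Computable.fst.comp Computable.fst).pair Computable.snd)
      (Computable.snd.comp (Computable.unpair.comp (Computable.snd.comp Computable.fst)))
  refine (re_of_fun hg).of_eq fun a => ?_
  constructor
  · rintro ⟨n, hn⟩
    cases hd : Encodable.decode (α := β) n.unpair.1 with
    | none => rw [hd] at hn; simp at hn
    | some b =>
      rw [hd] at hn
      exact ⟨b, (h (a, b)).2 ⟨_, hn⟩⟩
  · rintro ⟨b, hb⟩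
    obtain ⟨k, hk⟩ := (h (a, b)).1 hb
    exact ⟨Nat.pair (Encodable.encode b) k, by simpa using hk⟩

theorem re_and {p q : α → Prop} (hp : REPred p) (hq : REPred q) :
    REPred fun a => p a ∧ q a := by
  obtain ⟨f, hf, h⟩ := re_exists_fun hp
  obtain ⟨g, hg, h'⟩ := re_exists_fun hq
  have : Computable fun x : (α × ℕ) × ℕ => f x.1.1 x.1.2 && g x.1.1 x.2 :=
    Primrec.and.to_comp.comp (hf.comp (Computable.fst.comp Computable.fst)
      (Computable.snd.comp Computable.fst))
      (hg.comp (Computable.fst.comp Computable.fst) Computable.snd)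
  have h2 : REPred fun x : (α × ℕ) × ℕ => (f x.1.1 x.1.2 && g x.1.1 x.2) = true :=
    ComputablePred.to_re ⟨inferInstance, this.of_eq fun x => by simp⟩
  refine (re_exists (p := fun a n => ∃ m, (f a n && g a m) = true)
    (re_exists (p := fun (x : α × ℕ) m => (f x.1 x.2 && g x.1 m) = true) h2)).of_eq fun a => ?_
  rw [h, h']
  simp

end RE

end QISimple


namespace QISimple

/-! ### Part 2 : filtrations on HNN extensions -/

section HNN

open HNNExtension HNNExtension.NormalWord

/-- A filtration on a group, compatible with products. -/
structure IsFiltration {Γ : Type*} [Group Γ] (Bd : ℕ → Γ → Prop) : Prop where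
  one : ∀ n, Bd n 1
  mul : ∀ n m a b, Bd n a → Bd m b → Bd (n + m) (a * b)
  inv : ∀ n a, Bd n a → Bd n a⁻¹

theorem IsFiltration.mono {Γ : Type*} [Group Γ] {Bd : ℕ → Γ → Prop} (h : IsFiltration Bd)
    {n m : ℕ} (hnm : n ≤ m) {a : Γ} (ha : Bd n a) : Bd m a := by
  obtain ⟨k, rfl⟩ := Nat.exists_eq_add_of_le hnm
  simpa using h.mul n k a 1 ha (h.one k)

variable {Γ : Type*} [Group Γ] {A B : Subgroup Γ} (φ : A ≃* B)
  (Bd : ℕ → Γ → Prop)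

theorem hnn_reduce (hBd : IsFiltration Bd)
    (hφ : ∀ n (a : A), Bd n (a : Γ) ↔ Bd n (φ a : Γ)) :
    ∀ (l : List (ℤˣ × Γ × ℕ)) (g : Γ) (n : ℕ), Bd n g → (∀ x ∈ l, Bd x.2.2 x.2.1) →
      ∃ (g' : Γ) (n' : ℕ) (l' : List (ℤˣ × Γ × ℕ)), Bd n' g' ∧ (∀ x ∈ l', Bd x.2.2 x.2.1) ∧
        (l'.map (fun x => (x.1, x.2.1))).IsChain
          (fun a b => a.2 ∈ toSubgroup A B a.1 → a.1 = b.1) ∧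
        n' + (l'.map (fun x => x.2.2)).sum = n + (l.map (fun x => x.2.2)).sum ∧
        (of g' : HNNExtension Γ A B φ) * (l'.map (fun x => t ^ (x.1 : ℤ) * of x.2.1)).prod =
        of g * (l.map (fun x => t ^ (x.1 : ℤ) * of x.2.1)).prod := by
  intro l
  induction l with
  | nil =>
    intro g n hg _
    exact ⟨g, n, [], hg, by simp, by simp, by simp, by simp⟩
  | cons x l ih =>
    intro g n hg hl
    obtain ⟨u, g1, n1⟩ := x
    obtain ⟨g', n', l', hg', hl', hc, hs, hp⟩ := ih g1 n1 (hl (u, g1, n1) (by simp))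
      (fun x hx => hl x (by simp [hx]))
    by_cases hcan : ∃ y l2, l' = y :: l2 ∧ g' ∈ toSubgroup A B u ∧ u ≠ y.1
    · obtain ⟨⟨v, g2, n2⟩, l2, rfl, hmem, hne⟩ := hcan
      have hv : v = -u := by
        rcases Int.units_eq_one_or u with rfl | rfl <;>
        rcases Int.units_eq_one_or v with rfl | rfl <;> simp_all
      subst hv
      obtain ⟨h, hh, hconj⟩ : ∃ h : Γ, Bd n' h ∧
          (t : HNNExtension Γ A B φ) ^ (u : ℤ) * of g' * t ^ ((-u : ℤˣ) : ℤ) = of h := by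
        rcases Int.units_eq_one_or u with rfl | rfl
        · refine ⟨φ ⟨g', hmem⟩, (hφ n' ⟨g', hmem⟩).1 hg', ?_⟩
          have := equiv_eq_conj (φ := φ) ⟨g', hmem⟩
          simp only at this
          rw [this]; simp
        · refine ⟨φ.symm ⟨g', hmem⟩, (hφ n' _).2 (by simpa using hg'), ?_⟩
          have := equiv_symm_eq_conj (φ := φ) ⟨g', hmem⟩
          simp only at this
          rw [this]; simp
      refine ⟨g * (h * g2), n + (n' + n2), l2, hBd.mul _ _ _ _ hg (hBd.mul _ _ _ _ hh
        (hl' (-u, g2, n2) (by simp))), fun x hx => hl' x (by simp [hx]), ?_, ?_, ?_⟩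
      · simp only [List.map_cons] at hc
        exact hc.tail
      · simp at hs ⊢; omega
      · simp only [List.map_cons, List.prod_cons] at hp ⊢
        rw [mul_assoc (t ^ (u : ℤ)), ← hp, map_mul, map_mul, ← hconj]
        simp only [mul_assoc]
    · refine ⟨g, n, (u, g', n') :: l', hg, ?_, ?_, ?_, ?_⟩
      · intro x hx
        rcases List.mem_cons.1 hx with rfl | hx
        · exact hg'
        · exact hl' x hx
      · simp only [List.map_cons]
        refine List.IsChain.cons hc ?_
        intro y hy hmem
        cases l' with
        | nil => simp at hy
        | cons z l2 =>
          simp only [List.map_cons, List.head?_cons, Option.mem_def, Option.some.injEq] at hy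
          subst hy
          by_contra hne
          exact hcan ⟨z, l2, rfl, hmem, hne⟩
      · simp at hs ⊢; omega
      · simp only [List.map_cons, List.prod_cons]
        rw [mul_assoc (t ^ (u : ℤ)), hp, mul_assoc (t ^ (u : ℤ))]

/-- The filtration induced on an HNN extension by counting. -/
def HBd (n : ℕ) (x : HNNExtension Γ A B φ) : Prop :=
  ∃ (g : Γ) (m : ℕ) (l : List (ℤˣ × Γ × ℕ)), Bd m g ∧ (∀ x ∈ l, Bd x.2.2 x.2.1) ∧
    m + (l.map (fun x => x.2.2)).sum = n ∧
    x = of g * (l.map (fun x => t ^ (x.1 : ℤ) * of x.2.1)).prod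

theorem HBd_of (hBd : IsFiltration Bd)
    (hφ : ∀ n (a : A), Bd n (a : Γ) ↔ Bd n (φ a : Γ)) {n : ℕ} {g : Γ}
    (h : HBd φ Bd n (of g)) : Bd n g := by
  obtain ⟨g0, m, l, hg0, hl, rfl, hx⟩ := h
  obtain ⟨g', n', l', hg', hl', hc, hs, hp⟩ := hnn_reduce φ Bd hBd hφ l g0 m hg0 hl
  rw [← hs]
  let w : ReducedWord Γ A B := ⟨g', l'.map (fun x => (x.1, x.2.1)), hc⟩
  have hw : w.prod φ = of g := by
    rw [hx, ← hp]
    simp [w, ReducedWord.prod, List.map_map, Function.comp_def]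
  have := ReducedWord.toList_eq_nil_of_mem_of_range φ w (hw ▸ ⟨g, rfl⟩)
  have hnil : l' = [] := by simpa [w] using this
  subst hnil
  have : g' = g := by
    have : (of g' : HNNExtension Γ A B φ) = of g := by rw [hx, ← hp]; simp
    exact of_injective φ this
  subst this
  simpa using hg'

theorem HBd_of' {n : ℕ} {g : Γ} (h : Bd n g) : HBd φ Bd n (of g) :=
  ⟨g, n, [], h, by simp, by simp, by simp⟩

theorem HBd_t (hBd : IsFiltration Bd) (u : ℤˣ) : HBd φ Bd 0 (t ^ (u : ℤ)) :=
  ⟨1, 0, [(u, 1, 0)], hBd.one 0, by simpa using hBd.one 0, by simp, by simp⟩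

theorem HBd_mul (hBd : IsFiltration Bd) {n m : ℕ} {x y : HNNExtension Γ A B φ}
    (hx : HBd φ Bd n x) (hy : HBd φ Bd m y) : HBd φ Bd (n + m) (x * y) := by
  obtain ⟨g, a, l, hg, hl, rfl, rfl⟩ := hx
  obtain ⟨g', a', l', hg', hl', rfl, rfl⟩ := hy
  rcases List.eq_nil_or_concat l with rfl | ⟨l0, ⟨u, h, b⟩, rfl⟩
  · exact ⟨g * g', a + a', l', hBd.mul _ _ _ _ hg hg', hl', by simp; omega,
      by simp [mul_assoc]⟩
  · refine ⟨g, a, l0 ++ (u, h * g', b + a') :: l', hg, ?_, ?_, ?_⟩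
    · intro x hx
      simp only [List.mem_append, List.mem_cons] at hx
      rcases hx with hx | rfl | hx
      · exact hl x (by simp [hx])
      · exact hBd.mul _ _ _ _ (hl (u, h, b) (by simp)) hg'
      · exact hl' x hx
    · simp; omega
    · simp [mul_assoc]

end HNN

end QISimple


namespace QISimple

/-! ### Part 3 : a finitely presented group from a counter machine -/

/-- Affine counter machines with output alphabet `Fin r`. -/
structure CMachine (r : ℕ) where
  /-- states -/
  Q : Type
  /-- counters -/
  J : Type
  /-- rules -/
  R : Type
  [finQ : Finite Q]
  [finJ : Fintype J]
  [finR : Finite R]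
  src : R → Q
  tgt : R → Q
  hne : ∀ i, src i ≠ tgt i
  D : R → J → ℤ
  d : R → J → ℤ
  E : R → J → ℤ
  e : R → J → ℤ
  hD : ∀ i j, 0 < D i j
  hE : ∀ i j, 0 < E i j
  pr : R → Option (Fin r)
  q0 : Q
  q1 : Q

attribute [instance] CMachine.finQ CMachine.finJ CMachine.finR

namespace CMachine

variable {r : ℕ} (M : CMachine r)

/-- One step of the machine. -/
def Step (c c' : M.Q × (M.J → ℤ) × List (Fin r)) : Prop :=
  ∃ (i : M.R) (k : M.J → ℤ) (w : List (Fin r)),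
    c = (M.src i, fun j => M.D i j * k j + M.d i j, w) ∧
    c' = (M.tgt i, fun j => M.E i j * k j + M.e i j, w ++ (M.pr i).toList)

/-- Generators of the finitely presented group. -/
inductive Gen
  | p (a : Fin r) | s (a : Fin r) | v (a : Fin r)
  | t (q : M.Q) | x (q : M.Q) (j : M.J)
  | rho (i : M.R) | Y (i : M.R) (j : M.J) | Y' (i : M.R) (j : M.J) | k

/-- Indices of the relations. -/
inductive Rel
  | sv (a b : Fin r) | st (a : Fin r) | ps (a b : Fin r) | kp (a : Fin r) | kt | kr (i : M.R)
  | xx (q : M.Q) (i j : M.J) | rp (i : M.R) (a : Fin r) | Yp (i : M.R) (j : M.J) (a : Fin r)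
  | rt (i : M.R) | rY (i : M.R) (j : M.J)
  | Yx (i : M.R) (j l : M.J) | Yt (i : M.R) (j : M.J)
  | Y'x (i : M.R) (j l : M.J) | Y't (i : M.R) (j : M.J)

instance : Finite M.Gen := by
  let f : Fin r ⊕ Fin r ⊕ Fin r ⊕ M.Q ⊕ (M.Q × M.J) ⊕ M.R ⊕ (M.R × M.J) ⊕ (M.R × M.J) ⊕ Unit →
      M.Gen := fun z => match z with
    | .inl a => .p a
    | .inr (.inl a) => .s a
    | .inr (.inr (.inl a)) => .v a
    | .inr (.inr (.inr (.inl q))) => .t q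
    | .inr (.inr (.inr (.inr (.inl q)))) => .x q.1 q.2
    | .inr (.inr (.inr (.inr (.inr (.inl q))))) => .rho q
    | .inr (.inr (.inr (.inr (.inr (.inr (.inl q)))))) => .Y q.1 q.2
    | .inr (.inr (.inr (.inr (.inr (.inr (.inr (.inl q))))))) => .Y' q.1 q.2
    | .inr (.inr (.inr (.inr (.inr (.inr (.inr (.inr _))))))) => .k
  refine Finite.of_surjective f ?_
  rintro (a | a | a | q | ⟨q, j⟩ | i | ⟨i, j⟩ | ⟨i, j⟩ | _)
  · exact ⟨.inl a, rfl⟩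
  · exact ⟨.inr (.inl a), rfl⟩
  · exact ⟨.inr (.inr (.inl a)), rfl⟩
  · exact ⟨.inr (.inr (.inr (.inl q))), rfl⟩
  · exact ⟨.inr (.inr (.inr (.inr (.inl (q, j))))), rfl⟩
  · exact ⟨.inr (.inr (.inr (.inr (.inr (.inl i))))), rfl⟩
  · exact ⟨.inr (.inr (.inr (.inr (.inr (.inr (.inl (i, j))))))), rfl⟩
  · exact ⟨.inr (.inr (.inr (.inr (.inr (.inr (.inr (.inl (i, j)))))))), rfl⟩
  · exact ⟨.inr (.inr (.inr (.inr (.inr (.inr (.inr (.inr ()))))))), rfl⟩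

instance : Finite M.Rel := by
  let f : (Option (Fin r)) × (Option (Fin r)) × (Option M.Q) × (Option M.R) × (Option M.J) ×
      (Option M.J) × Fin 15 → Option M.Rel := fun z => match z with
    | (some a, some b, _, _, _, _, 0) => some (.sv a b)
    | (some a, _, _, _, _, _, 1) => some (.st a)
    | (some a, some b, _, _, _, _, 2) => some (.ps a b)
    | (some a, _, _, _, _, _, 3) => some (.kp a)
    | (_, _, _, _, _, _, 4) => some (.kt)
    | (_, _, _, some i, _, _, 5) => some (.kr i)
    | (_, _, some q, _, some i, some j, 6) => some (.xx q i j)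
    | (some a, _, _, some i, _, _, 7) => some (.rp i a)
    | (some a, _, _, some i, some j, _, 8) => some (.Yp i j a)
    | (_, _, _, some i, _, _, 9) => some (.rt i)
    | (_, _, _, some i, some j, _, 10) => some (.rY i j)
    | (_, _, _, some i, some j, some l, 11) => some (.Yx i j l)
    | (_, _, _, some i, some j, _, 12) => some (.Yt i j)
    | (_, _, _, some i, some j, some l, 13) => some (.Y'x i j l)
    | (_, _, _, some i, some j, _, 14) => some (.Y't i j)
    | _ => none
  have hf : ∀ y : M.Rel, ∃ z, f z = some y := by
    rintro (⟨a, b⟩ | a | ⟨a, b⟩ | a | _ | i | ⟨q, i, j⟩ | ⟨i, a⟩ | ⟨i, j, a⟩ | i | ⟨i, j⟩ |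
      ⟨i, j, l⟩ | ⟨i, j⟩ | ⟨i, j, l⟩ | ⟨i, j⟩)
    · exact ⟨(some a, some b, none, none, none, none, 0), rfl⟩
    · exact ⟨(some a, none, none, none, none, none, 1), rfl⟩
    · exact ⟨(some a, some b, none, none, none, none, 2), rfl⟩
    · exact ⟨(some a, none, none, none, none, none, 3), rfl⟩
    · exact ⟨(none, none, none, none, none, none, 4), rfl⟩
    · exact ⟨(none, none, none, some i, none, none, 5), rfl⟩
    · exact ⟨(none, none, some q, none, some i, some j, 6), rfl⟩
    · exact ⟨(some a, none, none, some i, none, none, 7), rfl⟩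
    · exact ⟨(some a, none, none, some i, some j, none, 8), rfl⟩
    · exact ⟨(none, none, none, some i, none, none, 9), rfl⟩
    · exact ⟨(none, none, none, some i, some j, none, 10), rfl⟩
    · exact ⟨(none, none, none, some i, some j, some l, 11), rfl⟩
    · exact ⟨(none, none, none, some i, some j, none, 12), rfl⟩
    · exact ⟨(none, none, none, some i, some j, some l, 13), rfl⟩
    · exact ⟨(none, none, none, some i, some j, none, 14), rfl⟩
  choose g hg using hf
  refine Finite.of_injective g fun y y' h => ?_
  have := hg y
  rw [h, hg y'] at this
  exact (Option.some.inj this).symm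

end CMachine

/-- Products of powers along a list. -/
def chiL {J H : Type*} [Group H] (x : J → H) (l : List J) (α : J → ℤ) : H :=
  (l.map fun j => x j ^ α j).prod

theorem map_chiL {J H H' : Type*} [Group H] [Group H'] (f : H →* H') (x : J → H) (l : List J)
    (α : J → ℤ) : f (chiL x l α) = chiL (fun j => f (x j)) l α := by
  simp [chiL, map_list_prod, List.map_map, Function.comp_def]

theorem chiL_commute {J H : Type*} [Group H] (x : J → H) (y : H) (h : ∀ j, Commute y (x j))
    (l : List J) (α : J → ℤ) : Commute y (chiL x l α) := by
  refine Commute.list_prod_right _ _ ?_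
  intro z hz
  obtain ⟨j, -, rfl⟩ := List.mem_map.1 hz
  exact (h j).zpow_right _

theorem chiL_add {J H : Type*} [Group H] (x : J → H) (h : ∀ i j, Commute (x i) (x j))
    (l : List J) (α β : J → ℤ) :
    chiL x l (fun j => α j + β j) = chiL x l α * chiL x l β := by
  induction l with
  | nil => simp [chiL]
  | cons j l ih =>
    have hc : Commute (x j ^ β j) (chiL x l α) :=
      chiL_commute x _ (fun i => (h j i).zpow_left _) l α
    simp only [chiL, List.map_cons, List.prod_cons] at ih hc ⊢
    rw [ih, zpow_add, mul_assoc, ← mul_assoc (x j ^ β j), hc.eq]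
    simp only [mul_assoc]

/-- The `Y` trick. -/
theorem chiL_conj {J H : Type*} [Group H] (th Y : J → H) (t : H)
    (hth : ∀ i j, Commute (th i) (th j)) (hY : ∀ i j, Commute (Y i) (th j))
    (ht : ∀ j, Commute ((th j)⁻¹ * Y j) t) (l : List J) (k : J → ℤ) :
    chiL th l k * t * (chiL th l k)⁻¹ = chiL Y l k * t * (chiL Y l k)⁻¹ := by
  induction l with
  | nil => simp [chiL]
  | cons j l ih =>
    have h1 : Commute (Y j ^ k j) (chiL th l k) :=
      chiL_commute th _ (fun i => (hY j i).zpow_left _) l k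
    have h2 : Commute (th j ^ k j) (chiL th l k) :=
      chiL_commute th _ (fun i => (hth j i).zpow_left _) l k
    have h3 : Commute ((th j ^ k j)⁻¹ * Y j ^ k j) t := by
      have : (th j ^ k j)⁻¹ * Y j ^ k j = ((th j)⁻¹ * Y j) ^ k j := by
        rw [Commute.mul_zpow ((hY j j).symm.inv_left), inv_zpow]
      rw [this]
      exact (ht j).zpow_left _
    have h4 : th j ^ k j * t * (th j ^ k j)⁻¹ = Y j ^ k j * t * (Y j ^ k j)⁻¹ := by
      have := h3.eq
      rw [mul_assoc, inv_mul_eq_iff_eq_mul] at this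
      rw [eq_mul_inv_iff_mul_eq, this]
      group
    have e1 : chiL th (j :: l) k = th j ^ k j * chiL th l k := by simp [chiL]
    have e2 : chiL Y (j :: l) k = Y j ^ k j * chiL Y l k := by simp [chiL]
    calc _ = chiL th l k * (th j ^ k j * t * (th j ^ k j)⁻¹) * (chiL th l k)⁻¹ := by
            rw [e1, h2.eq]; group
      _ = chiL th l k * (Y j ^ k j * t * (Y j ^ k j)⁻¹) * (chiL th l k)⁻¹ := by rw [h4]
      _ = (chiL th l k * Y j ^ k j) * t * (chiL th l k * Y j ^ k j)⁻¹ := by group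
      _ = Y j ^ k j * (chiL th l k * t * (chiL th l k)⁻¹) * (Y j ^ k j)⁻¹ := by
            rw [← h1.eq]; group
      _ = _ := by rw [ih, e2]; group

theorem chiL_pow {J H : Type*} [Group H] (x : J → H) (l : List J) (D k : J → ℤ) :
    chiL (fun j => x j ^ D j) l k = chiL x l (fun j => D j * k j) := by
  simp [chiL, zpow_mul]

namespace CMachine

variable {r : ℕ} (M : CMachine r) {H : Type*} [Group H]

open Classical in
/-- the monomial in the counters. -/
noncomputable def chi (g : M.Gen → H) (q : M.Q) (α : M.J → ℤ) : H :=
  chiL (fun j => g (.x q j)) (Finset.univ.toList) α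

/-- printing letter -/
def prt (g : M.Gen → H) (i : M.R) : H := ((M.pr i).toList.map fun a => g (.p a)).prod

/-- Left-hand sides. -/
noncomputable def lhs (g : M.Gen → H) : M.Rel → H
  | .sv a b => g (.s a) * g (.v b)
  | .st a => g (.t M.q1) * g (.s a)
  | .ps a b => g (.p a) * g (.s b)
  | .kp a => g .k * g (.p a)
  | .kt => g .k * g (.t M.q0)
  | .kr i => g .k * g (.rho i)
  | .xx q i j => g (.x q i) * g (.x q j)
  | .rp i a => g (.rho i) * g (.p a)
  | .Yp i j a => g (.Y' i j) * g (.p a)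
  | .rt i => g (.rho i) * (M.chi g (M.src i) (M.d i) * g (.t (M.src i)) *
      (M.chi g (M.src i) (M.d i))⁻¹) * (g (.rho i))⁻¹
  | .rY i j => g (.rho i) * g (.Y i j) * (g (.rho i))⁻¹
  | .Yx i j l => g (.Y i j) * g (.x (M.src i) l) ^ M.D i l
  | .Yt i j => ((g (.x (M.src i) j) ^ M.D i j)⁻¹ * g (.Y i j)) *
      (M.chi g (M.src i) (M.d i) * g (.t (M.src i)) * (M.chi g (M.src i) (M.d i))⁻¹)
  | .Y'x i j l => g (.Y' i j) * g (.x (M.tgt i) l) ^ M.E i l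
  | .Y't i j => ((g (.x (M.tgt i) j) ^ M.E i j)⁻¹ * g (.Y' i j)) *
      (M.chi g (M.tgt i) (M.e i) * g (.t (M.tgt i)) * (M.chi g (M.tgt i) (M.e i))⁻¹)

/-- Right-hand sides. -/
noncomputable def rhs (g : M.Gen → H) : M.Rel → H
  | .sv a b => g (.v b) * g (.s a)
  | .st a => g (.s a) * (g (.v a) * g (.t M.q1))
  | .ps a b => g (.s b) * g (.p a)
  | .kp a => g (.p a) * g (.s a) * g .k
  | .kt => g (.t M.q0) * g .k
  | .kr i => g (.rho i) * g .k
  | .xx q i j => g (.x q j) * g (.x q i)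
  | .rp i a => g (.p a) * g (.rho i)
  | .Yp i j a => g (.p a) * g (.Y' i j)
  | .rt i => M.prt g i * (M.chi g (M.tgt i) (M.e i) * g (.t (M.tgt i)) *
      (M.chi g (M.tgt i) (M.e i))⁻¹) * (M.prt g i)⁻¹
  | .rY i j => g (.Y' i j)
  | .Yx i j l => g (.x (M.src i) l) ^ M.D i l * g (.Y i j)
  | .Yt i j => (M.chi g (M.src i) (M.d i) * g (.t (M.src i)) * (M.chi g (M.src i) (M.d i))⁻¹) *
      ((g (.x (M.src i) j) ^ M.D i j)⁻¹ * g (.Y i j))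
  | .Y'x i j l => g (.x (M.tgt i) l) ^ M.E i l * g (.Y' i j)
  | .Y't i j => (M.chi g (M.tgt i) (M.e i) * g (.t (M.tgt i)) * (M.chi g (M.tgt i) (M.e i))⁻¹) *
      ((g (.x (M.tgt i) j) ^ M.E i j)⁻¹ * g (.Y' i j))

theorem map_chi {H' : Type*} [Group H'] (f : H →* H') (g : M.Gen → H) (q : M.Q) (α : M.J → ℤ) :
    f (M.chi g q α) = M.chi (fun y => f (g y)) q α := map_chiL _ _ _ _

theorem map_prt {H' : Type*} [Group H'] (f : H →* H') (g : M.Gen → H) (i : M.R) :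
    f (M.prt g i) = M.prt (fun y => f (g y)) i := by
  simp [prt, map_list_prod, List.map_map, Function.comp_def]

theorem map_lhs {H' : Type*} [Group H'] (f : H →* H') (g : M.Gen → H) (R : M.Rel) :
    f (M.lhs g R) = M.lhs (fun y => f (g y)) R := by
  cases R <;> simp [lhs, map_chi]

theorem map_rhs {H' : Type*} [Group H'] (f : H →* H') (g : M.Gen → H) (R : M.Rel) :
    f (M.rhs g R) = M.rhs (fun y => f (g y)) R := by
  cases R <;> simp [rhs, map_chi, map_prt]

/-- `g` satisfies all relations. -/
def Sat (g : M.Gen → H) : Prop := ∀ R, M.lhs g R = M.rhs g R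

/-- The conjugate of `t` encoding a configuration. -/
noncomputable def T (g : M.Gen → H) (c : M.Q × (M.J → ℤ) × List (Fin r)) : H :=
  (c.2.2.map fun a => g (.p a)).prod * (M.chi g c.1 c.2.1 * g (.t c.1) * (M.chi g c.1 c.2.1)⁻¹) *
    ((c.2.2.map fun a => g (.p a)).prod)⁻¹

variable {M}

theorem list_commute {X : Type*} (y : H) (f : X → H) (h : ∀ a, Commute y (f a)) (l : List X) :
    Commute y (l.map f).prod := by
  refine Commute.list_prod_right _ _ ?_
  intro z hz
  obtain ⟨j, -, rfl⟩ := List.mem_map.1 hz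
  exact h j

theorem T_step {g : M.Gen → H} (hg : M.Sat g) {c c'} (h : M.Step c c') :
    ∃ i, g (.rho i) * M.T g c * (g (.rho i))⁻¹ = M.T g c' := by
  obtain ⟨i, k, w, rfl, rfl⟩ := h
  refine ⟨i, ?_⟩
  have hxx : ∀ q j l, Commute (g (.x q j)) (g (.x q l)) := fun q j l => hg (.xx q j l)
  have key : ∀ (q : M.Q) (D d : M.J → ℤ) (Y : M.J → H)
      (_ : ∀ j l, Commute (Y j) (g (.x q l) ^ D l))
      (_ : ∀ j, Commute ((g (.x q j) ^ D j)⁻¹ * Y j) (M.chi g q d * g (.t q) * (M.chi g q d)⁻¹)),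
      M.chi g q (fun j => D j * k j + d j) * g (.t q) *
        (M.chi g q (fun j => D j * k j + d j))⁻¹ =
      chiL Y Finset.univ.toList k * (M.chi g q d * g (.t q) * (M.chi g q d)⁻¹) *
        (chiL Y Finset.univ.toList k)⁻¹ := by
    intro q D d Y h1 h2
    rw [← chiL_conj (fun j => g (.x q j) ^ D j) Y _
      (fun i j => ((hxx q i j).zpow_left _).zpow_right _) h1 h2, chiL_pow]
    have : M.chi g q (fun j => D j * k j + d j) =
        chiL (fun j => g (.x q j)) Finset.univ.toList (fun j => D j * k j) * M.chi g q d :=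
      chiL_add _ (hxx q) _ _ _
    rw [this]
    group
  have hs := key (M.src i) (M.D i) (M.d i) (fun j => g (.Y i j)) (fun j l => hg (.Yx i j l))
    (fun j => hg (.Yt i j))
  have ht := key (M.tgt i) (M.E i) (M.e i) (fun j => g (.Y' i j)) (fun j l => hg (.Y'x i j l))
    (fun j => hg (.Y't i j))
  have hrt := hg (.rt i)
  have hrp : Commute (g (.rho i)) (w.map fun a => g (.p a)).prod :=
    list_commute _ _ (fun a => hg (.rp i a)) w
  have hYprt : Commute (M.prt g i) (chiL (fun j => g (.Y' i j)) Finset.univ.toList k) :=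
    chiL_commute _ _ (fun j => (list_commute _ _ (fun a => hg (.Yp i j a)) _).symm) _ _
  have hrY : chiL (fun j => g (.Y' i j)) Finset.univ.toList k =
      g (.rho i) * chiL (fun j => g (.Y i j)) Finset.univ.toList k * (g (.rho i))⁻¹ := by
    have := map_chiL (MulAut.conj (g (.rho i))).toMonoidHom (fun j => g (.Y i j))
      Finset.univ.toList k
    simp only [MulEquiv.toMonoidHom_eq_coe, MonoidHom.coe_coe, MulAut.conj_apply] at this
    rw [this]
    congr 1
    funext j
    exact (hg (.rY i j)).symm
  simp only [T, List.map_append, List.prod_append]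
  rw [hs, ht]
  simp only [lhs, rhs] at hrt
  change _ = (w.map fun a => g (.p a)).prod * M.prt g i * _ *
    ((w.map fun a => g (.p a)).prod * M.prt g i)⁻¹
  generalize M.chi g (M.src i) (M.d i) * g (.t (M.src i)) * (M.chi g (M.src i) (M.d i))⁻¹ = A
    at *
  generalize M.chi g (M.tgt i) (M.e i) * g (.t (M.tgt i)) * (M.chi g (M.tgt i) (M.e i))⁻¹ = B
    at *
  generalize (w.map fun a => g (.p a)).prod = P at *
  generalize chiL (fun j => g (.Y' i j)) Finset.univ.toList k = Z at *
  generalize chiL (fun j => g (.Y i j)) Finset.univ.toList k = W at *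
  generalize g (.rho i) = ρ at *
  generalize M.prt g i = b at *
  calc _ = (ρ * P) * (W * A * W⁻¹) * (ρ * P)⁻¹ := by group
    _ = P * ((ρ * W * ρ⁻¹) * (ρ * A * ρ⁻¹) * (ρ * W * ρ⁻¹)⁻¹) * P⁻¹ := by rw [hrp.eq]; group
    _ = P * ((Z * b) * B * (Z * b)⁻¹) * P⁻¹ := by rw [← hrY, hrt]; group
    _ = _ := by rw [← hYprt.eq]; group

theorem commute_k_iff {g : M.Gen → H} (hg : M.Sat g) {c c'} (h : Relation.EqvGen M.Step c c') :
    Commute (g .k) (M.T g c) ↔ Commute (g .k) (M.T g c') := by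
  induction h with
  | rel c c' h =>
    obtain ⟨i, hi⟩ := T_step hg h
    have hk : Commute (g .k) (g (.rho i)) := hg (.kr i)
    rw [← hi]
    constructor
    · intro h
      exact (hk.mul_right h).mul_right hk.inv_right
    · intro h
      have := (hk.inv_right.mul_right h).mul_right hk
      simpa [mul_assoc] using this
  | refl => rfl
  | symm _ _ _ ih => exact ih.symm
  | trans _ _ _ _ _ ih1 ih2 => exact ih1.trans ih2

/-- If the machine relates the start to `(q1, 0, w)` then `v_w = 1`. -/
theorem v_eq_one {g : M.Gen → H} (hg : M.Sat g) (w : List (Fin r))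
    (h0 : Relation.EqvGen M.Step (M.q0, 0, []) (M.q1, 0, []))
    (h : Relation.EqvGen M.Step (M.q0, 0, []) (M.q1, 0, w)) :
    (w.map fun a => g (.v a)).prod = 1 := by
  have hb : Commute (g .k) (M.T g (M.q0, 0, [])) := by
    have h1 : Commute (g .k) (g (.t M.q0)) := hg .kt
    simpa [T, chi, chiL] using h1
  have h1 := (commute_k_iff hg h0).1 hb
  have h2 := (commute_k_iff hg h).1 hb
  simp only [T, chi, chiL, List.map_nil, List.prod_nil, Pi.zero_apply, zpow_zero, List.map_const',
    List.prod_replicate, one_pow, one_mul, inv_one, mul_one] at h1 h2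
  have hkp : ∀ w : List (Fin r), g .k * (w.map fun a => g (.p a)).prod =
      (w.map fun a => g (.p a)).prod * (w.map fun a => g (.s a)).prod * g .k := by
    intro w
    induction w with
    | nil => simp
    | cons a w ih =>
      have h3 : g .k * g (.p a) = g (.p a) * g (.s a) * g .k := hg (.kp a)
      have h4 : Commute (g (.s a)) (w.map fun a => g (.p a)).prod :=
        list_commute _ _ (fun b => (show Commute (g (.p b)) (g (.s a)) from hg (.ps b a)).symm) w
      simp only [List.map_cons, List.prod_cons]
      calc _ = (g .k * g (.p a)) * (w.map fun a => g (.p a)).prod := by group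
        _ = g (.p a) * g (.s a) * (g .k * (w.map fun a => g (.p a)).prod) := by rw [h3]; group
        _ = g (.p a) * (g (.s a) * (w.map fun a => g (.p a)).prod) *
            (w.map fun a => g (.s a)).prod * g .k := by rw [ih]; group
        _ = _ := by rw [h4.eq]; group
  have hst : ∀ w : List (Fin r), g (.t M.q1) * (w.map fun a => g (.s a)).prod =
      (w.map fun a => g (.s a)).prod * ((w.map fun a => g (.v a)).prod * g (.t M.q1)) := by
    intro w
    induction w with
    | nil => simp
    | cons a w ih =>
      have h3 : g (.t M.q1) * g (.s a) = g (.s a) * (g (.v a) * g (.t M.q1)) := hg (.st a)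
      have h4 : Commute (g (.v a)) (w.map fun a => g (.s a)).prod :=
        list_commute _ _ (fun b => (show Commute (g (.s b)) (g (.v a)) from hg (.sv b a)).symm) w
      simp only [List.map_cons, List.prod_cons]
      calc _ = (g (.t M.q1) * g (.s a)) * (w.map fun a => g (.s a)).prod := by group
        _ = g (.s a) * g (.v a) * (g (.t M.q1) * (w.map fun a => g (.s a)).prod) := by
            rw [h3]; group
        _ = g (.s a) * (g (.v a) * (w.map fun a => g (.s a)).prod) *
            ((w.map fun a => g (.v a)).prod * g (.t M.q1)) := by rw [ih]; group
        _ = _ := by rw [h4.eq]; group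
  have hk := hkp w
  have hs := hst w
  generalize (w.map fun a => g (.p a)).prod = P at *
  generalize (w.map fun a => g (.s a)).prod = s at *
  generalize (w.map fun a => g (.v a)).prod = v at *
  generalize g (.t M.q1) = t at *
  generalize g .k = k at *
  have e1 : k * (P * t * P⁻¹) = P * (s * t * s⁻¹) * P⁻¹ * k := by
    have : k * (P * t * P⁻¹) = (k * P) * t * P⁻¹ := by group
    rw [this, hk]
    have : k * t * P⁻¹ = t * (k * P⁻¹) := by rw [h1.eq]; group
    have h5 : k * P⁻¹ = s⁻¹ * P⁻¹ * k := by
      have : k = P * s * k * P⁻¹ := by rw [← hk]; group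
      calc k * P⁻¹ = s⁻¹ * P⁻¹ * (P * s * k * P⁻¹) := by group
        _ = _ := by rw [← this]
    calc _ = P * s * (k * t * P⁻¹) := by group
      _ = P * s * t * (k * P⁻¹) := by rw [this]; group
      _ = _ := by rw [h5]; group
  rw [h2.eq] at e1
  have e2 : t = s * t * s⁻¹ := by
    have := mul_right_cancel e1
    have := mul_right_cancel this
    exact mul_left_cancel this
  have e3 : t * s = s * t := by
    rw [eq_mul_inv_iff_mul_eq] at e2; exact e2
  rw [e3, mul_right_inj] at hs
  simpa using hs.symm

end CMachine

end QISimple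


set_option linter.unusedSectionVars false

namespace QISimple

/-- Length functions. -/
structure IsNorm {S : Type*} [Group S] (ν : S → ℕ) : Prop where
  one : ν 1 = 0
  mul : ∀ a b, ν (a * b) ≤ ν a + ν b
  inv : ∀ a, ν a⁻¹ = ν a
  eq_one : ∀ a, ν a = 0 → a = 1

/-- Binary size of an integer. -/
def isz (a : ℤ) : ℕ := a.natAbs.size

theorem isz_zero : isz 0 = 0 := by simp [isz]

theorem isz_neg (a : ℤ) : isz (-a) = isz a := by simp [isz]

theorem isz_add (a b : ℤ) : isz (a + b) ≤ isz a + isz b + 1 := by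
  unfold isz
  rw [Nat.size_le]
  have h1 := Nat.lt_size_self a.natAbs
  have h2 := Nat.lt_size_self b.natAbs
  have h3 : (a + b).natAbs ≤ a.natAbs + b.natAbs := Int.natAbs_add_le a b
  have h4 : 2 ^ a.natAbs.size ≤ 2 ^ (a.natAbs.size + b.natAbs.size) :=
    Nat.pow_le_pow_right (by norm_num) (by omega)
  have h5 : 2 ^ b.natAbs.size ≤ 2 ^ (a.natAbs.size + b.natAbs.size) :=
    Nat.pow_le_pow_right (by norm_num) (by omega)
  rw [pow_succ]
  omega

theorem isz_le_add (a b : ℤ) : isz a ≤ isz (a + b) + isz b + 1 := by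
  have := isz_add (a + b) (-b)
  rw [isz_neg] at this
  simpa using this

theorem isz_mul (a b : ℤ) : isz (a * b) ≤ isz a + isz b := by
  unfold isz
  rw [Nat.size_le, Int.natAbs_mul, pow_add]
  exact Nat.mul_lt_mul'' (Nat.lt_size_self _) (Nat.lt_size_self _)

theorem isz_le_mul (D k : ℤ) (hD : 0 < D) : isz k ≤ isz (D * k) := by
  unfold isz
  apply Nat.size_le_size
  rw [Int.natAbs_mul]
  exact Nat.le_mul_of_pos_left _ (by omega)

theorem isz_affine1 (D d k : ℤ) : isz (D * k + d) ≤ isz k + (isz D + isz d + 1) := by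
  have := isz_add (D * k) d
  have := isz_mul D k
  omega

theorem isz_affine2 (D d k : ℤ) (hD : 0 < D) : isz k ≤ isz (D * k + d) + (isz D + isz d + 1) := by
  have := isz_le_add (D * k) d
  have := isz_le_mul D k hD
  omega

namespace CMachine

variable {r : ℕ} (M : CMachine r) (S : Type) [Group S]

/-- Configurations of the model. -/
abbrev Cf := S × M.Q × (M.J → ℤ)

/-- The set on which the model acts. -/
abbrev ZZ := M.Cf S × ℤ × S

/-- The initial value of a rule. -/
def prS {S : Type} [Group S] (s : Fin r → S) (i : M.R) : S := ((M.pr i).toList.map s).prod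

/-- Soundness data. -/
structure Sound {S : Type} [Group S] (s : Fin r → S) (ν : S → ℕ) (hist : M.J)
    (I : M.Q → (M.J → ℤ) → Prop) (f : M.Q → (M.J → ℤ) → S) (C : ℕ) : Prop where
  norm : IsNorm ν
  hs : ∀ a, ν (s a) ≤ 1
  inv : ∀ i (k : M.J → ℤ), I (M.src i) (fun j => M.D i j * k j + M.d i j) ↔
    I (M.tgt i) (fun j => M.E i j * k j + M.e i j)
  h0 : I M.q0 0
  h1 : I M.q1 0
  f0 : f M.q0 0 = 1
  hf : ∀ i (k : M.J → ℤ), I (M.src i) (fun j => M.D i j * k j + M.d i j) →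
    f (M.src i) (fun j => M.D i j * k j + M.d i j) =
      M.prS s i * f (M.tgt i) (fun j => M.E i j * k j + M.e i j)
  hν : ∀ q α, I q α → ν (f q α) ≤ C * isz (α hist)

variable {M S}

section perms

/-- Lift of a permutation of configurations. -/
def liftC : Equiv.Perm (M.Cf S) →* Equiv.Perm (M.ZZ S) where
  toFun π := Equiv.prodCongr π (Equiv.refl _)
  map_one' := by ext z <;> rfl
  map_mul' a b := by ext z <;> rfl

@[simp] theorem liftC_apply (π : Equiv.Perm (M.Cf S)) (c : M.Cf S) (i : ℤ) (f : S) :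
    liftC π (c, i, f) = (π c, i, f) := rfl

/-- Fibrewise multiplication. -/
def fib (P : M.Cf S → ℤ → S) : Equiv.Perm (M.ZZ S) where
  toFun z := (z.1, z.2.1, P z.1 z.2.1 * z.2.2)
  invFun z := (z.1, z.2.1, (P z.1 z.2.1)⁻¹ * z.2.2)
  left_inv z := by simp
  right_inv z := by simp

@[simp] theorem fib_apply (P : M.Cf S → ℤ → S) (c : M.Cf S) (i : ℤ) (f : S) :
    fib P (c, i, f) = (c, i, P c i * f) := rfl

theorem fib_inv_apply (P : M.Cf S → ℤ → S) (c : M.Cf S) (i : ℤ) (f : S) :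
    (fib P)⁻¹ (c, i, f) = (c, i, (P c i)⁻¹ * f) := rfl

open Classical in
/-- Lamp at a configuration. -/
noncomputable def lamp (c0 : M.Cf S) : Equiv.Perm (M.ZZ S) where
  toFun z := (z.1, if z.1 = c0 then z.2.1 + 1 else z.2.1, z.2.2)
  invFun z := (z.1, if z.1 = c0 then z.2.1 - 1 else z.2.1, z.2.2)
  left_inv z := by ext <;> simp; split_ifs <;> simp
  right_inv z := by ext <;> simp; split_ifs <;> simp

open Classical in
@[simp] theorem lamp_apply (c0 c : M.Cf S) (i : ℤ) (f : S) :
    lamp c0 (c, i, f) = (c, if c = c0 then i + 1 else i, f) := rfl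

theorem liftC_lamp (π : Equiv.Perm (M.Cf S)) (c : M.Cf S) :
    liftC π * lamp c * (liftC π)⁻¹ = lamp (π c) := by
  rw [mul_inv_eq_iff_eq_mul]
  ext1 ⟨c', i, f⟩
  have : (π c' = π c) ↔ c' = c := π.injective.eq_iff
  simp only [Equiv.Perm.mul_apply, lamp_apply, liftC_apply]
  by_cases h : c' = c
  · rw [if_pos h, if_pos (this.2 h)]
  · rw [if_neg h, if_neg (mt this.1 h)]

theorem liftC_lamp_commute (π : Equiv.Perm (M.Cf S)) (c : M.Cf S) (h : π c = c) :
    liftC π * lamp c = lamp c * liftC π := by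
  rw [← mul_inv_eq_iff_eq_mul, liftC_lamp, h]

/-- printing letters -/
def pP (g : S) : Equiv.Perm (M.Cf S) := Equiv.prodCongr (Equiv.mulLeft g) (Equiv.refl _)

@[simp] theorem pP_apply (g u : S) (q : M.Q) (α : M.J → ℤ) :
    (pP g : Equiv.Perm (M.Cf S)) (u, q, α) = (g * u, q, α) := rfl

open Classical in
/-- shift counters in a given state -/
noncomputable def sh (q : M.Q) (β : M.J → ℤ) : Equiv.Perm (M.Cf S) where
  toFun c := (c.1, c.2.1, if c.2.1 = q then c.2.2 + β else c.2.2)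
  invFun c := (c.1, c.2.1, if c.2.1 = q then c.2.2 - β else c.2.2)
  left_inv c := by ext : 2 <;> simp; split_ifs <;> simp
  right_inv c := by ext : 2 <;> simp; split_ifs <;> simp

open Classical in
@[simp] theorem sh_apply (q q' : M.Q) (β α : M.J → ℤ) (u : S) :
    (sh q β : Equiv.Perm (M.Cf S)) (u, q', α) = (u, q', if q' = q then α + β else α) := rfl

theorem sh_add (q : M.Q) (β γ : M.J → ℤ) :
    (sh q (β + γ) : Equiv.Perm (M.Cf S)) = sh q β * sh q γ := by
  ext1 ⟨u, q', α⟩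
  simp only [Equiv.Perm.mul_apply, sh_apply]
  split_ifs <;> simp [add_comm, add_left_comm]

/-- shift as a homomorphism -/
noncomputable def shHom (q : M.Q) : Multiplicative (M.J → ℤ) →* Equiv.Perm (M.Cf S) :=
  MonoidHom.mk' (fun β => sh q β.toAdd) (fun _ _ => sh_add q _ _)

theorem sh_zpow (q : M.Q) (β : M.J → ℤ) (n : ℤ) :
    (sh q β : Equiv.Perm (M.Cf S)) ^ n = sh q (n • β) :=
  (map_zpow (shHom q) (Multiplicative.ofAdd β) n).symm

theorem sh_neg (q : M.Q) (β : M.J → ℤ) :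
    (sh q β : Equiv.Perm (M.Cf S))⁻¹ = sh q (-β) :=
  (map_inv (shHom q) (Multiplicative.ofAdd β)).symm

theorem sh_zero (q : M.Q) : (sh q 0 : Equiv.Perm (M.Cf S)) = 1 := map_one (shHom q)

open Classical in
theorem chiL_sh (q : M.Q) (α : M.J → ℤ) :
    chiL (fun j => (sh q (Pi.single j 1) : Equiv.Perm (M.Cf S))) Finset.univ.toList α =
      sh q α := by
  have h : ∀ l : List M.J, chiL (fun j => (sh q (Pi.single j 1) : Equiv.Perm (M.Cf S))) l α =
      sh q (l.map fun j => Pi.single j (α j)).sum := by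
    intro l
    induction l with
    | nil => simp [chiL, sh_zero]
    | cons j l ih =>
      simp only [chiL, List.map_cons, List.prod_cons, List.sum_cons] at ih ⊢
      rw [ih, sh_add, sh_zpow]
      congr 2
      ext x
      by_cases hx : x = j
      · subst hx; simp
      · simp [hx]
  rw [h]
  congr 1
  rw [Finset.sum_map_toList]
  exact Finset.univ_sum_single α

/-- Congruence classes of configurations. -/
def cls (q : M.Q) (D d : M.J → ℤ) (c : M.Cf S) : Prop :=
  c.2.1 = q ∧ ∀ l, D l ∣ c.2.2 l - d l

theorem cls_mk (q : M.Q) (D d k : M.J → ℤ) (u : S) :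
    cls q D d (u, q, fun l => D l * k l + d l) := ⟨rfl, fun l => by simp⟩

theorem cls_iff (q : M.Q) (D d : M.J → ℤ) (c : M.Cf S) :
    cls q D d c ↔ ∃ (u : S) (k : M.J → ℤ), c = (u, q, fun l => D l * k l + d l) := by
  constructor
  · rintro ⟨h1, h2⟩
    choose k hk using h2
    refine ⟨c.1, k, ?_⟩
    ext1
    · rfl
    · ext1
      · exact h1
      · funext l
        have := hk l
        simp only
        linarith
  · rintro ⟨u, k, rfl⟩
    exact cls_mk q D d k u

open Classical in
theorem cls_shift (q : M.Q) (D d : M.J → ℤ) (u : S) (q' : M.Q) (α : M.J → ℤ) (j : M.J) (n : ℤ) :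
    cls q D d (u, q', α + n • Pi.single j (D j)) ↔ cls q D d (u, q', α) := by
  unfold cls
  simp only [Pi.add_apply, Pi.smul_apply, smul_eq_mul]
  refine and_congr_right fun _ => forall_congr' fun l => ?_
  have : D l ∣ n * (Pi.single j (D j) : M.J → ℤ) l := by
    by_cases h : l = j
    · subst h; simp
    · simp [h]
  rw [show α l + n * (Pi.single j (D j) : M.J → ℤ) l - d l =
    (α l - d l) + n * (Pi.single j (D j) : M.J → ℤ) l by ring]
  exact dvd_add_left this

open Classical in
/-- shift on a class -/
noncomputable def Ysh (q : M.Q) (D d : M.J → ℤ) (j : M.J) : Equiv.Perm (M.Cf S) where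
  toFun c := (c.1, c.2.1, if cls q D d c then c.2.2 + Pi.single j (D j) else c.2.2)
  invFun c := (c.1, c.2.1, if cls q D d c then c.2.2 - Pi.single j (D j) else c.2.2)
  left_inv c := by
    obtain ⟨u, q', α⟩ := c
    have := cls_shift q D d u q' α j 1
    rw [one_smul] at this
    ext : 2
    · rfl
    · rfl
    · dsimp only
      by_cases h : cls q D d (u, q', α)
      · simp [h, this]
      · simp [h]
  right_inv c := by
    obtain ⟨u, q', α⟩ := c
    have := cls_shift q D d u q' α j (-1)
    rw [neg_one_smul, ← sub_eq_add_neg] at this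
    ext : 2
    · rfl
    · rfl
    · dsimp only
      by_cases h : cls q D d (u, q', α)
      · simp [h, this]
      · simp [h]

open Classical in
@[simp] theorem Ysh_apply (q q' : M.Q) (D d α : M.J → ℤ) (j : M.J) (u : S) :
    (Ysh q D d j : Equiv.Perm (M.Cf S)) (u, q', α) =
      (u, q', if cls q D d (u, q', α) then α + Pi.single j (D j) else α) := rfl

theorem Ysh_commute (q : M.Q) (D d : M.J → ℤ) (j l : M.J) [DecidableEq M.J] :
    Commute (Ysh q D d j : Equiv.Perm (M.Cf S)) (sh q (Pi.single l (D l))) := by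
  classical
  ext1 ⟨u, q', α⟩
  have := cls_shift q D d u q' α l 1
  rw [one_smul] at this
  simp only [Equiv.Perm.mul_apply, sh_apply, Ysh_apply]
  by_cases hq : q' = q
  · subst hq
    by_cases h : cls q' D d (u, q', α)
    · have h2 := this.2 h
      simp only [↓reduceIte, h, add_right_comm]
      rw [if_pos]
      convert h2
    · have h2 := mt this.1 h
      simp only [↓reduceIte, h]
      rw [if_neg]
      intro h3; apply h2; convert h3
  · have h : ¬ cls q D d (u, q', α) := fun h => hq h.1
    simp [hq, h]

open Classical in
/-- The involution of a rule, as a function. -/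
noncomputable def rhoFun (s : Fin r → S) (i : M.R) (c : M.Cf S) : M.Cf S :=
  if cls (M.src i) (M.D i) (M.d i) c then
    (c.1 * M.prS s i, M.tgt i, fun l => M.E i l * ((c.2.2 l - M.d i l) / M.D i l) + M.e i l)
  else if cls (M.tgt i) (M.E i) (M.e i) c then
    (c.1 * (M.prS s i)⁻¹, M.src i,
      fun l => M.D i l * ((c.2.2 l - M.e i l) / M.E i l) + M.d i l)
  else c

theorem rhoFun_src (s : Fin r → S) (i : M.R) (u : S) (k : M.J → ℤ) :
    rhoFun s i (u, M.src i, fun l => M.D i l * k l + M.d i l) =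
      (u * M.prS s i, M.tgt i, fun l => M.E i l * k l + M.e i l) := by
  rw [rhoFun, if_pos (cls_mk _ _ _ _ _)]
  have : ∀ l, M.D i l * k l / M.D i l = k l := fun l =>
    Int.mul_ediv_cancel_left _ (M.hD i l).ne'
  simp [this]

theorem rhoFun_tgt (s : Fin r → S) (i : M.R) (u : S) (k : M.J → ℤ) :
    rhoFun s i (u, M.tgt i, fun l => M.E i l * k l + M.e i l) =
      (u * (M.prS s i)⁻¹, M.src i, fun l => M.D i l * k l + M.d i l) := by
  rw [rhoFun, if_neg (fun h => M.hne i h.1.symm), if_pos (cls_mk _ _ _ _ _)]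
  have : ∀ l, M.E i l * k l / M.E i l = k l := fun l =>
    Int.mul_ediv_cancel_left _ (M.hE i l).ne'
  simp [this]

theorem rhoFun_cases (s : Fin r → S) (i : M.R) (c : M.Cf S) :
    (∃ (u : S) (k : M.J → ℤ), c = (u, M.src i, fun l => M.D i l * k l + M.d i l) ∧
      rhoFun s i c = (u * M.prS s i, M.tgt i, fun l => M.E i l * k l + M.e i l)) ∨
    (∃ (u : S) (k : M.J → ℤ), c = (u, M.tgt i, fun l => M.E i l * k l + M.e i l) ∧
      rhoFun s i c = (u * (M.prS s i)⁻¹, M.src i, fun l => M.D i l * k l + M.d i l)) ∨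
    (¬ cls (M.src i) (M.D i) (M.d i) c ∧ ¬ cls (M.tgt i) (M.E i) (M.e i) c ∧
      rhoFun s i c = c) := by
  by_cases h1 : cls (M.src i) (M.D i) (M.d i) c
  · obtain ⟨u, k, rfl⟩ := (cls_iff _ _ _ _).1 h1
    exact Or.inl ⟨u, k, rfl, rhoFun_src s i u k⟩
  · by_cases h2 : cls (M.tgt i) (M.E i) (M.e i) c
    · obtain ⟨u, k, rfl⟩ := (cls_iff _ _ _ _).1 h2
      exact Or.inr (Or.inl ⟨u, k, rfl, rhoFun_tgt s i u k⟩)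
    · exact Or.inr (Or.inr ⟨h1, h2, by rw [rhoFun, if_neg h1, if_neg h2]⟩)

theorem rhoFun_invol (s : Fin r → S) (i : M.R) :
    Function.Involutive (rhoFun s i : M.Cf S → M.Cf S) := by
  intro c
  rcases rhoFun_cases s i c with ⟨u, k, rfl, h⟩ | ⟨u, k, rfl, h⟩ | ⟨-, -, h⟩
  · rw [h, rhoFun_tgt]; simp
  · rw [h, rhoFun_src]; simp
  · rw [h, h]

/-- The involution of a rule. -/
noncomputable def rhoP (s : Fin r → S) (i : M.R) : Equiv.Perm (M.Cf S) :=
  (rhoFun_invol s i).toPerm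

theorem rhoP_apply (s : Fin r → S) (i : M.R) (c : M.Cf S) : rhoP s i c = rhoFun s i c := rfl

theorem rhoP_Y (s : Fin r → S) (i : M.R) (j : M.J) :
    (rhoP s i : Equiv.Perm (M.Cf S)) * Ysh (M.src i) (M.D i) (M.d i) j =
      Ysh (M.tgt i) (M.E i) (M.e i) j * rhoP s i := by
  classical
  have hshift : ∀ (D d k : M.J → ℤ), (fun l => D l * k l + d l) + Pi.single j (D j) =
      fun l => D l * (k + Pi.single j 1 : M.J → ℤ) l + d l := by
    intro D d k
    funext l
    by_cases h : l = j
    · subst h; simp; ring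
    · simp [h]
  ext1 c
  simp only [Equiv.Perm.mul_apply, rhoP_apply]
  rcases rhoFun_cases s i c with ⟨u, k, rfl, h⟩ | ⟨u, k, rfl, h⟩ | ⟨h1, h2, h⟩
  · rw [h, Ysh_apply, Ysh_apply, if_pos (cls_mk _ _ _ _ _), if_pos (cls_mk _ _ _ _ _),
      hshift, hshift, rhoFun_src]
  · rw [h, Ysh_apply, Ysh_apply, if_neg (fun h => M.hne i h.1.symm),
      if_neg (fun h => M.hne i h.1), h]
  · obtain ⟨u, q, α⟩ := c
    rw [h, Ysh_apply, if_neg h1, Ysh_apply, if_neg h2, h]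

end perms

end CMachine

end QISimple


set_option linter.unusedSectionVars false

namespace QISimple

theorem perm_apply_inv {α : Type*} (a : Equiv.Perm α) (z : α) : a (a⁻¹ z) = z :=
  a.apply_symm_apply z

theorem perm_inv_apply {α : Type*} (a : Equiv.Perm α) (z : α) : a⁻¹ (a z) = z :=
  a.symm_apply_apply z

namespace CMachine

variable {r : ℕ} {M : CMachine r} {S : Type} [Group S]

/-- depth of a configuration -/
def dep (ν : S → ℕ) (hist : M.J) (C : ℕ) (c : M.Cf S) : ℕ := ν c.1 + C * isz (c.2.2 hist)

/-- The filtration. -/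
def Bd (ν : S → ℕ) (hist : M.J) (C : ℕ) (n : ℕ) (π : Equiv.Perm (M.ZZ S)) : Prop :=
  ∀ z : M.ZZ S, ν ((π z).2.2 * z.2.2⁻¹) ≤ n ∧
    dep ν hist C (π z).1 ≤ dep ν hist C z.1 + n ∧ dep ν hist C z.1 ≤ dep ν hist C (π z).1 + n ∧
    ((π z).2.1 ≠ z.2.1 → dep ν hist C z.1 ≤ n ∧ dep ν hist C (π z).1 ≤ n)

theorem Bd_filtration {ν : S → ℕ} (hν : IsNorm ν) (hist : M.J) (C : ℕ) :
    IsFiltration (Bd ν hist C) where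
  one n z := by simp [hν.one]
  mul n m a b ha hb z := by
    obtain ⟨b1, b2, b3, b4⟩ := hb z
    obtain ⟨a1, a2, a3, a4⟩ := ha (b z)
    rw [Equiv.Perm.mul_apply]
    refine ⟨?_, by omega, by omega, ?_⟩
    · have := hν.mul ((a (b z)).2.2 * (b z).2.2⁻¹) ((b z).2.2 * z.2.2⁻¹)
      have e : (a (b z)).2.2 * (b z).2.2⁻¹ * ((b z).2.2 * z.2.2⁻¹) =
        (a (b z)).2.2 * z.2.2⁻¹ := by group
      rw [e] at this
      omega
    · intro h
      by_cases h1 : (b z).2.1 = z.2.1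
      · rw [← h1] at h
        have := a4 h
        omega
      · have := b4 h1
        omega
  inv n a ha z := by
    obtain ⟨a1, a2, a3, a4⟩ := ha (a⁻¹ z)
    rw [perm_apply_inv] at a1 a2 a3 a4
    refine ⟨?_, by omega, by omega, ?_⟩
    · rw [← hν.inv]; simpa using a1
    · intro h
      have := a4 (Ne.symm h)
      omega

theorem Bd_liftC {ν : S → ℕ} (hν : IsNorm ν) (hist : M.J) (C : ℕ) (n : ℕ)
    (π : Equiv.Perm (M.Cf S)) (h : ∀ c, dep ν hist C (π c) ≤ dep ν hist C c + n ∧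
      dep ν hist C c ≤ dep ν hist C (π c) + n) : Bd ν hist C n (liftC π) := by
  rintro ⟨c, i, f⟩
  simp [hν.one, h c]

theorem Bd_fib {ν : S → ℕ} (hist : M.J) (C : ℕ) (n : ℕ)
    (P : M.Cf S → ℤ → S) (h : ∀ c i, ν (P c i) ≤ n) : Bd ν hist C n (fib P) := by
  rintro ⟨c, i, f⟩
  simp [h]

theorem Bd_lamp {ν : S → ℕ} (hν : IsNorm ν) (hist : M.J) (C : ℕ)
    (q : M.Q) : Bd ν hist C 0 (lamp ((1, q, 0) : M.Cf S)) := by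
  classical
  rintro ⟨c, i, f⟩
  simp only [lamp_apply, mul_inv_cancel, hν.one, le_refl, true_and]
  refine ⟨by omega, by omega, fun h => ?_⟩
  have : c = (1, q, 0) := by
    by_contra hc
    simp [hc] at h
  subst this
  simp [dep, hν.one, isz_zero]

variable (M)

open Classical in
/-- The `s` and `v` multipliers and `k`. -/
noncomputable def sFib (I : M.Q → (M.J → ℤ) → Prop) (g : S) (c : M.Cf S) (i : ℤ) : S :=
  if i ≤ 0 ∧ I c.2.1 c.2.2 then g else 1

open Classical in
noncomputable def vFib (g : S) (c : M.Cf S) (i : ℤ) : S :=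
  if i = 1 ∧ c = (1, M.q1, 0) then g else 1

open Classical in
noncomputable def kFib (I : M.Q → (M.J → ℤ) → Prop) (f : M.Q → (M.J → ℤ) → S)
    (c : M.Cf S) (i : ℤ) : S :=
  if i ≤ 0 ∧ I c.2.1 c.2.2 then c.1 * f c.2.1 c.2.2 else 1

open Classical in
/-- The model without the stable letter. -/
noncomputable def mdl (s : Fin r → S) (I : M.Q → (M.J → ℤ) → Prop) : M.Gen → Equiv.Perm (M.ZZ S)
  | .p a => liftC (pP (s a))
  | .s a => fib (M.sFib I (s a))
  | .v a => fib (M.vFib (s a))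
  | .t q => lamp (1, q, 0)
  | .x q j => liftC (sh q (Pi.single j 1))
  | .rho i => liftC (rhoP s i)
  | .Y i j => liftC (Ysh (M.src i) (M.D i) (M.d i) j)
  | .Y' i j => liftC (Ysh (M.tgt i) (M.E i) (M.e i) j)
  | .k => 1

/-- The subgroup `A`. -/
def subA (I : M.Q → (M.J → ℤ) → Prop) (f : M.Q → (M.J → ℤ) → S) :
    Subgroup (Equiv.Perm (M.ZZ S)) where
  carrier := {π | ∃ g0 : S, ∀ z : M.ZZ S, (π z).2.2 = z.2.2 ∧
    (I (π z).1.2.1 (π z).1.2.2 ↔ I z.1.2.1 z.1.2.2) ∧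
    (I z.1.2.1 z.1.2.2 → (π z).1.1 * f (π z).1.2.1 (π z).1.2.2 = g0 * (z.1.1 * f z.1.2.1 z.1.2.2)) ∧
    ((π z).2.1 ≠ z.2.1 → I z.1.2.1 z.1.2.2)}
  one_mem' := ⟨1, fun z => by simp⟩
  mul_mem' := by
    rintro a b ⟨g, ha⟩ ⟨h, hb⟩
    refine ⟨g * h, fun z => ?_⟩
    obtain ⟨b1, b2, b3, b4⟩ := hb z
    obtain ⟨a1, a2, a3, a4⟩ := ha (b z)
    rw [Equiv.Perm.mul_apply]
    refine ⟨a1.trans b1, a2.trans b2, fun h => ?_, fun h => ?_⟩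
    · rw [a3 (b2.2 h), b3 h, mul_assoc]
    · by_cases h1 : (b z).2.1 = z.2.1
      · rw [← h1] at h
        exact b2.1 (a4 h)
      · exact b4 h1
  inv_mem' := by
    rintro a ⟨g, ha⟩
    refine ⟨g⁻¹, fun z => ?_⟩
    obtain ⟨a1, a2, a3, a4⟩ := ha (a⁻¹ z)
    rw [perm_apply_inv] at a1 a2 a3 a4
    refine ⟨a1.symm, a2.symm, fun h => ?_, fun h => ?_⟩
    · rw [a3 (a2.1 h)]; group
    · exact a2.2 (a4 (Ne.symm h))

/-- The conjugated subgroup. -/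
noncomputable def subB (I : M.Q → (M.J → ℤ) → Prop) (f : M.Q → (M.J → ℤ) → S) :
    Subgroup (Equiv.Perm (M.ZZ S)) :=
  (M.subA I f).map (MulAut.conj (fib (M.kFib I f))).toMonoidHom

/-- The isomorphism. -/
noncomputable def isoAB (I : M.Q → (M.J → ℤ) → Prop) (f : M.Q → (M.J → ℤ) → S) :
    M.subA I f ≃* M.subB I f :=
  (M.subA I f).equivMapOfInjective _ (MulAut.conj (fib (M.kFib I f))).injective

theorem isoAB_apply (I : M.Q → (M.J → ℤ) → Prop) (f : M.Q → (M.J → ℤ) → S) (a : M.subA I f) :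
    (M.isoAB I f a : Equiv.Perm (M.ZZ S)) = fib (M.kFib I f) * a * (fib (M.kFib I f))⁻¹ := rfl

variable {M}

theorem Bd_iso {s : Fin r → S} {ν : S → ℕ} {hist : M.J} {I : M.Q → (M.J → ℤ) → Prop}
    {f : M.Q → (M.J → ℤ) → S} {C : ℕ} (h : M.Sound s ν hist I f C) (n : ℕ) (a : M.subA I f) :
    Bd ν hist C n (a : Equiv.Perm (M.ZZ S)) ↔
      Bd ν hist C n (M.isoAB I f a : Equiv.Perm (M.ZZ S)) := by
  classical
  obtain ⟨a, g0, ha⟩ := a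
  rw [isoAB_apply]
  simp only
  have key : ∀ z : M.ZZ S, (fib (M.kFib I f) * a * (fib (M.kFib I f))⁻¹) z =
      ((a (z.1, z.2.1, (M.kFib I f z.1 z.2.1)⁻¹ * z.2.2)).1,
        (a (z.1, z.2.1, (M.kFib I f z.1 z.2.1)⁻¹ * z.2.2)).2.1,
        M.kFib I f (a (z.1, z.2.1, (M.kFib I f z.1 z.2.1)⁻¹ * z.2.2)).1
          (a (z.1, z.2.1, (M.kFib I f z.1 z.2.1)⁻¹ * z.2.2)).2.1 *
          ((M.kFib I f z.1 z.2.1)⁻¹ * z.2.2)) := by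
    rintro ⟨c, i, x⟩
    rw [Equiv.Perm.mul_apply, fib_inv_apply, Equiv.Perm.mul_apply]
    have := (ha (c, i, (M.kFib I f c i)⁻¹ * x)).1
    simp only at this ⊢
    conv_lhs => rw [show a (c, i, (M.kFib I f c i)⁻¹ * x) =
      ((a (c, i, (M.kFib I f c i)⁻¹ * x)).1, (a (c, i, (M.kFib I f c i)⁻¹ * x)).2.1,
        (a (c, i, (M.kFib I f c i)⁻¹ * x)).2.2) from rfl]
    rw [fib_apply, this]
  have hdep : ∀ c : M.Cf S, I c.2.1 c.2.2 → ν (c.1 * f c.2.1 c.2.2) ≤ dep ν hist C c := by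
    intro c hc
    have := h.norm.mul c.1 (f c.2.1 c.2.2)
    have := h.hν _ _ hc
    unfold dep
    omega
  constructor
  · intro hb
    have hg0 : ν g0 ≤ n := by
      have h1 := ha ((1, M.q0, 0), 0, 1)
      have h2 := h1.2.2.1 h.h0
      have h3 := hdep _ (h1.2.1.2 h.h0)
      simp only [h.f0, mul_one] at h2
      rw [h2] at h3
      have h4 := (hb ((1, M.q0, 0), 0, 1)).2.1
      have h5 : dep ν hist C ((1, M.q0, 0) : M.Cf S) = 0 := by
        simp [dep, h.norm.one, isz_zero]
      rw [h5] at h4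
      omega
    intro z
    rw [key z]
    obtain ⟨c, i, x⟩ := z
    simp only
    have hb' := hb (c, i, (M.kFib I f c i)⁻¹ * x)
    have ha' := ha (c, i, (M.kFib I f c i)⁻¹ * x)
    generalize a (c, i, (M.kFib I f c i)⁻¹ * x) = y at hb' ha'
    obtain ⟨c', i', x'⟩ := y
    simp only at hb' ha' ⊢
    refine ⟨?_, hb'.2.1, hb'.2.2.1, hb'.2.2.2⟩
    rw [mul_assoc, mul_assoc, mul_inv_cancel, mul_one]
    obtain ⟨a1, a2, a3, a4⟩ := ha'
    by_cases hI : I c.2.1 c.2.2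
    · have hI' := a2.2 hI
      have a3 := a3 hI
      have d1 := hdep c hI
      have d2 := hdep c' hI'
      by_cases hi : i ≤ 0
      · by_cases hi' : i' ≤ 0
        · simp only [kFib, hi, hi', hI, hI', and_self, ↓reduceIte]
          rw [a3, mul_inv_cancel_right]
          exact hg0
        · have := hb'.2.2.2 (by omega)
          simp only [kFib, hi, hi', hI, hI', and_self, ↓reduceIte, false_and, one_mul]
          rw [h.norm.inv]
          omega
      · by_cases hi' : i' ≤ 0
        · have := hb'.2.2.2 (by omega)
          simp only [kFib, hi, hi', hI, hI', and_self, ↓reduceIte, false_and, inv_one, mul_one]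
          omega
        · simp [kFib, hi, hi', h.norm.one]
    · have hI' := mt a2.1 hI
      simp [kFib, hI, hI', h.norm.one]
  · intro hb z
    obtain ⟨c, i, x⟩ := z
    have hb' := hb (c, i, M.kFib I f c i * x)
    rw [key] at hb'
    simp only [inv_mul_cancel_left] at hb'
    have ha' := ha (c, i, x)
    refine ⟨?_, hb'.2.1, hb'.2.2.1, hb'.2.2.2⟩
    rw [ha'.1]
    simp [h.norm.one]

theorem mdl_Bd {s : Fin r → S} {ν : S → ℕ} {hist : M.J} {I : M.Q → (M.J → ℤ) → Prop}
    {f : M.Q → (M.J → ℤ) → S} {C : ℕ} (h : M.Sound s ν hist I f C) (y : M.Gen) :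
    ∃ n, Bd ν hist C n (M.mdl s I y) := by
  classical
  have hshift : ∀ (b a : ℤ), C * isz (a + b) ≤ C * isz a + C * (isz b + 1) ∧
      C * isz a ≤ C * isz (a + b) + C * (isz b + 1) := by
    intro b a
    rw [← mul_add, ← mul_add]
    constructor
    · exact Nat.mul_le_mul_left _ (by have := isz_add a b; omega)
    · exact Nat.mul_le_mul_left _ (by have := isz_le_add a b; omega)
  cases y with
  | p a =>
    refine ⟨1, Bd_liftC h.norm _ _ _ _ ?_⟩
    rintro ⟨u, q, α⟩
    have h1 := h.norm.mul (s a) u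
    have h2 := h.norm.mul (s a)⁻¹ (s a * u)
    have h3 := h.hs a
    rw [h.norm.inv, inv_mul_cancel_left] at h2
    simp only [pP_apply, dep]
    omega
  | s a =>
    refine ⟨1, Bd_fib _ _ _ _ ?_⟩
    intro c i
    unfold sFib
    split_ifs
    · exact h.hs a
    · simp [h.norm.one]
  | v a =>
    refine ⟨1, Bd_fib _ _ _ _ ?_⟩
    intro c i
    unfold vFib
    split_ifs
    · exact h.hs a
    · simp [h.norm.one]
  | t q => exact ⟨0, Bd_lamp h.norm _ _ q⟩
  | x q j =>
    refine ⟨_, Bd_liftC h.norm _ _ (C * (isz ((Pi.single j 1 : M.J → ℤ) hist) + 1)) _ ?_⟩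
    rintro ⟨u, q', α⟩
    have := hshift ((Pi.single j 1 : M.J → ℤ) hist) (α hist)
    simp only [sh_apply, dep]
    split_ifs
    · simp only [Pi.add_apply]
      omega
    · omega
  | rho i =>
    refine ⟨_, Bd_liftC h.norm _ _ (ν (M.prS s i) + C * ((isz (M.D i hist) + isz (M.d i hist) + 1) +
      (isz (M.E i hist) + isz (M.e i hist) + 1))) _ ?_⟩
    have key : ∀ k : ℤ, (C * isz (M.D i hist * k + M.d i hist) ≤
        C * isz (M.E i hist * k + M.e i hist) +
        C * ((isz (M.D i hist) + isz (M.d i hist) + 1) +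
      (isz (M.E i hist) + isz (M.e i hist) + 1))) ∧ (C * isz (M.E i hist * k + M.e i hist) ≤
        C * isz (M.D i hist * k + M.d i hist) +
        C * ((isz (M.D i hist) + isz (M.d i hist) + 1) +
      (isz (M.E i hist) + isz (M.e i hist) + 1))) := by
      intro k
      have h1 := isz_affine1 (M.D i hist) (M.d i hist) k
      have h2 := isz_affine2 (M.D i hist) (M.d i hist) k (M.hD i hist)
      have h3 := isz_affine1 (M.E i hist) (M.e i hist) k
      have h4 := isz_affine2 (M.E i hist) (M.e i hist) k (M.hE i hist)
      rw [← mul_add, ← mul_add]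
      exact ⟨Nat.mul_le_mul_left _ (by omega), Nat.mul_le_mul_left _ (by omega)⟩
    have hmul : ∀ u b : S, ν (u * b) ≤ ν u + ν b ∧ ν u ≤ ν (u * b) + ν b := by
      intro u b
      refine ⟨h.norm.mul u b, ?_⟩
      have := h.norm.mul (u * b) b⁻¹
      rwa [h.norm.inv, mul_inv_cancel_right] at this
    intro c
    rw [rhoP_apply]
    rcases rhoFun_cases s i c with ⟨u, k, rfl, hc⟩ | ⟨u, k, rfl, hc⟩ | ⟨h1, h2, hc⟩
    · rw [hc]
      have := key (k hist)
      have := hmul u (M.prS s i)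
      simp only [dep]
      omega
    · rw [hc]
      have := key (k hist)
      have := hmul u (M.prS s i)⁻¹
      rw [h.norm.inv] at this
      simp only [dep]
      omega
    · rw [hc]; omega
  | Y i j =>
    refine ⟨_, Bd_liftC h.norm _ _
      (C * (isz ((Pi.single j (M.D i j) : M.J → ℤ) hist) + 1)) _ ?_⟩
    rintro ⟨u, q', α⟩
    have := hshift ((Pi.single j (M.D i j) : M.J → ℤ) hist) (α hist)
    simp only [Ysh_apply, dep]
    split_ifs
    · simp only [Pi.add_apply]
      omega
    · omega
  | Y' i j =>
    refine ⟨_, Bd_liftC h.norm _ _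
      (C * (isz ((Pi.single j (M.E i j) : M.J → ℤ) hist) + 1)) _ ?_⟩
    rintro ⟨u, q', α⟩
    have := hshift ((Pi.single j (M.E i j) : M.J → ℤ) hist) (α hist)
    simp only [Ysh_apply, dep]
    split_ifs
    · simp only [Pi.add_apply]
      omega
    · omega
  | k => exact ⟨0, (Bd_filtration h.norm hist C).one 0⟩

theorem chi_mdl (s : Fin r → S) (I : M.Q → (M.J → ℤ) → Prop) (q : M.Q) (α : M.J → ℤ) :
    M.chi (M.mdl s I) q α = liftC (sh q α) := by
  classical
  rw [← chiL_sh, map_chiL]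
  unfold chi
  congr 1

theorem prt_mdl (s : Fin r → S) (I : M.Q → (M.J → ℤ) → Prop) (i : M.R) :
    M.prt (M.mdl s I) i = liftC (pP (M.prS s i)) := by
  unfold prt prS
  rcases M.pr i with _ | a
  · simp only [Option.toList_none, List.map_nil, List.prod_nil]
    ext1 ⟨⟨u, q, α⟩, i, f⟩
    simp
  · simp [mdl]


theorem fib_ext {P P' : M.Cf S → ℤ → S} (h : ∀ c i, P c i = P' c i) : fib P = fib P' := by
  have : P = P' := by funext c i; exact h c i
  rw [this]

theorem fib_mul (P P' : M.Cf S → ℤ → S) : fib P * fib P' = fib (fun c i => P c i * P' c i) := by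
  ext1 ⟨c, i, f⟩
  simp [mul_assoc]

variable (M) in
/-- Representing the whole group in the HNN extension. -/
noncomputable def hmdl (s : Fin r → S) (I : M.Q → (M.J → ℤ) → Prop) (f : M.Q → (M.J → ℤ) → S) :
    M.Gen → HNNExtension _ (M.subA I f) (M.subB I f) (M.isoAB I f)
  | .k => HNNExtension.t
  | y => HNNExtension.of (M.mdl s I y)

variable (M) in
theorem hnn_comm {I : M.Q → (M.J → ℤ) → Prop} {f : M.Q → (M.J → ℤ) → S}
    (a b : Equiv.Perm (M.ZZ S)) (ha : a ∈ M.subA I f)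
    (hab : fib (M.kFib I f) * a = b * fib (M.kFib I f)) :
    (HNNExtension.t * HNNExtension.of a : HNNExtension _ (M.subA I f) (M.subB I f) (M.isoAB I f)) =
      HNNExtension.of b * HNNExtension.t := by
  have := HNNExtension.t_mul_of (φ := M.isoAB I f) ⟨a, ha⟩
  rw [this, isoAB_apply]
  simp only
  rw [hab, mul_inv_cancel_right]

theorem hmdl_sat {s : Fin r → S} {ν : S → ℕ} {hist : M.J} {I : M.Q → (M.J → ℤ) → Prop}
    {f : M.Q → (M.J → ℤ) → S} {C : ℕ} (h : M.Sound s ν hist I f C) : M.Sat (M.hmdl s I f) := by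
  classical
  have red : ∀ R, M.lhs (M.mdl s I) R = M.rhs (M.mdl s I) R →
      M.lhs (fun y => (HNNExtension.of (M.mdl s I y) :
        HNNExtension _ (M.subA I f) (M.subB I f) (M.isoAB I f))) R =
      M.rhs (fun y => (HNNExtension.of (M.mdl s I y) :
        HNNExtension _ (M.subA I f) (M.subB I f) (M.isoAB I f))) R := by
    intro R hR
    rw [← M.map_lhs, ← M.map_rhs, hR]
  intro R
  cases R with
  | sv a b =>
    refine red (.sv a b) ?_
    simp only [lhs, rhs, mdl]
    rw [fib_mul, fib_mul]
    refine fib_ext fun c i => ?_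
    unfold sFib vFib
    by_cases h1 : i = 1
    · subst h1; simp
    · simp [h1]
  | st a =>
    refine red (.st a) ?_
    simp only [lhs, rhs, mdl]
    ext1 ⟨c, i, x⟩
    simp only [Equiv.Perm.mul_apply, lamp_apply, fib_apply]
    by_cases hc : c = (1, M.q1, 0)
    · subst hc
      simp only [↓reduceIte, sFib, vFib, and_true, h.h1]
      by_cases h1 : i = 0
      · subst h1; simp
      · by_cases h2 : i ≤ 0
        · have h3 : i + 1 ≤ 0 := by omega
          simp [h1, h2, h3]
        · have h3 : ¬ (i + 1 ≤ 0) := by omega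
          simp [h1, h2, h3]
    · simp [hc, vFib]
  | ps a b =>
    refine red (.ps a b) ?_
    simp only [lhs, rhs, mdl]
    ext1 ⟨⟨u, q, α⟩, i, x⟩
    simp [sFib]
  | kp a =>
    simp only [lhs, rhs, hmdl]
    rw [← map_mul]
    refine hnn_comm M _ _ ?_ ?_
    · refine ⟨s a, ?_⟩
      rintro ⟨⟨u, q, α⟩, i, x⟩
      simp [mdl, mul_assoc]
    · ext1 ⟨⟨u, q, α⟩, i, x⟩
      simp only [mdl, Equiv.Perm.mul_apply, liftC_apply, fib_apply, pP_apply, kFib, sFib]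
      split_ifs <;> simp [mul_assoc]
  | kt =>
    simp only [lhs, rhs, hmdl]
    refine hnn_comm M _ _ ?_ ?_
    · refine ⟨1, ?_⟩
      rintro ⟨c, i, x⟩
      simp only [mdl, lamp_apply, true_and, one_mul, implies_true]
      intro h1
      have : c = (1, M.q0, 0) := by
        by_contra hc
        simp [hc] at h1
      subst this
      exact h.h0
    · ext1 ⟨c, i, x⟩
      simp only [mdl, Equiv.Perm.mul_apply, lamp_apply, fib_apply]
      by_cases hc : c = (1, M.q0, 0)
      · subst hc
        simp [kFib, h.f0]
      · simp [hc]
  | kr i =>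
    have hrho : ∀ c : M.Cf S, (I (rhoFun s i c).2.1 (rhoFun s i c).2.2 ↔ I c.2.1 c.2.2) ∧
        (I c.2.1 c.2.2 → (rhoFun s i c).1 * f (rhoFun s i c).2.1 (rhoFun s i c).2.2 =
          c.1 * f c.2.1 c.2.2) := by
      intro c
      rcases rhoFun_cases s i c with ⟨u, k, rfl, hc⟩ | ⟨u, k, rfl, hc⟩ | ⟨h1, h2, hc⟩
      · rw [hc]
        refine ⟨(h.inv i k).symm, fun hI => ?_⟩
        simp only at hI ⊢
        rw [h.hf i k hI, mul_assoc]
      · rw [hc]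
        refine ⟨h.inv i k, fun hI => ?_⟩
        simp only at hI ⊢
        rw [h.hf i k ((h.inv i k).2 hI)]
        group
      · rw [hc]; simp
    simp only [lhs, rhs, hmdl]
    refine hnn_comm M _ _ ?_ ?_
    · refine ⟨1, ?_⟩
      rintro ⟨c, j, x⟩
      simp only [mdl, liftC_apply, rhoP_apply, true_and, one_mul, ne_eq, not_true, false_imp_iff,
        and_true]
      exact hrho c
    · ext1 ⟨c, j, x⟩
      simp only [mdl, Equiv.Perm.mul_apply, liftC_apply, fib_apply, rhoP_apply, kFib]
      by_cases hI : I c.2.1 c.2.2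
      · have h1 := (hrho c).1.2 hI
        have h2 := (hrho c).2 hI
        simp only [hI, h1, h2]
      · have h1 := mt (hrho c).1.1 hI
        simp [hI, h1]
  | xx q i j =>
    refine red (.xx q i j) ?_
    simp only [lhs, rhs, mdl]
    rw [← map_mul, ← map_mul, ← sh_add, ← sh_add, add_comm]
  | rp i a =>
    refine red (.rp i a) ?_
    simp only [lhs, rhs, mdl]
    rw [← map_mul, ← map_mul]
    congr 1
    ext1 c
    simp only [Equiv.Perm.mul_apply, rhoP_apply]
    rcases rhoFun_cases s i c with ⟨u, k, rfl, hc⟩ | ⟨u, k, rfl, hc⟩ | ⟨h1, h2, hc⟩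
    · rw [hc, pP_apply, pP_apply, rhoFun_src, mul_assoc]
    · rw [hc, pP_apply, pP_apply, rhoFun_tgt, mul_assoc]
    · rw [hc]
      obtain ⟨u, q, α⟩ := c
      rw [pP_apply, rhoFun, if_neg (show ¬ cls _ _ _ (s a * u, q, α) from h1),
        if_neg (show ¬ cls _ _ _ (s a * u, q, α) from h2)]
  | Yp i j a =>
    refine red (.Yp i j a) ?_
    simp only [lhs, rhs, mdl]
    rw [← map_mul, ← map_mul]
    congr 1
  | rt i =>
    refine red (.rt i) ?_
    simp only [lhs, rhs, chi_mdl, prt_mdl]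
    simp only [mdl, liftC_lamp]
    congr 1
    simp only [sh_apply, ↓reduceIte, zero_add, pP_apply, rhoP_apply]
    have := rhoFun_src s i 1 (0 : M.J → ℤ)
    simp only [Pi.zero_apply, mul_zero, zero_add, one_mul] at this
    rw [mul_one]
    exact this
  | rY i j =>
    refine red (.rY i j) ?_
    simp only [lhs, rhs, mdl]
    rw [mul_inv_eq_iff_eq_mul, ← map_mul, ← map_mul, rhoP_Y]
  | Yx i j l =>
    refine red (.Yx i j l) ?_
    simp only [lhs, rhs, mdl]
    rw [← map_zpow, ← map_mul, ← map_mul, sh_zpow, ← Pi.single_smul, smul_eq_mul, mul_one,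
      (Ysh_commute _ _ _ _ _).eq]
  | Yt i j =>
    refine red (.Yt i j) ?_
    simp only [lhs, rhs, chi_mdl]
    simp only [mdl, liftC_lamp]
    rw [← map_zpow, ← map_inv, ← map_mul, liftC_lamp_commute]
    rw [sh_zpow, sh_neg, ← Pi.single_smul, smul_eq_mul, mul_one]
    have : cls (M.src i) (M.D i) (M.d i) ((1, M.src i, M.d i) : M.Cf S) := ⟨rfl, by simp⟩
    simp [this]
  | Y'x i j l =>
    refine red (.Y'x i j l) ?_
    simp only [lhs, rhs, mdl]
    rw [← map_zpow, ← map_mul, ← map_mul, sh_zpow, ← Pi.single_smul, smul_eq_mul, mul_one,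
      (Ysh_commute _ _ _ _ _).eq]
  | Y't i j =>
    refine red (.Y't i j) ?_
    simp only [lhs, rhs, chi_mdl]
    simp only [mdl, liftC_lamp]
    rw [← map_zpow, ← map_inv, ← map_mul, liftC_lamp_commute]
    rw [sh_zpow, sh_neg, ← Pi.single_smul, smul_eq_mul, mul_one]
    have : cls (M.tgt i) (M.E i) (M.e i) ((1, M.tgt i, M.e i) : M.Cf S) := ⟨rfl, by simp⟩
    simp [this]

end CMachine

end QISimple


set_option linter.unusedSectionVars false

namespace QISimple

namespace CMachine

variable {r : ℕ} (M : CMachine r) {S : Type} [Group S]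

/-- The relators. -/
def rels : Set (FreeGroup M.Gen) :=
  Set.range fun R => M.lhs FreeGroup.of R * (M.rhs FreeGroup.of R)⁻¹

/-- The finitely presented group. -/
abbrev KK := PresentedGroup M.rels

/-- generators of `KK`. -/
def kg (y : M.Gen) : M.KK := PresentedGroup.of y

theorem kg_sat : M.Sat M.kg := by
  intro R
  have h : (PresentedGroup.mk M.rels) (M.lhs FreeGroup.of R * (M.rhs FreeGroup.of R)⁻¹) = 1 :=
    PresentedGroup.one_of_mem ⟨R, rfl⟩
  rw [map_mul, map_inv, mul_inv_eq_one, M.map_lhs, M.map_rhs] at h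
  exact h

/-- maps out of `KK` -/
def toHom {H : Type*} [Group H] (g : M.Gen → H) (hg : M.Sat g) : M.KK →* H :=
  PresentedGroup.toGroup (f := g) (by
    rintro _ ⟨R, rfl⟩
    rw [map_mul, map_inv, M.map_lhs, M.map_rhs]
    simp only [FreeGroup.lift_apply_of]
    rw [show (fun y => g y) = g from rfl, hg R, mul_inv_cancel])

theorem toHom_kg {H : Type*} [Group H] (g : M.Gen → H) (hg : M.Sat g) (y : M.Gen) :
    M.toHom g hg (M.kg y) = g y := PresentedGroup.toGroup.of _

variable {M}

theorem vFib_mul (s : Fin r → S) (w : List (Fin r)) :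
    (w.map fun a => (fib (M.vFib (s a)) : Equiv.Perm (M.ZZ S))).prod =
      fib (M.vFib (w.map s).prod) := by
  induction w with
  | nil =>
    ext1 ⟨c, i, f⟩
    simp [vFib]
  | cons a w ih =>
    simp only [List.map_cons, List.prod_cons]
    rw [ih, fib_mul]
    refine fib_ext fun c i => ?_
    unfold vFib
    split_ifs <;> simp

/-- **Theorem A.** -/
theorem theoremA (s : Fin r → S) (hgen : ∀ g : S, ∃ w : List (Fin r), (w.map s).prod = g)
    {ν : S → ℕ} {hist : M.J} {I : M.Q → (M.J → ℤ) → Prop}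
    {f : M.Q → (M.J → ℤ) → S} {C : ℕ} (h : M.Sound s ν hist I f C)
    (hcomp : ∀ w : List (Fin r), (w.map s).prod = 1 →
      Relation.EqvGen M.Step (M.q0, 0, []) (M.q1, 0, w)) :
    ∃ (K : Type) (_ : Group K) (n : ℕ) (π : FreeGroup (Fin n) →* K)
      (R : Finset (FreeGroup (Fin n))), Function.Surjective π ∧
      π.ker = Subgroup.normalClosure (R : Set (FreeGroup (Fin n))) ∧
      ∃ V : S →* K, Function.Injective V ∧ (∀ a, ∃ i, V (s a) = π (FreeGroup.of i)) ∧
      ∃ C : ℕ, ∀ (w : List (Fin n × Bool)) (g : S), V g = π (FreeGroup.mk w) →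
        ν g ≤ C * w.length := by
  classical
  have hsat := M.kg_sat
  -- the homomorphism V
  let vw : List (Fin r) → M.KK := fun w => (w.map fun a => M.kg (.v a)).prod
  have hvw_app : ∀ w w', vw (w ++ w') = vw w * vw w' := by intro w w'; simp [vw]
  have hvw1 : ∀ w : List (Fin r), (w.map s).prod = 1 → vw w = 1 := fun w hw =>
    v_eq_one hsat w (hcomp [] (by simp)) (hcomp w hw)
  have hinvw : ∀ w : List (Fin r), ∃ w' : List (Fin r), (w'.map s).prod = ((w.map s).prod)⁻¹ :=
    fun w => hgen _
  have hwd : ∀ w w' : List (Fin r), (w.map s).prod = (w'.map s).prod → vw w = vw w' := by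
    intro w w' hww
    obtain ⟨u, hu⟩ := hinvw w'
    have h1 := hvw1 (w ++ u) (by simp [hu, hww])
    have h2 := hvw1 (w' ++ u) (by simp [hu])
    rw [hvw_app] at h1 h2
    rw [← h2] at h1
    exact mul_right_cancel h1
  choose wd hwd' using hgen
  let V : S →* M.KK := MonoidHom.mk' (fun g => vw (wd g)) (by
    intro a b
    rw [← hvw_app]
    apply hwd
    simp [hwd'])
  have hV : ∀ w : List (Fin r), V (w.map s).prod = vw w := fun w => hwd _ _ (hwd' _)
  -- the model
  let Φ := M.toHom (M.hmdl s I f) (hmdl_sat h)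
  have hΦV : ∀ g, Φ (V g) = HNNExtension.of (fib (M.vFib g)) := by
    intro g
    suffices hs' : ∀ w : List (Fin r), Φ (V (w.map s).prod) =
        HNNExtension.of (fib (M.vFib (w.map s).prod)) by
      have := hs' (wd g)
      rwa [hwd'] at this
    intro w
    rw [hV]
    simp only [vw, map_list_prod, List.map_map]
    rw [← vFib_mul, map_list_prod, List.map_map]
    congr 1
  have hfil := Bd_filtration h.norm hist C
  have hiso := Bd_iso h
  have hgenBd : ∃ N, ∀ (y : M.Gen) (b : Bool),
      HBd (M.isoAB I f) (Bd ν hist C) N (cond b (M.hmdl s I f y) (M.hmdl s I f y)⁻¹) := by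
    have h1 : ∀ y : M.Gen, ∃ N, Bd ν hist C N (M.mdl s I y) := mdl_Bd h
    choose N hN using h1
    have := Fintype.ofFinite M.Gen
    refine ⟨Finset.univ.sup N, fun y b => ?_⟩
    have hy : Bd ν hist C (Finset.univ.sup N) (M.mdl s I y) :=
      hfil.mono (Finset.le_sup (Finset.mem_univ y)) (hN y)
    have hy' := hfil.inv _ _ hy
    have h0 : ∀ u : ℤˣ, HBd (M.isoAB I f) (Bd ν hist C) (Finset.univ.sup N)
        (HNNExtension.t ^ (u : ℤ)) := by
      intro u
      have := HBd_mul (M.isoAB I f) (Bd ν hist C) hfil (HBd_t (M.isoAB I f) (Bd ν hist C) hfil u)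
        (HBd_of' (M.isoAB I f) (Bd ν hist C) (hfil.one (Finset.univ.sup N)))
      simpa using this
    cases b
    · have := HBd_of' (M.isoAB I f) (Bd ν hist C) hy'
      rw [map_inv] at this
      cases y
      case k => simpa [hmdl] using h0 (-1)
      all_goals exact this
    · have := HBd_of' (M.isoAB I f) (Bd ν hist C) hy
      cases y
      case k => simpa [hmdl] using h0 1
      all_goals exact this
  obtain ⟨N, hN⟩ := hgenBd
  have hbound : ∀ (w : List (M.Gen × Bool)) (g : S),
      V g = PresentedGroup.mk M.rels (FreeGroup.mk w) → ν g ≤ N * w.length := by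
    have hw : ∀ w : List (M.Gen × Bool), HBd (M.isoAB I f) (Bd ν hist C) (N * w.length)
        (Φ (PresentedGroup.mk M.rels (FreeGroup.mk w))) := by
      intro w
      induction w with
      | nil =>
        have := HBd_of' (M.isoAB I f) (Bd ν hist C) (hfil.one 0)
        rw [map_one] at this
        have e : (FreeGroup.mk [] : FreeGroup M.Gen) = 1 := rfl
        rw [e, map_one, map_one]
        simpa using this
      | cons x w ih =>
        obtain ⟨y, b⟩ := x
        have e : (FreeGroup.mk ((y, b) :: w) : FreeGroup M.Gen) =
            cond b (FreeGroup.of y) (FreeGroup.of y)⁻¹ * FreeGroup.mk w := by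
          cases b <;> simp [FreeGroup.of, FreeGroup.inv_mk, FreeGroup.mul_mk, FreeGroup.invRev]
        have e2 : Φ (PresentedGroup.mk M.rels (cond b (FreeGroup.of y) (FreeGroup.of y)⁻¹)) =
            cond b (M.hmdl s I f y) (M.hmdl s I f y)⁻¹ := by
          have := M.toHom_kg (M.hmdl s I f) (hmdl_sat h) y
          cases b
          · simp only [cond_false, map_inv]; exact congrArg _ this
          · exact this
        rw [e, map_mul, map_mul, e2, List.length_cons, Nat.mul_succ, add_comm]
        exact HBd_mul _ _ hfil (hN y b) ih
    intro w g hg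
    have h1 := hw w
    rw [← hg, hΦV] at h1
    have h2 := HBd_of _ _ hfil hiso h1
    have h3 := (h2 ((1, M.q1, 0), 1, 1)).1
    simpa [vFib] using h3
  -- transfer to `Fin n`
  obtain ⟨n, ⟨e⟩⟩ := Finite.exists_equiv_fin M.Gen
  let E : FreeGroup (Fin n) ≃* FreeGroup M.Gen := FreeGroup.freeGroupCongr e.symm
  let π : FreeGroup (Fin n) →* M.KK := (PresentedGroup.mk M.rels).comp E.toMonoidHom
  have hfin : (E.symm '' M.rels).Finite := (Set.finite_range _).image _
  refine ⟨M.KK, inferInstance, n, π, hfin.toFinset, ?_, ?_, V, ?_, ?_, N, ?_⟩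
  · exact (PresentedGroup.mk_surjective M.rels).comp E.surjective
  · rw [Set.Finite.coe_toFinset]
    have h1 : π.ker = (Subgroup.normalClosure M.rels).comap E.toMonoidHom := by
      rw [← MonoidHom.comap_ker]
      congr 1
      exact QuotientGroup.ker_mk' _
    rw [h1]
    have h2 := Subgroup.map_normalClosure M.rels E.symm.toMonoidHom E.symm.surjective
    rw [Subgroup.comap_equiv_eq_map_symm']
    exact h2
  · rw [injective_iff_map_eq_one]
    intro g hg
    apply h.norm.eq_one
    have := hbound [] g (by rw [hg]; rfl)
    simpa using this
  · intro a
    refine ⟨e (.v a), ?_⟩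
    have h1 := hV [a]
    simp only [List.map_cons, List.map_nil, List.prod_cons, List.prod_nil, mul_one, vw] at h1
    rw [h1]
    simp [π, E, kg]
    rfl
  · intro w g hg
    have h1 := hbound (w.map fun x => (e.symm x.1, x.2)) g (by
      rw [hg]
      simp only [π, E, MonoidHom.comp_apply]
      rfl)
    simpa using h1

end CMachine

end QISimple


set_option linter.unusedSectionVars false

namespace QISimple

namespace CMachine

variable {r : ℕ} (M : CMachine r)

/-! ### Part 4a : adding a history counter and a mirror copy -/

/-- Runs of `M`, with the list of rules used (last one first). -/
inductive Run : List M.R → M.Q → (M.J → ℤ) → List (Fin r) → Prop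
  | nil : Run [] M.q0 0 []
  | cons (i : M.R) (k : M.J → ℤ) (l : List M.R) (w : List (Fin r))
      (h : Run l (M.src i) (fun j => M.D i j * k j + M.d i j) w) :
      Run (i :: l) (M.tgt i) (fun j => M.E i j * k j + M.e i j) (w ++ (M.pr i).toList)

variable {M}

theorem affine_inj {J : Type*} {D d k k' : J → ℤ} (hD : ∀ j, 0 < D j)
    (h : (fun j => D j * k j + d j) = fun j => D j * k' j + d j) : k = k' := by
  funext j
  have := congrFun h j
  simp only [add_left_inj] at this
  exact mul_left_cancel₀ (hD j).ne' this

theorem Run.det {l : List M.R} {q α w q' α' w'} (h : M.Run l q α w) (h' : M.Run l q' α' w') :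
    q = q' ∧ α = α' ∧ w = w' := by
  induction h generalizing q' α' w' with
  | nil => cases h'; exact ⟨rfl, rfl, rfl⟩
  | cons i k l w h ih =>
    cases h' with
    | cons _ k' _ w' h' =>
      obtain ⟨-, h2, rfl⟩ := ih h'
      obtain rfl := affine_inj (M.hD i) h2
      exact ⟨rfl, rfl, rfl⟩

theorem Run.length {l : List M.R} {q α w} (h : M.Run l q α w) : w.length ≤ l.length := by
  induction h with
  | nil => simp
  | cons i k l w h ih =>
    simp only [List.length_append, List.length_cons]
    have : (M.pr i).toList.length ≤ 1 := by cases M.pr i <;> simp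
    omega

theorem Run.of_reach {c : M.Q × (M.J → ℤ) × List (Fin r)}
    (h : Relation.ReflTransGen M.Step (M.q0, 0, []) c) : ∃ l, M.Run l c.1 c.2.1 c.2.2 := by
  induction h with
  | refl => exact ⟨[], Run.nil⟩
  | tail _ h ih =>
    obtain ⟨i, k, w, rfl, rfl⟩ := h
    obtain ⟨l, hl⟩ := ih
    exact ⟨i :: l, Run.cons i k l w hl⟩

theorem Run.reach {l : List M.R} {q α w} (h : M.Run l q α w) :
    Relation.ReflTransGen M.Step (M.q0, 0, []) (q, α, w) := by
  induction h with
  | nil => exact .refl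
  | cons i k l w h ih => exact ih.tail ⟨i, k, w, rfl, rfl⟩

variable (M)

/-- code of a rule -/
noncomputable def rcode (i : M.R) : ℕ := (Finite.equivFin M.R i : ℕ) + 1

/-- base -/
noncomputable def rbase : ℕ := Nat.card M.R + 1

variable {M}

theorem rcode_lt (i : M.R) : M.rcode i < M.rbase := by
  unfold rcode rbase
  have := (Finite.equivFin M.R i).2
  omega

theorem rcode_pos (i : M.R) : 0 < M.rcode i := Nat.succ_pos _

theorem rcode_inj {i j : M.R} (h : M.rcode i = M.rcode j) : i = j := by
  unfold rcode at h
  apply (Finite.equivFin M.R).injective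
  exact Fin.ext (by omega)

variable (M)

/-- number coding a list of rules -/
noncomputable def rnum : List M.R → ℤ
  | [] => 0
  | i :: l => M.rbase * rnum l + M.rcode i

variable {M}

theorem base_inj {b a a' : ℤ} {c c' : ℕ} (hc : (c : ℤ) < b) (hc' : (c' : ℤ) < b)
    (h : b * a + c = b * a' + c') : a = a' ∧ c = c' := by
  have h1 : (b * a + c) % b = c := by
    rw [Int.mul_add_emod_self_left]; exact Int.emod_eq_of_lt (by positivity) hc
  have h2 : (b * a' + c') % b = c' := by
    rw [Int.mul_add_emod_self_left]; exact Int.emod_eq_of_lt (by positivity) hc'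
  have h3 : (c : ℤ) = c' := by rw [← h1, h, h2]
  refine ⟨?_, by exact_mod_cast h3⟩
  rw [h3, add_left_inj] at h
  exact mul_left_cancel₀ (by have : (0:ℤ) ≤ c := by positivity
                             omega) h

theorem rnum_cons {l : List M.R} {a : ℤ} {i : M.R} (h : M.rnum l = M.rbase * a + M.rcode i) :
    ∃ l', l = i :: l' ∧ M.rnum l' = a := by
  cases l with
  | nil =>
    have h' : (M.rbase : ℤ) * 0 + ((0 : ℕ) : ℤ) = M.rbase * a + M.rcode i := by
      rw [← h]; simp [rnum]
    have := (base_inj (by exact_mod_cast (Nat.zero_lt_of_lt (rcode_lt i)))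
      (by exact_mod_cast rcode_lt i) h').2
    have := rcode_pos i
    omega
  | cons j l =>
    obtain ⟨h1, h2⟩ := base_inj (by exact_mod_cast rcode_lt j) (by exact_mod_cast rcode_lt i) h
    exact ⟨l, by rw [rcode_inj h2], h1⟩

theorem rnum_inj {l l' : List M.R} (h : M.rnum l = M.rnum l') : l = l' := by
  induction l' generalizing l with
  | nil =>
    cases l with
    | nil => rfl
    | cons i l =>
      obtain ⟨l'', h', -⟩ := rnum_cons (l := []) (a := M.rnum l) (i := i) h.symm
      cases h'
  | cons i l' ih =>
    obtain ⟨l'', rfl, h2⟩ := rnum_cons (l := l) (a := M.rnum l') (i := i) h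
    rw [ih h2]

theorem rnum_size (l : List M.R) : l.length ≤ isz (M.rnum l) := by
  have h : ∀ l : List M.R, (2 : ℤ) ^ l.length ≤ M.rnum l + 1 := by
    intro l
    induction l with
    | nil => simp [rnum]
    | cons i l ih =>
      simp only [rnum, List.length_cons, pow_succ]
      have h1 := rcode_pos i
      have h2 := rcode_lt i
      have h3 : (2 : ℤ) ≤ M.rbase := by exact_mod_cast (by omega)
      have h4 : (1 : ℤ) ≤ M.rcode i := by exact_mod_cast h1
      have h5 : (1 : ℤ) ≤ 2 ^ l.length := one_le_pow₀ (by norm_num)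
      nlinarith
  rcases Nat.eq_zero_or_pos l.length with h0 | h0
  · omega
  · obtain ⟨m, hm⟩ : ∃ m, l.length = m + 1 := ⟨l.length - 1, by omega⟩
    have h1 := h l
    rw [hm] at h1 ⊢
    unfold isz
    rw [Nat.succ_le_iff, Nat.lt_size]
    zify
    have h5 : (1 : ℤ) ≤ 2 ^ m := one_le_pow₀ (by norm_num)
    rw [pow_succ] at h1
    have : |M.rnum l| ≥ M.rnum l := le_abs_self _
    linarith

variable (M)

/-- The doubled machine with history counter. -/
noncomputable def dbl : CMachine r where
  Q := Bool × M.Q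
  J := Option M.J
  R := Option (Bool × M.R)
  src := fun x => match x with
    | none => (true, M.q1)
    | some (b, i) => (b, M.src i)
  tgt := fun x => match x with
    | none => (false, M.q1)
    | some (b, i) => (b, M.tgt i)
  hne := fun x => by
    rcases x with _ | ⟨b, i⟩
    · simp
    · simpa using M.hne i
  D := fun x j => match x, j with
    | none, _ => 1
    | some _, none => 1
    | some (_, i), some j => M.D i j
  d := fun x j => match x, j with
    | none, _ => 0
    | some _, none => 0
    | some (_, i), some j => M.d i j
  E := fun x j => match x, j with
    | none, _ => 1
    | some _, none => M.rbase
    | some (_, i), some j => M.E i j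
  e := fun x j => match x, j with
    | none, _ => 0
    | some (_, i), none => M.rcode i
    | some (_, i), some j => M.e i j
  hD := fun x j => by
    rcases x with _ | ⟨b, i⟩ <;> rcases j with _ | j <;> simp [M.hD]
  hE := fun x j => by
    rcases x with _ | ⟨b, i⟩ <;> rcases j with _ | j <;> simp [M.hE, rbase]
  pr := fun x => match x with
    | none => none
    | some (true, i) => M.pr i
    | some (false, _) => none
  q0 := (true, M.q0)
  q1 := (false, M.q0)

variable {S : Type} [Group S]

/-- The invariant. -/
def dblI (q : Bool × M.Q) (α : Option M.J → ℤ) : Prop :=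
  ∃ l w, M.Run l q.2 (fun j => α (some j)) w ∧ α none = M.rnum l

open Classical in
/-- The fibre function. -/
noncomputable def dblf (s : Fin r → S) (q : Bool × M.Q) (α : Option M.J → ℤ) : S :=
  if h : q.1 = true ∧ M.dblI q α then ((h.2.choose_spec.choose.map s).prod)⁻¹ else 1

variable {M}

theorem dblf_eq (s : Fin r → S) {q : M.Q} {α : Option M.J → ℤ} {l w}
    (h : M.Run l q (fun j => α (some j)) w) (hl : α none = M.rnum l) :
    M.dblf s (true, q) α = ((w.map s).prod)⁻¹ := by
  have hI : M.dblI (true, q) α := ⟨l, w, h, hl⟩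
  unfold dblf
  rw [dif_pos ⟨rfl, hI⟩]
  have h1 := hI.choose_spec.choose_spec
  have h2 : l = hI.choose := rnum_inj (hl.symm.trans h1.2)
  have h3 := (h1.1.det (h2 ▸ h)).2.2
  exact congrArg (fun z => ((List.map s z).prod)⁻¹) h3

theorem dblf_false (s : Fin r → S) {q : M.Q} {α : Option M.J → ℤ} :
    M.dblf s (false, q) α = 1 := by
  unfold dblf
  rw [dif_neg (by simp)]

theorem dbl_inv (i : M.dbl.R) (k : M.dbl.J → ℤ) :
    M.dblI (M.dbl.src i) (fun j => M.dbl.D i j * k j + M.dbl.d i j) ↔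
    M.dblI (M.dbl.tgt i) (fun j => M.dbl.E i j * k j + M.dbl.e i j) := by
  rcases i with _ | ⟨b, i⟩
  · rfl
  · constructor
    · rintro ⟨l, w, h, hl⟩
      refine ⟨i :: l, w ++ (M.pr i).toList, Run.cons i (fun j => k (some j)) l w h, ?_⟩
      have hl : 1 * k none + 0 = M.rnum l := hl
      change (M.rbase : ℤ) * k none + M.rcode i = M.rbase * M.rnum l + M.rcode i
      rw [← hl]; ring
    · rintro ⟨l, w, h, hl⟩
      obtain ⟨l', rfl, h2⟩ := rnum_cons (l := l) (a := k none) (i := i) hl.symm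
      have h : M.Run (i :: l') (M.tgt i) (fun j => M.E i j * k (some j) + M.e i j) w := h
      generalize hα : (fun j => M.E i j * k (some j) + M.e i j) = α at h
      cases h with
      | cons _ k' _ w' h' =>
        obtain rfl := affine_inj (M.hE i) hα
        refine ⟨l', w', h', ?_⟩
        change 1 * k none + 0 = _
        rw [h2]; ring

theorem dbl_sound {s : Fin r → S} {ν : S → ℕ} (hν : IsNorm ν) (hs : ∀ a, ν (s a) ≤ 1)
    (hacc : ∀ w α, Relation.ReflTransGen M.Step (M.q0, 0, []) (M.q1, α, w) → (w.map s).prod = 1) :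
    M.dbl.Sound s ν (none : Option M.J) M.dblI (M.dblf s) 1 where
  norm := hν
  hs := hs
  inv := dbl_inv
  h0 := ⟨[], [], Run.nil, rfl⟩
  h1 := ⟨[], [], Run.nil, rfl⟩
  f0 := by
    have := dblf_eq (M := M) s (q := M.q0) (α := 0) (l := []) (w := []) Run.nil rfl
    exact this.trans (by simp)
  hf := by
    intro i k hI
    rcases i with _ | ⟨b, i⟩
    · obtain ⟨l, w, h, hl⟩ := hI
      have h1 : M.dblf s (true, M.q1) (fun j => 1 * k j + 0) = ((w.map s).prod)⁻¹ :=
        dblf_eq s h hl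
      have h2 : M.dblf s (false, M.q1) (fun j => 1 * k j + 0) = 1 := dblf_false s
      refine h1.trans ?_
      refine Eq.trans ?_ (congrArg (fun z => M.dbl.prS s none * z) h2.symm)
      rw [hacc w _ h.reach]
      simp [prS, dbl]
    · cases b
      · refine (dblf_false s).trans ?_
        refine Eq.trans ?_ (congrArg (fun z => M.dbl.prS s (some (false, i)) * z)
          (dblf_false s).symm)
        simp [prS, dbl]
      · have hI' := (dbl_inv (some (true, i)) k).1 hI
        obtain ⟨l, w, h, hl⟩ := hI
        refine (dblf_eq s h hl).trans ?_
        have h3 : M.dblf s (true, M.tgt i)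
            (fun j => M.dbl.E (some (true, i)) j * k j + M.dbl.e (some (true, i)) j) =
            (((w ++ (M.pr i).toList).map s).prod)⁻¹ := by
          refine dblf_eq (l := i :: l) s (Run.cons i (fun j => k (some j)) l w h) ?_
          have hl : 1 * k none + 0 = M.rnum l := hl
          change (M.rbase : ℤ) * k none + M.rcode i = M.rbase * M.rnum l + M.rcode i
          rw [← hl]; ring
        refine Eq.trans ?_ (congrArg (fun z => M.dbl.prS s (some (true, i)) * z) h3.symm)
        change _ = ((M.pr i).toList.map s).prod * _
        simp
  hν := by
    rintro ⟨b, q⟩ α hI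
    cases b
    · have := dblf_false (M := M) s (q := q) (α := α)
      rw [this, hν.one]
      exact Nat.zero_le _
    · obtain ⟨l, w, h, hl⟩ := hI
      have h1 : M.dblf s (true, q) α = ((w.map s).prod)⁻¹ := dblf_eq s h hl
      rw [h1, hν.inv, one_mul]
      have h2 : ∀ w : List (Fin r), ν (w.map s).prod ≤ w.length := by
        intro w
        induction w with
        | nil => simp [hν.one]
        | cons a w ih =>
          simp only [List.map_cons, List.prod_cons, List.length_cons]
          have := hν.mul (s a) (w.map s).prod
          have := hs a
          omega
      have h3 := rnum_size l
      rw [hl]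
      exact ((h2 w).trans h.length).trans h3

theorem dbl_comp {w : List (Fin r)} {α}
    (h : Relation.ReflTransGen M.Step (M.q0, 0, []) (M.q1, α, w)) :
    Relation.EqvGen M.dbl.Step (M.dbl.q0, 0, []) (M.dbl.q1, 0, w) := by
  obtain ⟨l, hl⟩ := Run.of_reach h
  let ext : List M.R → (M.J → ℤ) → (Option M.J → ℤ) := fun l α j => match j with
    | none => M.rnum l
    | some j => α j
  have hcl : ∀ l α (k : M.J → ℤ) (i : M.R) (b : Bool) (u : List (Fin r)),
      α = (fun j => M.D i j * k j + M.d i j) →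
      M.dbl.Step ((b, M.src i), ext l α, u) ((b, M.tgt i),
        ext (i :: l) (fun j => M.E i j * k j + M.e i j),
        u ++ if b then (M.pr i).toList else []) := by
    intro l α k i b u hα
    refine ⟨some (b, i), ext l k, u, ?_, ?_⟩
    · refine Prod.ext rfl (Prod.ext ?_ rfl)
      funext j
      cases j with
      | none => change M.rnum l = 1 * M.rnum l + 0; ring
      | some j => rw [hα]; rfl
    · refine Prod.ext rfl (Prod.ext ?_ ?_)
      · funext j
        cases j <;> rfl
      · cases b <;> rfl
  have hz : ext [] 0 = 0 := by
    funext j; cases j <;> rfl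
  have h1 : ∀ {l q α w}, M.Run l q α w →
      Relation.EqvGen M.dbl.Step ((true, M.q0), 0, []) ((true, q), ext l α, w) := by
    intro l q α w h
    induction h with
    | nil => rw [hz]; exact .refl _
    | cons i k l w h ih => exact ih.trans _ _ _ (.rel _ _ (hcl _ _ k i true w rfl))
  have h2 : ∀ {l q α w}, M.Run l q α w → ∀ u,
      Relation.EqvGen M.dbl.Step ((false, M.q0), 0, u) ((false, q), ext l α, u) := by
    intro l q α w h u
    induction h with
    | nil => rw [hz]; exact .refl _
    | cons i k l w h ih =>
      have := hcl l _ k i false u rfl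
      simp only [Bool.false_eq_true, if_false, List.append_nil] at this
      exact ih.trans _ _ _ (.rel _ _ this)
  have h3 : M.dbl.Step ((true, M.q1), ext l α, w) ((false, M.q1), ext l α, w) := by
    refine ⟨none, ext l α, w, ?_, ?_⟩
    · refine Prod.ext rfl (Prod.ext ?_ rfl)
      funext j
      change ext l α j = 1 * ext l α j + 0
      ring
    · refine Prod.ext rfl (Prod.ext ?_ ?_)
      · funext j
        change ext l α j = 1 * ext l α j + 0
        ring
      · change w = w ++ []
        simp
  exact ((h1 hl).trans _ _ _ (.rel _ _ h3)).trans _ _ _ ((h2 hl w).symm _ _)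

end CMachine

/-- Combination of Theorem A and the doubling construction. -/
theorem embed_of_machine {r : ℕ} (M : CMachine r) {S : Type} [Group S] (s : Fin r → S)
    (hgen : ∀ g : S, ∃ w : List (Fin r), (w.map s).prod = g)
    {ν : S → ℕ} (hν : IsNorm ν) (hs : ∀ a, ν (s a) ≤ 1)
    (hM : ∀ w, (w.map s).prod = 1 ↔
      ∃ α, Relation.ReflTransGen M.Step (M.q0, 0, []) (M.q1, α, w)) :
    ∃ (K : Type) (_ : Group K) (n : ℕ) (π : FreeGroup (Fin n) →* K)
      (R : Finset (FreeGroup (Fin n))), Function.Surjective π ∧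
      π.ker = Subgroup.normalClosure (R : Set (FreeGroup (Fin n))) ∧
      ∃ V : S →* K, Function.Injective V ∧ (∀ a, ∃ i, V (s a) = π (FreeGroup.of i)) ∧
      ∃ C : ℕ, ∀ (w : List (Fin n × Bool)) (g : S), V g = π (FreeGroup.mk w) →
        ν g ≤ C * w.length :=
  M.dbl.theoremA s hgen (CMachine.dbl_sound hν hs fun w α h => (hM w).2 ⟨α, h⟩)
    fun w hw => CMachine.dbl_comp ((hM w).1 hw).choose_spec

end QISimple


set_option linter.unusedSectionVars false

namespace QISimple

/-! ### Part 4b : stack machines -/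

/-- Stack operations. -/
inductive SOp (K Γ : Type)
  | nop
  | push (k : K) (a : Γ)
  | pop (k : K) (a : Option Γ)
  | peek (k : K) (a : Option Γ)

instance {K Γ : Type} [Finite K] [Finite Γ] : Finite (SOp K Γ) := by
  let f : Unit ⊕ (K × Γ) ⊕ (K × Option Γ) ⊕ (K × Option Γ) → SOp K Γ := fun z => match z with
    | .inl _ => .nop
    | .inr (.inl (k, a)) => .push k a
    | .inr (.inr (.inl (k, a))) => .pop k a
    | .inr (.inr (.inr (k, a))) => .peek k a
  refine Finite.of_surjective f ?_
  rintro (_ | ⟨k, a⟩ | ⟨k, a⟩ | ⟨k, a⟩)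
  · exact ⟨.inl (), rfl⟩
  · exact ⟨.inr (.inl (k, a)), rfl⟩
  · exact ⟨.inr (.inr (.inl (k, a))), rfl⟩
  · exact ⟨.inr (.inr (.inr (k, a))), rfl⟩

section stack

variable {K Γ : Type} [DecidableEq K] [Fintype K] [Finite Γ]

/-- Semantics of stack operations. -/
def SOp.Rel : SOp K Γ → (K → List Γ) → (K → List Γ) → Prop
  | .nop, S, S' => S' = S
  | .push k a, S, S' => S' = Function.update S k (a :: S k)
  | .pop k a, S, S' => (S k).head? = a ∧ S' = Function.update S k (S k).tail
  | .peek k a, S, S' => (S k).head? = a ∧ S' = S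

variable (Γ) in
/-- base for coding stacks -/
noncomputable def sbase : ℕ := Nat.card Γ + 1

/-- code of a stack symbol -/
noncomputable def scode : Option Γ → ℕ
  | none => 0
  | some a => (Finite.equivFin Γ a : ℕ) + 1

theorem scode_lt (a : Option Γ) : scode a < sbase Γ := by
  unfold sbase
  cases a with
  | none => simp [scode]
  | some a =>
    have := (Finite.equivFin Γ a).2
    simp only [scode]
    omega

theorem scode_inj {a b : Option Γ} (h : scode a = scode b) : a = b := by
  cases a <;> cases b <;> simp only [scode] at h
  · rfl
  · omega
  · omega
  · exact congrArg some ((Finite.equivFin Γ).injective (Fin.ext (by omega)))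

/-- number coding a stack -/
noncomputable def snum : List Γ → ℤ
  | [] => 0
  | a :: l => sbase Γ * snum l + scode (some a)

theorem snum_eq (l : List Γ) : snum l = sbase Γ * snum l.tail + scode l.head? := by
  cases l <;> simp [snum, scode]

theorem snum_iff {l : List Γ} {a : Option Γ} {x : ℤ} :
    snum l = sbase Γ * x + scode a ↔ l.head? = a ∧ snum l.tail = x := by
  rw [snum_eq l]
  constructor
  · intro h
    obtain ⟨h1, h2⟩ := CMachine.base_inj (by exact_mod_cast scode_lt _)
      (by exact_mod_cast scode_lt _) h
    exact ⟨scode_inj h2, h1⟩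
  · rintro ⟨rfl, rfl⟩; rfl

/-- Affine maps of an operation. -/
noncomputable def SOp.D : SOp K Γ → K → ℤ
  | .nop, _ => 1
  | .push _ _, _ => 1
  | .pop k _, j => if j = k then sbase Γ else 1
  | .peek k _, j => if j = k then sbase Γ else 1

/-- Affine maps of an operation. -/
noncomputable def SOp.d : SOp K Γ → K → ℤ
  | .nop, _ => 0
  | .push _ _, _ => 0
  | .pop k a, j => if j = k then scode a else 0
  | .peek k a, j => if j = k then scode a else 0

/-- Affine maps of an operation. -/
noncomputable def SOp.E : SOp K Γ → K → ℤ
  | .nop, _ => 1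
  | .push k _, j => if j = k then sbase Γ else 1
  | .pop _ _, _ => 1
  | .peek k _, j => if j = k then sbase Γ else 1

/-- Affine maps of an operation. -/
noncomputable def SOp.e : SOp K Γ → K → ℤ
  | .nop, _ => 0
  | .push k a, j => if j = k then scode (some a) else 0
  | .pop _ _, _ => 0
  | .peek k a, j => if j = k then scode a else 0

theorem sbase_pos : (0 : ℤ) < sbase Γ := by unfold sbase; positivity

theorem SOp.D_pos (o : SOp K Γ) (j : K) : 0 < o.D j := by
  cases o <;> simp only [SOp.D] <;> try split_ifs
  all_goals first | exact one_pos | exact sbase_pos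

theorem SOp.E_pos (o : SOp K Γ) (j : K) : 0 < o.E j := by
  cases o <;> simp only [SOp.E] <;> try split_ifs
  all_goals first | exact one_pos | exact sbase_pos

theorem SOp.sim (o : SOp K Γ) {S S' : K → List Γ} (h : o.Rel S S') :
    ∃ x : K → ℤ, (fun j => snum (S j)) = (fun j => o.D j * x j + o.d j) ∧
      (fun j => snum (S' j)) = fun j => o.E j * x j + o.e j := by
  cases o with
  | nop =>
    obtain rfl := h
    exact ⟨fun j => snum (S' j), by simp [SOp.D, SOp.d], by simp [SOp.E, SOp.e]⟩
  | push k a =>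
    obtain rfl := h
    refine ⟨fun j => snum (S j), by simp [SOp.D, SOp.d], ?_⟩
    funext j
    by_cases hj : j = k
    · subst hj; simp [SOp.E, SOp.e, snum]
    · simp [SOp.E, SOp.e, hj]
  | pop k a =>
    obtain ⟨h1, rfl⟩ := h
    refine ⟨fun j => snum (Function.update S k (S k).tail j), ?_, by simp [SOp.E, SOp.e]⟩
    funext j
    by_cases hj : j = k
    · subst hj; simp [SOp.D, SOp.d, snum_iff, h1]
    · simp [SOp.D, SOp.d, hj]
  | peek k a =>
    obtain ⟨h1, rfl⟩ := h
    refine ⟨fun j => snum (Function.update S' k (S' k).tail j), ?_, ?_⟩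
    all_goals
      funext j
      by_cases hj : j = k
      · subst hj; simp [SOp.D, SOp.d, SOp.E, SOp.e, snum_iff, h1]
      · simp [SOp.D, SOp.d, SOp.E, SOp.e, hj]

theorem SOp.sim' (o : SOp K Γ) {S : K → List Γ} {x : K → ℤ}
    (h : (fun j => snum (S j)) = (fun j => o.D j * x j + o.d j)) :
    ∃ S', o.Rel S S' ∧ (fun j => snum (S' j)) = fun j => o.E j * x j + o.e j := by
  have key : ∃ S', o.Rel S S' := by
    cases o with
    | nop => exact ⟨_, rfl⟩
    | push k a => exact ⟨_, rfl⟩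
    | pop k a =>
      have h1 := congrFun h k
      simp only [SOp.D, SOp.d, if_true, snum_iff] at h1
      exact ⟨_, h1.1, rfl⟩
    | peek k a =>
      have h1 := congrFun h k
      simp only [SOp.D, SOp.d, if_true, snum_iff] at h1
      exact ⟨_, h1.1, rfl⟩
  obtain ⟨S', hS'⟩ := key
  obtain ⟨x', h1, h2⟩ := o.sim hS'
  obtain rfl := CMachine.affine_inj o.D_pos (h.symm.trans h1)
  exact ⟨S', hS', h2⟩

variable {r : ℕ} {Q : Type} [Finite Q]

/-- Steps of a stack machine given by the rule predicate `P`. -/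
def SStep (P : Q → SOp K Γ → Option (Fin r) → Q → Prop)
    (c c' : Q × (K → List Γ) × List (Fin r)) : Prop :=
  ∃ o p, P c.1 o p c'.1 ∧ o.Rel c.2.1 c'.2.1 ∧ c'.2.2 = c.2.2 ++ p.toList

/-- The counter machine of a stack machine. -/
noncomputable def toCMachine (P : Q → SOp K Γ → Option (Fin r) → Q → Prop) (qs qa : Q) :
    CMachine r where
  Q := Option (Q × Bool)
  J := K
  R := (Bool × {t : Q × SOp K Γ × Option (Fin r) × Q // P t.1 t.2.1 t.2.2.1 t.2.2.2}) ⊕ Bool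
  src := fun x => match x with
    | .inl (b, t) => some (t.1.1, b)
    | .inr b => some (qa, b)
  tgt := fun x => match x with
    | .inl (b, t) => some (t.1.2.2.2, !b)
    | .inr _ => none
  hne := fun x => by
    rcases x with ⟨b, t⟩ | b
    · cases b <;> simp
    · simp
  D := fun x => match x with
    | .inl (_, t) => t.1.2.1.D
    | .inr _ => fun _ => 1
  d := fun x => match x with
    | .inl (_, t) => t.1.2.1.d
    | .inr _ => fun _ => 0
  E := fun x => match x with
    | .inl (_, t) => t.1.2.1.E
    | .inr _ => fun _ => 1
  e := fun x => match x with
    | .inl (_, t) => t.1.2.1.e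
    | .inr _ => fun _ => 0
  hD := fun x j => by
    rcases x with ⟨b, t⟩ | b
    · exact SOp.D_pos _ _
    · exact one_pos
  hE := fun x j => by
    rcases x with ⟨b, t⟩ | b
    · exact SOp.E_pos _ _
    · exact one_pos
  pr := fun x => match x with
    | .inl (_, t) => t.1.2.2.1
    | .inr _ => none
  q0 := some (qs, true)
  q1 := none

theorem toCMachine_reach (P : Q → SOp K Γ → Option (Fin r) → Q → Prop) (qs qa : Q)
    (w : List (Fin r)) :
    (∃ α, Relation.ReflTransGen (toCMachine P qs qa).Step
      ((toCMachine P qs qa).q0, 0, []) ((toCMachine P qs qa).q1, α, w)) ↔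
    ∃ S, Relation.ReflTransGen (SStep P) (qs, fun _ => [], []) (qa, S, w) := by
  constructor
  · rintro ⟨α, h⟩
    have key : ∀ c, Relation.ReflTransGen (toCMachine P qs qa).Step
        ((toCMachine P qs qa).q0, 0, []) c → ∃ q S,
        Relation.ReflTransGen (SStep P) (qs, fun _ => [], []) (q, S, c.2.2) ∧
          c.2.1 = (fun j => snum (S j)) ∧ ((∃ b, c.1 = some (q, b)) ∨ c.1 = none ∧ q = qa) := by
      intro c h
      induction h with
      | refl => exact ⟨qs, fun _ => [], .refl, rfl, .inl ⟨true, rfl⟩⟩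
      | tail _ h ih =>
        obtain ⟨i, k, w, rfl, rfl⟩ := h
        obtain ⟨q, S, h1, h2, h3⟩ := ih
        rcases i with ⟨b, ⟨q', o, p, q''⟩, hP⟩ | b
        · rcases h3 with ⟨b', h3⟩ | ⟨h3, -⟩
          · have h3 : some (q', b) = some (q, b') := h3
            simp only [Option.some.injEq, Prod.mk.injEq] at h3
            obtain ⟨rfl, rfl⟩ := h3
            obtain ⟨S', h4, h5⟩ := o.sim' h2.symm
            exact ⟨q'', S', h1.tail ⟨o, p, hP, h4, rfl⟩, h5.symm, .inl ⟨_, rfl⟩⟩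
          · cases h3
        · rcases h3 with ⟨b', h3⟩ | ⟨h3, -⟩
          · have h3 : some (qa, b) = some (q, b') := h3
            simp only [Option.some.injEq, Prod.mk.injEq] at h3
            obtain ⟨rfl, rfl⟩ := h3
            refine ⟨qa, S, ?_, h2, .inr ⟨rfl, rfl⟩⟩
            change Relation.ReflTransGen (SStep P) (qs, fun _ => [], []) (qa, S, w ++ [])
            simpa using h1
          · cases h3
    obtain ⟨q, S, h1, -, h3⟩ := key _ h
    rcases h3 with ⟨b', h3⟩ | ⟨-, rfl⟩
    · cases h3
    · exact ⟨S, h1⟩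
  · rintro ⟨S, h⟩
    have key : ∀ c, Relation.ReflTransGen (SStep P) (qs, fun _ => [], []) c → ∃ b,
        Relation.ReflTransGen (toCMachine P qs qa).Step ((toCMachine P qs qa).q0, 0, [])
          (some (c.1, b), (fun j => snum (c.2.1 j)), c.2.2) := by
      intro c h
      induction h with
      | refl => exact ⟨true, .refl⟩
      | @tail c c' _ h ih =>
        obtain ⟨b, ih⟩ := ih
        obtain ⟨q, S, w⟩ := c
        obtain ⟨q', S', w'⟩ := c'
        obtain ⟨o, p, hP, h4, h5⟩ := h
        simp only at hP h4 h5 ih ⊢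
        obtain ⟨x, h6, h7⟩ := o.sim h4
        refine ⟨!b, ih.tail ⟨.inl (b, ⟨(q, o, p, q'), hP⟩), x, w, ?_, ?_⟩⟩
        · exact Prod.ext rfl (Prod.ext h6 rfl)
        · exact Prod.ext rfl (Prod.ext h7 h5)
    obtain ⟨b, h1⟩ := key _ h
    refine ⟨fun j => snum (S j), h1.tail ⟨.inr b, fun j => snum (S j), w, ?_, ?_⟩⟩
    · refine Prod.ext rfl (Prod.ext ?_ rfl)
      funext j
      change snum (S j) = 1 * snum (S j) + 0
      ring
    · refine Prod.ext rfl (Prod.ext ?_ ?_)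
      · funext j
        change snum (S j) = 1 * snum (S j) + 0
        ring
      · change w = w ++ []
        simp

end stack

end QISimple


set_option linter.unusedSectionVars false

namespace QISimple

open Turing

/-! ### Part 4c : from stack Turing machines to rule systems -/

section TM

variable {K Γ Λ σ : Type} [DecidableEq K] (T : Λ → TM2.Stmt (fun _ : K => Γ) Λ σ)

/-- small-step rules of a stack Turing machine -/
inductive TRule : TM2.Stmt (fun _ : K => Γ) Λ σ × σ → SOp K Γ →
    Option (TM2.Stmt (fun _ : K => Γ) Λ σ × σ) → Prop
  | push (k f q v) : TRule (.push k f q, v) (.push k (f v)) (some (q, v))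
  | peek (k f q v a) : TRule (.peek k f q, v) (.peek k a) (some (q, f v a))
  | pop (k f q v a) : TRule (.pop k f q, v) (.pop k a) (some (q, f v a))
  | load (a q v) : TRule (.load a q, v) .nop (some (q, a v))
  | branch (f q₁ q₂ v) : TRule (.branch f q₁ q₂, v) .nop (some (cond (f v) q₁ q₂, v))
  | goto (f v) : TRule (.goto f, v) .nop (some (T (f v), v))
  | halt (v) : TRule (.halt, v) .nop none

/-- halting of small-step configurations -/
def THalts : Option (TM2.Stmt (fun _ : K => Γ) Λ σ × σ) → (K → List Γ) → Prop
  | none, _ => True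
  | some (q, v), S => ∃ v' S', TM2.Reaches T (TM2.stepAux q v S) ⟨none, v', S'⟩

variable {T}

theorem THalts.back {c c' o S S'} (h : TRule T c o c') (ho : o.Rel S S') (h' : THalts T c' S') :
    THalts T (some c) S := by
  cases h with
  | push k f q v =>
    obtain rfl := ho
    exact h'
  | peek k f q v a =>
    obtain ⟨rfl, rfl⟩ := ho
    exact h'
  | pop k f q v a =>
    obtain ⟨rfl, rfl⟩ := ho
    exact h'
  | load a q v =>
    obtain rfl := ho
    exact h'
  | branch f q₁ q₂ v =>
    obtain rfl := ho
    unfold THalts at h' ⊢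
    simp only [TM2.stepAux]
    cases hf : f v <;> rw [hf] at h' <;> exact h'
  | goto f v =>
    obtain rfl := ho
    obtain ⟨v', S', h'⟩ := h'
    exact ⟨v', S', Relation.ReflTransGen.head (by simp [TM2.step]) h'⟩
  | halt v =>
    obtain rfl := ho
    exact ⟨v, S', .refl⟩

variable (T)

/-- small steps -/
def TStep (c c' : Option (TM2.Stmt (fun _ : K => Γ) Λ σ × σ) × (K → List Γ)) : Prop :=
  ∃ x o, c.1 = some x ∧ TRule T x o c'.1 ∧ o.Rel c.2 c'.2

/-- configurations after a big step -/
def ofCfg (c : TM2.Cfg (fun _ : K => Γ) Λ σ) :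
    Option (TM2.Stmt (fun _ : K => Γ) Λ σ × σ) × (K → List Γ) :=
  (c.l.map fun l => (T l, c.var), c.stk)

theorem TStep_stepAux (q : TM2.Stmt (fun _ : K => Γ) Λ σ) (v : σ) (S : K → List Γ) :
    Relation.ReflTransGen (TStep T) (some (q, v), S) (ofCfg T (TM2.stepAux q v S)) := by
  induction q generalizing v S with
  | push k f q ih =>
    exact Relation.ReflTransGen.head (b := (some (q, v), Function.update S k (f v :: S k)))
      (show TStep T _ _ from ⟨_, _, rfl, TRule.push k f q v, rfl⟩) (ih _ _)
  | peek k f q ih =>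
    exact Relation.ReflTransGen.head (b := (some (q, f v (S k).head?), S))
      (show TStep T _ _ from ⟨_, _, rfl, TRule.peek k f q v _, rfl, rfl⟩) (ih _ _)
  | pop k f q ih =>
    exact Relation.ReflTransGen.head
      (b := (some (q, f v (S k).head?), Function.update S k (S k).tail))
      (show TStep T _ _ from ⟨_, _, rfl, TRule.pop k f q v _, rfl, rfl⟩) (ih _ _)
  | load a q ih =>
    exact Relation.ReflTransGen.head (b := (some (q, a v), S))
      (show TStep T _ _ from ⟨_, _, rfl, TRule.load a q v, rfl⟩) (ih _ _)
  | branch f q₁ q₂ ih₁ ih₂ =>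
    refine Relation.ReflTransGen.head (b := (some (cond (f v) q₁ q₂, v), S))
      (show TStep T _ _ from ⟨_, _, rfl, TRule.branch f q₁ q₂ v, rfl⟩) ?_
    simp only [TM2.stepAux]
    cases f v
    · exact ih₂ v S
    · exact ih₁ v S
  | goto f =>
    exact .single ⟨_, _, rfl, TRule.goto f v, rfl⟩
  | halt =>
    exact .single ⟨_, _, rfl, TRule.halt v, rfl⟩

theorem TStep_reaches {c c' : TM2.Cfg (fun _ : K => Γ) Λ σ} (h : TM2.Reaches T c c') :
    Relation.ReflTransGen (TStep T) (ofCfg T c) (ofCfg T c') := by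
  induction h with
  | refl => exact .refl
  | @tail b c _ h ih =>
    refine ih.trans ?_
    obtain ⟨l, v, S⟩ := b
    cases l with
    | none => simp [TM2.step] at h
    | some l =>
      simp only [TM2.step, Option.mem_def, Option.some.injEq] at h
      subst h
      exact TStep_stepAux T (T l) v S

theorem THalts.reach {q v S} (h : THalts T (some (q, v)) S) :
    ∃ S', Relation.ReflTransGen (TStep T) (some (q, v), S) (none, S') := by
  obtain ⟨v', S', h⟩ := h
  exact ⟨S', (TStep_stepAux T q v S).trans (TStep_reaches T h)⟩

variable {T}

/-- Set of statements, closed under small steps. -/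
theorem TRule.mem [Inhabited Λ] {A : Finset Λ} (hA : TM2.Supports T A) {q v o q' v'}
    (h : TRule T (q, v) o (some (q', v'))) (hq : some q ∈ TM2.stmts T A) :
    some q' ∈ TM2.stmts T A := by
  cases h with
  | push k f q v => exact TM2.stmts_trans (by simp [TM2.stmts₁, TM2.stmts₁_self]) hq
  | peek k f q v a => exact TM2.stmts_trans (by simp [TM2.stmts₁, TM2.stmts₁_self]) hq
  | pop k f q v a => exact TM2.stmts_trans (by simp [TM2.stmts₁, TM2.stmts₁_self]) hq
  | load a q v => exact TM2.stmts_trans (by simp [TM2.stmts₁, TM2.stmts₁_self]) hq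
  | branch f q₁ q₂ v =>
    refine TM2.stmts_trans ?_ hq
    cases f v <;> simp [TM2.stmts₁, TM2.stmts₁_self]
  | goto f v =>
    have h1 := TM2.stmts_supportsStmt hA hq
    have h2 : f v ∈ A := h1 v
    simp only [TM2.stmts, Finset.mem_insertNone, Finset.mem_biUnion, Option.mem_def,
      Option.some.injEq, forall_eq']
    exact ⟨f v, h2, TM2.stmts₁_self⟩

end TM

/-! ### Guessing the input -/

open PartrecToTM2

/-- binary numbers with `j` final ones -/
def hnum (j A : ℕ) : ℕ := (fun n => 2 * n + 1)^[j] (2 * A)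

theorem hnum_zero (A : ℕ) : hnum 0 A = 2 * A := rfl
theorem hnum_succ (j A : ℕ) : hnum (j + 1) A = 2 * hnum j A + 1 := by
  unfold hnum; rw [Function.iterate_succ_apply']

theorem hnum_inj {j j' A A' : ℕ} (h : hnum j A = hnum j' A') : j = j' ∧ A = A' := by
  induction j generalizing j' with
  | zero =>
    cases j' with
    | zero => simp only [hnum_zero] at h; omega
    | succ j' => simp only [hnum_zero, hnum_succ] at h; omega
  | succ j ih =>
    cases j' with
    | zero => simp only [hnum_zero, hnum_succ] at h; omega
    | succ j' =>
      simp only [hnum_succ] at h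
      have := ih (j' := j') (by omega)
      omega

variable {r : ℕ}

/-- number coding a word, reversed -/
def encR : List (Fin r) → ℕ
  | [] => 1
  | j :: l => hnum j (encR l)

theorem hnum_pos (j : ℕ) {A : ℕ} (h : 0 < A) : 1 < hnum j A := by
  induction j with
  | zero => simp only [hnum_zero]; omega
  | succ j ih => rw [hnum_succ]; omega

theorem encR_pos (l : List (Fin r)) : 0 < encR l := by
  induction l with
  | nil => exact one_pos
  | cons j l ih => exact (hnum_pos j ih).le

theorem encR_inj {l l' : List (Fin r)} (h : encR l = encR l') : l = l' := by
  induction l generalizing l' with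
  | nil =>
    cases l' with
    | nil => rfl
    | cons j l' =>
      have := hnum_pos j (encR_pos l')
      simp only [encR] at h
      omega
  | cons j l ih =>
    cases l' with
    | nil =>
      have := hnum_pos j (encR_pos l)
      simp only [encR] at h
      omega
    | cons j' l' =>
      simp only [encR] at h
      obtain ⟨h1, h2⟩ := hnum_inj h
      rw [ih h2, Fin.ext h1]

theorem primrec_encR : Primrec (encR (r := r)) := by
  have h1 : Primrec₂ fun (j : Fin r) (A : ℕ) => hnum j A := by
    have : Primrec fun x : Fin r × ℕ => (fun n => 2 * n + 1)^[(x.1 : ℕ)] (2 * x.2) :=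
      Primrec.nat_iterate (Primrec.fin_val.comp Primrec.fst)
        (Primrec.nat_mul.comp (Primrec.const 2) Primrec.snd)
        (Primrec.succ.comp (Primrec.nat_mul.comp (Primrec.const 2) Primrec.snd))
    exact this
  have h2 : Primrec fun l : List (Fin r) => l.foldr (fun (j : Fin r) (A : ℕ) => hnum (j : ℕ) A) 1 :=
    Primrec.list_foldr Primrec.id (Primrec.const 1) (h1.comp₂
      (Primrec.fst.comp₂ Primrec₂.right) (Primrec.snd.comp₂ Primrec₂.right))
  refine h2.of_eq fun l => ?_
  induction l with
  | nil => rfl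
  | cons j l ih => simp only [List.foldr_cons, ih, encR]

/-- number coding a word -/
def encW (w : List (Fin r)) : ℕ := encR w.reverse

theorem encW_inj {l l' : List (Fin r)} (h : encW l = encW l') : l = l' :=
  List.reverse_injective (encR_inj h)

theorem encW_pos (l : List (Fin r)) : 0 < encW l := encR_pos _

theorem encW_append (w : List (Fin r)) (j : Fin r) : encW (w ++ [j]) = hnum j (encW w) := by
  simp [encW, encR]

theorem trNat_bit1 (n : ℕ) : trNat (2 * n + 1) = Γ'.bit1 :: trNat n := by
  have h : ((2 * n + 1 : ℕ) : Num) = Num.bit1 (n : Num) := by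
    push_cast
    rw [two_mul, Num.bit1_of_bit1]
  rw [trNat, h, trNat]
  cases (n : Num) <;> rfl

theorem trNat_bit0 {n : ℕ} (hn : 0 < n) : trNat (2 * n) = Γ'.bit0 :: trNat n := by
  have h : ((2 * n : ℕ) : Num) = Num.bit0 (n : Num) := by
    push_cast
    rw [two_mul, Num.bit0_of_bit0]
  rw [trNat, h, trNat]
  have h2 : (n : Num) ≠ 0 := by
    intro h
    have : ((n : Num) : ℕ) = 0 := by rw [h]; rfl
    rw [Num.to_of_nat] at this
    omega
  cases hx : (n : Num) with
  | zero => exact absurd hx h2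
  | pos p => rfl

/-- An r.e. predicate on words is accepted by a code. -/
theorem exists_code_of_re {N : List (Fin r) → Prop} (hN : REPred N) :
    ∃ c : ToPartrec.Code, ∀ w, N w ↔ (c.eval [encW w]).Dom := by
  have h1 : REPred fun n : ℕ => ∃ w : List (Fin r), encW w = n ∧ N w := by
    refine re_exists (p := fun n w => encW w = n ∧ N w) (re_and ?_ (re_comp hN Computable.snd))
    refine ComputablePred.to_re (PrimrecPred.computablePred ?_)
    exact Primrec.eq.comp (primrec_encR.comp (Primrec.list_reverse.comp Primrec.snd)) Primrec.fst
  have h2 : Partrec fun n : ℕ => (Part.assert (∃ w : List (Fin r), encW w = n ∧ N w)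
      fun _ => Part.some ()).map fun _ => (0 : ℕ) :=
    Partrec.map h1 (Computable.const 0).to₂
  obtain ⟨c, hc⟩ := ToPartrec.Code.exists_code (Nat.Partrec'.part_iff₁.2 h2)
  refine ⟨c, fun w => ?_⟩
  have h3 := hc ⟨[encW w], rfl⟩
  rw [show (⟨[encW w], rfl⟩ : List.Vector ℕ 1).1 = [encW w] from rfl] at h3
  rw [h3]
  have h4 : List.Vector.head (⟨[encW w], rfl⟩ : List.Vector ℕ 1) = encW w := rfl
  rw [h4]
  constructor
  · intro hw
    exact ⟨⟨w, rfl, hw⟩, trivial⟩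
  · rintro ⟨⟨w', h5, h6⟩, -⟩
    rwa [← encW_inj h5]

end QISimple


set_option linter.unusedSectionVars false

namespace QISimple

open Turing PartrecToTM2

/-! ### Part 4d : the machine for an r.e. set of words -/

instance instFintypeKp : Fintype K' :=
  ⟨{K'.main, K'.rev, K'.aux, K'.stack}, by intro x; cases x <;> simp⟩

/-- statements occurring in the machine, with internal state -/
def MF (c : ToPartrec.Code) : Type :=
  {q : TM2.Stmt (fun _ : K' => Γ') Λ' (Option Γ') //
    some q ∈ TM2.stmts tr (codeSupp c Cont'.halt)} × Option Γ'

instance (c : ToPartrec.Code) : Finite (MF c) := by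
  have : Finite {q : TM2.Stmt (fun _ : K' => Γ') Λ' (Option Γ') //
    some q ∈ TM2.stmts tr (codeSupp c Cont'.halt)} := by
    have h := Set.Finite.preimage (f := (some : TM2.Stmt (fun _ : K' => Γ') Λ' (Option Γ') → _))
      (Option.some_injective _).injOn (Finset.finite_toSet (TM2.stmts tr (codeSupp c Cont'.halt)))
    exact h.to_subtype
  unfold MF
  infer_instance

/-- states of the whole machine -/
inductive MS (r : ℕ) (c : ToPartrec.Code) : Type
  | s0 | s1 | rd | acc
  | h (j : Fin r)
  | tm (x : MF c)

instance (r : ℕ) (c : ToPartrec.Code) : Finite (MS r c) := by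
  let f : Fin 4 ⊕ Fin r ⊕ MF c → MS r c := fun z => match z with
    | .inl i => if i = 0 then .s0 else if i = 1 then .s1 else if i = 2 then .rd else .acc
    | .inr (.inl j) => .h j
    | .inr (.inr x) => .tm x
  refine Finite.of_surjective f ?_
  rintro (_ | _ | _ | _ | j | x)
  · exact ⟨.inl 0, rfl⟩
  · exact ⟨.inl 1, rfl⟩
  · exact ⟨.inl 2, rfl⟩
  · exact ⟨.inl 3, rfl⟩
  · exact ⟨.inr (.inl j), rfl⟩
  · exact ⟨.inr (.inr x), rfl⟩

/-- initial statement -/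
def mfInit (c : ToPartrec.Code) : MF c :=
  (⟨tr (trNormal c Cont'.halt), by
    have h := (tr_supports c Cont'.halt).1
    simp only [TM2.stmts, Finset.mem_insertNone, Finset.mem_biUnion, Option.mem_def]
    intro a ha
    obtain rfl := Option.some_injective _ ha
    exact ⟨_, h, TM2.stmts₁_self⟩⟩, none)

variable {r : ℕ}

/-- rules of the whole machine -/
inductive MRule (c : ToPartrec.Code) : MS r c → SOp K' Γ' → Option (Fin r) → MS r c → Prop
  | a0 : MRule c .s0 (.push K'.main Γ'.cons) none .s1
  | a1 : MRule c .s1 (.push K'.main Γ'.bit1) none .rd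
  | b0 (j : Fin r) (hj : j.1 = 0) : MRule c .rd (.push K'.main Γ'.bit0) none (.h j)
  | b1 (j j' : Fin r) (hj : j'.1 = j.1 + 1) : MRule c (.h j) (.push K'.main Γ'.bit1) none (.h j')
  | b2 (j : Fin r) : MRule c (.h j) .nop (some j) .rd
  | t0 : MRule c .rd .nop none (.tm (mfInit c))
  | t1 (x y : MF c) (o) (h : TRule tr (x.1.1, x.2) o (some (y.1.1, y.2))) :
      MRule c (.tm x) o none (.tm y)
  | t2 (x : MF c) (o) (h : TRule tr (x.1.1, x.2) o none) : MRule c (.tm x) o none .acc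

/-- stacks with given main stack -/
def mstk (l : List Γ') : K' → List Γ' := K'.elim l [] [] []

theorem mstk_push (l : List Γ') (a : Γ') :
    Function.update (mstk l) K'.main (a :: mstk l K'.main) = mstk (a :: l) := by
  funext k
  cases k <;> simp [mstk, Function.update]

theorem halt_iff (c : ToPartrec.Code) (n : ℕ) :
    (c.eval [n]).Dom ↔
      THalts tr (some ((mfInit c).1.1, (mfInit c).2)) (mstk (trNat n ++ [Γ'.cons])) := by
  have hst : mstk (trNat n ++ [Γ'.cons]) = K'.elim (trList [n]) [] [] [] := by
    simp [mstk, trList]; try rfl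
  have he : StateTransition.eval (TM2.step tr) ⟨some (trNormal c Cont'.halt), none,
      mstk (trNat n ++ [Γ'.cons])⟩ = halt <$> c.eval [n] := by
    rw [hst]
    exact tr_eval c [n]
  constructor
  · intro h
    obtain ⟨v, hv⟩ := Part.dom_iff_mem.1 h
    have h1 : halt v ∈ StateTransition.eval (TM2.step tr) ⟨some (trNormal c Cont'.halt), none,
        mstk (trNat n ++ [Γ'.cons])⟩ := by
      rw [he]
      exact Part.mem_map _ hv
    have h2 := (StateTransition.mem_eval.1 h1).1
    rcases Relation.ReflTransGen.cases_head h2 with h3 | ⟨b, h3, h4⟩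
    · have := congrArg TM2.Cfg.l h3
      simp [halt] at this
    · simp only [TM2.step] at h3
      obtain rfl := Option.some_injective _ h3
      exact ⟨_, _, h4⟩
  · rintro ⟨v', S', h⟩
    have h1 : (⟨none, v', S'⟩ : TM2.Cfg (fun _ : K' => Γ') Λ' (Option Γ')) ∈
        StateTransition.eval (TM2.step tr) ⟨some (trNormal c Cont'.halt), none,
          mstk (trNat n ++ [Γ'.cons])⟩ := by
      refine StateTransition.mem_eval.2 ⟨?_, rfl⟩
      exact Relation.ReflTransGen.head (by simp only [TM2.step]; rfl) h
    rw [he] at h1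
    obtain ⟨b, hb, -⟩ := (Part.mem_map_iff _).1 h1
    exact Part.dom_iff_mem.2 ⟨b, hb⟩

/-- the invariant of the machine -/
def MInv (N : List (Fin r) → Prop) (c : ToPartrec.Code) :
    MS r c × (K' → List Γ') × List (Fin r) → Prop
  | (.s0, S, w) => S = mstk [] ∧ w = []
  | (.s1, S, w) => S = mstk [Γ'.cons] ∧ w = []
  | (.rd, S, w) => S = mstk (trNat (encW w) ++ [Γ'.cons])
  | (.h j, S, w) => S = mstk (trNat (hnum j (encW w)) ++ [Γ'.cons])
  | (.tm x, S, w) => THalts tr (some (x.1.1, x.2)) S → N w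
  | (.acc, _, w) => N w

theorem MInv.step {N : List (Fin r) → Prop} {c : ToPartrec.Code}
    (hc : ∀ w, N w ↔ (c.eval [encW w]).Dom) {x y} (hx : MInv N c x)
    (h : SStep (MRule c) x y) : MInv N c y := by
  obtain ⟨q, S, w⟩ := x
  obtain ⟨q', S', w'⟩ := y
  obtain ⟨o, p, h, ho, hw⟩ := h
  cases h with
  | a0 =>
    obtain ⟨rfl, rfl⟩ := hx
    simp only [SOp.Rel] at ho
    rw [mstk_push] at ho
    exact ⟨ho, hw⟩
  | a1 =>
    obtain ⟨rfl, rfl⟩ := hx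
    simp only [SOp.Rel] at ho
    rw [mstk_push] at ho
    simp only [List.nil_append, Option.toList] at hw
    subst hw
    have : trNat (encW ([] : List (Fin r))) = [Γ'.bit1] := by
      have := trNat_bit1 0
      simpa [encW, encR, trNat_zero] using this
    simp only [MInv]
    rw [ho, this]; rfl
  | b0 j hj =>
    simp only [MInv] at hx
    subst hx
    simp only [SOp.Rel] at ho
    rw [mstk_push] at ho
    simp only [List.append_nil, Option.toList] at hw
    subst hw
    simp only [MInv]
    rw [ho, hj, hnum_zero, trNat_bit0 (encW_pos _)]; rfl
  | b1 j j' hj =>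
    simp only [MInv] at hx
    subst hx
    simp only [SOp.Rel] at ho
    rw [mstk_push] at ho
    simp only [List.append_nil, Option.toList] at hw
    subst hw
    simp only [MInv]
    rw [ho, hj, hnum_succ, trNat_bit1]; rfl
  | b2 j =>
    simp only [MInv] at hx
    subst hx
    simp only [SOp.Rel] at ho
    simp only [Option.toList] at hw
    subst hw
    simp only [MInv]
    rw [ho, encW_append]
  | t0 =>
    simp only [MInv] at hx
    subst hx
    simp only [SOp.Rel] at ho
    simp only [Option.toList, List.append_nil] at hw
    subst hw
    subst ho
    simp only [MInv]
    rw [hc, halt_iff]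
    exact id
  | t1 x y o h =>
    simp only [Option.toList, List.append_nil] at hw
    subst hw
    intro h1
    exact hx (THalts.back h ho h1)
  | t2 x o h =>
    simp only [Option.toList, List.append_nil] at hw
    subst hw
    exact hx (THalts.back h ho trivial)

theorem mreach_h {c : ToPartrec.Code} (w : List (Fin r)) (j : ℕ) (hj : j < r) :
    Relation.ReflTransGen (SStep (MRule c))
      (MS.rd, mstk (trNat (encW w) ++ [Γ'.cons]), w)
      (MS.h ⟨j, hj⟩, mstk (trNat (hnum j (encW w)) ++ [Γ'.cons]), w) := by
  induction j with
  | zero =>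
    refine Relation.ReflTransGen.single ⟨_, none, MRule.b0 _ rfl, ?_, by simp⟩
    simp only [SOp.Rel]
    rw [mstk_push, hnum_zero, trNat_bit0 (encW_pos _)]; rfl
  | succ j ih =>
    refine (ih (by omega)).tail ⟨_, none, MRule.b1 _ _ rfl, ?_, by simp⟩
    simp only [SOp.Rel]
    rw [mstk_push, hnum_succ, trNat_bit1]; rfl

theorem mreach_rd {c : ToPartrec.Code} (w : List (Fin r)) :
    Relation.ReflTransGen (SStep (MRule c)) (MS.s0, mstk [], [])
      (MS.rd, mstk (trNat (encW w) ++ [Γ'.cons]), w) := by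
  induction w using List.reverseRecOn with
  | nil =>
    have : trNat (encW ([] : List (Fin r))) = [Γ'.bit1] := by
      have := trNat_bit1 0
      simpa [encW, encR, trNat_zero] using this
    rw [this]
    refine Relation.ReflTransGen.head (b := (MS.s1, mstk [Γ'.cons], []))
      ⟨_, none, MRule.a0, ?_, by simp⟩ (Relation.ReflTransGen.single
      ⟨_, none, MRule.a1, ?_, by simp⟩)
    · simp only [SOp.Rel]
      rw [mstk_push]
    · simp only [SOp.Rel]
      rw [mstk_push]; rfl
  | append_singleton w j ih =>
    refine (ih.trans (mreach_h w j.1 j.2)).tail ⟨_, some j, MRule.b2 j, ?_, by simp⟩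
    simp only [SOp.Rel]
    rw [encW_append]

theorem mreach_tm {c : ToPartrec.Code} (w : List (Fin r)) {x S S'}
    (h : Relation.ReflTransGen (TStep tr) (some (x.1.1, x.2), S) (none, S')) :
    Relation.ReflTransGen (SStep (MRule (r := r) c)) (MS.tm x, S, w) (MS.acc, S', w) := by
  generalize hz : ((some (x.1.1, x.2) : Option _), S) = z at h
  induction h using Relation.ReflTransGen.head_induction_on generalizing x S with
  | refl => simp at hz
  | @head a b h _ ih =>
    subst hz
    obtain ⟨u, o, h1, h2, h3⟩ := h
    simp only [Option.some.injEq] at h1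
    subst h1
    obtain ⟨b1, b2⟩ := b
    cases b1 with
    | none =>
      refine Relation.ReflTransGen.head (b := (MS.acc, b2, w))
        ⟨o, none, MRule.t2 _ _ h2, h3, by simp⟩ ?_
      rename_i h4
      rcases Relation.ReflTransGen.cases_head h4 with h5 | ⟨y, ⟨_, _, h5, _⟩, _⟩
      · cases h5; exact .refl
      · simp at h5
    | some b1 =>
      obtain ⟨q', v'⟩ := b1
      let _ : Inhabited Λ' := ⟨trNormal c Cont'.halt⟩
      have hm := TRule.mem (tr_supports c Cont'.halt) h2 x.1.2
      exact Relation.ReflTransGen.head (b := (MS.tm ⟨⟨q', hm⟩, v'⟩, b2, w))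
        ⟨o, none, MRule.t1 _ ⟨⟨q', hm⟩, v'⟩ _ h2, h3, by simp⟩ (ih rfl)

/-- Every r.e. set of words is enumerated by a counter machine. -/
theorem exists_machine {N : List (Fin r) → Prop} (hN : REPred N) :
    ∃ M : CMachine r, ∀ w, N w ↔ ∃ α, Relation.ReflTransGen M.Step (M.q0, 0, []) (M.q1, α, w) := by
  obtain ⟨c, hc⟩ := exists_code_of_re hN
  refine ⟨toCMachine (MRule c) MS.s0 MS.acc, fun w => ?_⟩
  rw [toCMachine_reach]
  have h0 : (fun _ : K' => ([] : List Γ')) = mstk [] := by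
    funext k; cases k <;> rfl
  rw [h0]
  constructor
  · intro hw
    rw [hc, halt_iff] at hw
    obtain ⟨S', hS'⟩ := THalts.reach tr hw
    refine ⟨S', (mreach_rd w).trans (Relation.ReflTransGen.head
      (b := (MS.tm (mfInit c), mstk (trNat (encW w) ++ [Γ'.cons]), w))
      ⟨.nop, none, MRule.t0, rfl, by simp⟩ (mreach_tm w hS'))⟩
  · rintro ⟨S, h⟩
    have : ∀ y, Relation.ReflTransGen (SStep (MRule c)) (MS.s0, mstk [], []) y → MInv N c y := by
      intro y hy
      induction hy with
      | refl => exact ⟨rfl, rfl⟩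
      | tail _ h ih => exact ih.step hc h
    exact this _ h

end QISimple


set_option linter.unusedSectionVars false

namespace QISimple

/-! ### Part 5a : partial swaps and partial actions -/

section pswap

variable {Ω A : Type}

/-- two injections with disjoint ranges -/
structure Dj (i j : A → Ω) : Prop where
  inj_l : Function.Injective i
  inj_r : Function.Injective j
  ne : ∀ a b, i a ≠ j b

theorem Dj.symm {i j : A → Ω} (h : Dj i j) : Dj j i := ⟨h.2, h.1, fun a b e => h.3 b a e.symm⟩

open Classical in
/-- partial swap, as a function -/
noncomputable def swapF (i j : A → Ω) (ω : Ω) : Ω :=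
  if h : ∃ a, i a = ω then j h.choose else if h : ∃ a, j a = ω then i h.choose else ω

theorem swapF_l {i j : A → Ω} (h : Dj i j) (a : A) : swapF i j (i a) = j a := by
  unfold swapF
  have h1 : ∃ b, i b = i a := ⟨a, rfl⟩
  rw [dif_pos h1, h.1 h1.choose_spec]

theorem swapF_r {i j : A → Ω} (h : Dj i j) (a : A) : swapF i j (j a) = i a := by
  unfold swapF
  have h0 : ¬ ∃ b, i b = j a := by
    rintro ⟨b, hb⟩
    exact h.3 _ _ hb
  have h1 : ∃ b, j b = j a := ⟨a, rfl⟩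
  rw [dif_neg h0, dif_pos h1, h.2 h1.choose_spec]

theorem swapF_of {i j : A → Ω} {ω : Ω} (h1 : ∀ a, i a ≠ ω) (h2 : ∀ a, j a ≠ ω) :
    swapF i j ω = ω := by
  unfold swapF
  rw [dif_neg (by rintro ⟨a, h⟩; exact h1 a h), dif_neg (by rintro ⟨a, h⟩; exact h2 a h)]

theorem swapF_swapF {i j : A → Ω} (h : Dj i j) (ω : Ω) : swapF i j (swapF i j ω) = ω := by
  by_cases h1 : ∃ a, i a = ω
  · obtain ⟨a, rfl⟩ := h1
    rw [swapF_l h, swapF_r h]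
  · by_cases h2 : ∃ a, j a = ω
    · obtain ⟨a, rfl⟩ := h2
      rw [swapF_r h, swapF_l h]
    · have := swapF_of (i := i) (j := j) (ω := ω) (fun a e => h1 ⟨a, e⟩) (fun a e => h2 ⟨a, e⟩)
      rw [this, this]

/-- partial swap -/
noncomputable def pswap (i j : A → Ω) (h : Dj i j) : Equiv.Perm Ω :=
  ⟨swapF i j, swapF i j, swapF_swapF h, swapF_swapF h⟩

variable {i j k : A → Ω}

theorem pswap_l (h : Dj i j) (a : A) : pswap i j h (i a) = j a := swapF_l h a
theorem pswap_r (h : Dj i j) (a : A) : pswap i j h (j a) = i a := swapF_r h a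
theorem pswap_of (h : Dj i j) {ω : Ω} (h1 : ∀ a, i a ≠ ω) (h2 : ∀ a, j a ≠ ω) :
    pswap i j h ω = ω := swapF_of h1 h2
theorem pswap_mul_self (h : Dj i j) : pswap i j h * pswap i j h = 1 := by
  ext ω
  exact swapF_swapF h ω

theorem pswap_inv (h : Dj i j) : (pswap i j h)⁻¹ = pswap i j h :=
  inv_eq_of_mul_eq_one_left (pswap_mul_self h)

theorem pswap_ext (h : Dj i j) {p : Equiv.Perm Ω} (h1 : ∀ a, p (i a) = j a)
    (h2 : ∀ a, p (j a) = i a) (h3 : ∀ ω, (∀ a, i a ≠ ω) → (∀ a, j a ≠ ω) → p ω = ω) :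
    p = pswap i j h := by
  ext ω
  by_cases e1 : ∃ a, i a = ω
  · obtain ⟨a, rfl⟩ := e1
    rw [h1, pswap_l h]
  · by_cases e2 : ∃ a, j a = ω
    · obtain ⟨a, rfl⟩ := e2
      rw [h2, pswap_r h]
    · push Not at e1 e2
      rw [h3 ω e1 e2, pswap_of h e1 e2]

theorem pswap_symm (h : Dj i j) : pswap i j h = pswap j i h.symm :=
  pswap_ext h.symm (pswap_r h) (pswap_l h) fun _ h1 h2 => pswap_of h h2 h1

theorem perm_inv_eq {s : Equiv.Perm Ω} {a b : Ω} (h : s a = b) : s⁻¹ b = a :=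
  Equiv.Perm.inv_eq_iff_eq.2 h.symm

theorem pswap_conj (h : Dj i j) (s : Equiv.Perm Ω) {i' j' : A → Ω} (h' : Dj i' j')
    (hi : ∀ a, s (i a) = i' a) (hj : ∀ a, s (j a) = j' a) :
    s * pswap i j h * s⁻¹ = pswap i' j' h' := by
  refine pswap_ext h' (fun a => ?_) (fun a => ?_) (fun ω h1 h2 => ?_)
  · rw [Equiv.Perm.mul_apply, Equiv.Perm.mul_apply, perm_inv_eq (hi a), pswap_l h, hj]
  · rw [Equiv.Perm.mul_apply, Equiv.Perm.mul_apply, perm_inv_eq (hj a), pswap_r h, hi]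
  · rw [Equiv.Perm.mul_apply, Equiv.Perm.mul_apply, pswap_of h]
    · exact Equiv.apply_symm_apply s ω
    · intro a e
      apply h1 a
      rw [← hi, e]
      exact Equiv.apply_symm_apply s ω
    · intro a e
      apply h2 a
      rw [← hj, e]
      exact Equiv.apply_symm_apply s ω

/-- three-cycles are commutators -/
theorem pswap_comm (h1 : Dj i j) (h2 : Dj j k) (h3 : Dj i k) :
    pswap i j h1 * pswap j k h2 =
      pswap i k h3 * pswap j k h2 * (pswap i k h3)⁻¹ * (pswap j k h2)⁻¹ := by
  rw [pswap_inv h2]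
  congr 1
  rw [pswap_symm h1]
  refine (pswap_conj h2 _ h1.symm (fun a => ?_) (fun a => ?_)).symm
  · exact pswap_of h3 (fun b => h1.3 b a) (fun b => h2.symm.3 b a)
  · exact pswap_r h3 a

end pswap

section pact

variable {Ω A : Type}

/-- the partial action, along an injection -/
noncomputable def pact (i : A → Ω) (hi : Function.Injective i) (e : Equiv.Perm A) : Equiv.Perm Ω :=
  e.viaEmbedding ⟨i, hi⟩

theorem pact_apply {i : A → Ω} (hi : Function.Injective i) (e : Equiv.Perm A) (a : A) :
    pact i hi e (i a) = i (e a) := Equiv.Perm.viaEmbedding_apply e ⟨i, hi⟩ a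

theorem pact_of {i : A → Ω} (hi : Function.Injective i) (e : Equiv.Perm A) {ω : Ω}
    (h : ∀ a, i a ≠ ω) : pact i hi e ω = ω :=
  Equiv.Perm.viaEmbedding_apply_of_notMem e ⟨i, hi⟩ ω (by rintro ⟨a, ha⟩; exact h a ha)

theorem pact_ext {i : A → Ω} (hi : Function.Injective i) (e : Equiv.Perm A) {p : Equiv.Perm Ω}
    (h1 : ∀ a, p (i a) = i (e a)) (h2 : ∀ ω, (∀ a, i a ≠ ω) → p ω = ω) : p = pact i hi e := by
  ext ω
  by_cases e1 : ∃ a, i a = ω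
  · obtain ⟨a, rfl⟩ := e1
    rw [h1, pact_apply hi]
  · push Not at e1
    rw [h2 ω e1, pact_of hi e e1]

theorem pact_mul {i : A → Ω} (hi : Function.Injective i) (e f : Equiv.Perm A) :
    pact i hi (e * f) = pact i hi e * pact i hi f := by
  refine (pact_ext hi _ (fun a => ?_) fun ω h => ?_).symm
  · rw [Equiv.Perm.mul_apply, pact_apply hi, pact_apply hi]; rfl
  · rw [Equiv.Perm.mul_apply, pact_of hi f h, pact_of hi e h]

theorem pact_conj {i : A → Ω} (hi : Function.Injective i) (e : Equiv.Perm A) (s : Equiv.Perm Ω)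
    {i' : A → Ω} (hi' : Function.Injective i') (h : ∀ a, s (i a) = i' a) :
    s * pact i hi e * s⁻¹ = pact i' hi' e := by
  refine pact_ext hi' e (fun a => ?_) (fun ω h1 => ?_)
  · rw [Equiv.Perm.mul_apply, Equiv.Perm.mul_apply, perm_inv_eq (h a), pact_apply hi, h]
  · rw [Equiv.Perm.mul_apply, Equiv.Perm.mul_apply, pact_of hi]
    · exact Equiv.apply_symm_apply s ω
    · intro a e
      apply h1 a
      rw [← h, e]
      exact Equiv.apply_symm_apply s ω

end pact

/-! ### Streams -/

section streams

variable {α : Type}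

theorem append_stream_inj (u : List α) : Function.Injective fun x : Stream' α => u ++ₛ x := by
  induction u with
  | nil => exact fun _ _ h => h
  | cons a u ih =>
    intro x y h
    exact ih (Stream'.cons_injective2 h).2

theorem append_stream_comparable {u v : List α} {x y : Stream' α} (h : u ++ₛ x = v ++ₛ y) :
    u <+: v ∨ v <+: u := by
  induction u generalizing v with
  | nil => left; exact List.nil_prefix
  | cons a u ih =>
    cases v with
    | nil => right; exact List.nil_prefix
    | cons b v =>
      obtain ⟨rfl, h2⟩ := Stream'.cons_injective2 h
      rcases ih h2 with h | h
      · left; exact (List.prefix_cons_inj a).2 h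
      · right; exact (List.prefix_cons_inj a).2 h

theorem append_stream_pre {u v : List α} {x y : Stream' α} (h : u ++ₛ x = v ++ₛ y)
    (hl : u.length ≤ v.length) : u <+: v := by
  rcases append_stream_comparable h with h | h
  · exact h
  · rw [h.eq_of_length_le hl]

end streams

/-- incomparable words -/
def Inc (u v : List Bool) : Prop := ¬ u <+: v ∧ ¬ v <+: u

theorem Inc.symm {u v : List Bool} (h : Inc u v) : Inc v u := ⟨h.2, h.1⟩

theorem Inc.append {u v : List Bool} (h : Inc u v) (w w' : List Bool) : Inc (u ++ w) (v ++ w') := by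
  constructor
  · intro h1
    have h2 : u <+: v ++ w' := (List.prefix_append u w).trans h1
    rcases List.prefix_or_prefix_of_prefix h2 (List.prefix_append v w') with h3 | h3
    · exact h.1 h3
    · exact h.2 h3
  · intro h1
    have h2 : v <+: u ++ w := (List.prefix_append v w').trans h1
    rcases List.prefix_or_prefix_of_prefix h2 (List.prefix_append u w) with h3 | h3
    · exact h.2 h3
    · exact h.1 h3

theorem Inc.append_left_iff {u v w : List Bool} : Inc (w ++ u) (w ++ v) ↔ Inc u v := by
  simp [Inc, List.prefix_append_right_inj]

theorem Inc.of_head {a b : Bool} (h : a ≠ b) (u v : List Bool) : Inc (a :: u) (b :: v) := by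
  constructor
  · intro h1; exact h (List.cons_prefix_cons.1 h1).1
  · intro h1; exact h (List.cons_prefix_cons.1 h1).1.symm

theorem Inc.cons_iff {a : Bool} {u v : List Bool} : Inc (a :: u) (a :: v) ↔ Inc u v := by
  simp [Inc, List.cons_prefix_cons]

theorem Inc.ne_nil {u v : List Bool} (h : Inc u v) : u ≠ [] := by
  rintro rfl
  exact h.1 List.nil_prefix

end QISimple


set_option linter.unusedSectionVars false

namespace QISimple

/-! ### Part 5b : the simple group -/

/-- the space acted upon -/
abbrev Om (G : Type) : Type := Stream' Bool × Stream' G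

section simple

variable {G : Type}

/-- the cone map of a binary word -/
def cone (u : List Bool) (ω : Om G) : Om G := (u ++ₛ ω.1, ω.2)

/-- the brick map of a binary word and a word in `G` -/
def cc (u : List Bool) (ys : List G) (ω : Om G) : Om G := (u ++ₛ ω.1, ys ++ₛ ω.2)

/-- push a letter on the second tape -/
def push (h : G) (ω : Om G) : Om G := (ω.1, Stream'.cons h ω.2)

theorem cone_injective (u : List Bool) : Function.Injective (cone (G := G) u) := by
  rintro ⟨x, y⟩ ⟨x', y'⟩ h
  obtain ⟨h1, h2⟩ := Prod.ext_iff.1 h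
  exact Prod.ext (append_stream_inj u h1) h2

theorem push_injective (g : G) : Function.Injective (push g) := by
  rintro ⟨x, y⟩ ⟨x', y'⟩ h
  obtain ⟨h1, h2⟩ := Prod.ext_iff.1 h
  exact Prod.ext h1 (Stream'.cons_injective2 h2).2

theorem cone_append (u v : List Bool) (ω : Om G) : cone (u ++ v) ω = cone u (cone v ω) := by
  simp [cone]

theorem cone_nil (ω : Om G) : cone [] ω = ω := rfl

theorem cone_push (u : List Bool) (g : G) (ω : Om G) : cone u (push g ω) = push g (cone u ω) := rfl

theorem cc_eq (u : List Bool) (ys : List G) (ω : Om G) : cc u ys ω = cone u (cc [] ys ω) := rfl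

theorem cc_cons (u : List Bool) (g : G) (ys : List G) (ω : Om G) :
    cc u (g :: ys) ω = cone u (push g (cc [] ys ω)) := rfl

theorem cc_append (u u' : List Bool) (ys ys' : List G) (ω : Om G) :
    cc (u ++ u') (ys ++ ys') ω = cc u ys (cc u' ys' ω) := by
  simp [cc]

theorem cone_ne {u v : List Bool} (h : Inc u v) (ω ω' : Om G) : cone u ω ≠ cone v ω' := by
  intro e
  rcases append_stream_comparable (Prod.ext_iff.1 e).1 with h1 | h1
  · exact h.1 h1
  · exact h.2 h1

theorem dj_cone {u v : List Bool} (h : Inc u v) : Dj (cone (G := G) u) (cone v) :=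
  ⟨cone_injective u, cone_injective v, cone_ne h⟩

variable (G) in
/-- swap of two cones -/
noncomputable def sig (u v : List Bool) (h : Inc u v) : Equiv.Perm (Om G) :=
  pswap (cone u) (cone v) (dj_cone h)

theorem sig_l {u v : List Bool} (h : Inc u v) (ω : Om G) : sig G u v h (cone u ω) = cone v ω :=
  pswap_l _ _

theorem sig_r {u v : List Bool} (h : Inc u v) (ω : Om G) : sig G u v h (cone v ω) = cone u ω :=
  pswap_r _ _

theorem sig_fix {u v : List Bool} (h : Inc u v) {c : List Bool} (h1 : Inc u c) (h2 : Inc v c)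
    (ω : Om G) : sig G u v h (cone c ω) = cone c ω :=
  pswap_of _ (fun _ => cone_ne h1 _ _) (fun _ => cone_ne h2 _ _)

theorem cone_cases (ω : Om G) : (∃ ω', ω = cone [false] ω') ∨ ∃ ω', ω = cone [true] ω' := by
  obtain ⟨x, y⟩ := ω
  have hx := Stream'.eta x
  cases hb : Stream'.head x
  · left
    refine ⟨(Stream'.tail x, y), Prod.ext ?_ rfl⟩
    rw [hb] at hx
    exact hx.symm
  · right
    refine ⟨(Stream'.tail x, y), Prod.ext ?_ rfl⟩
    rw [hb] at hx
    exact hx.symm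

theorem sig_split {u v : List Bool} (h : Inc u v) :
    sig G u v h = sig G (u ++ [false]) (v ++ [false]) (h.append _ _) *
      sig G (u ++ [true]) (v ++ [true]) (h.append _ _) := by
  have hu : Inc (u ++ [true]) (u ++ [false]) :=
    Inc.append_left_iff.2 (Inc.of_head (by decide) _ _)
  have hv : Inc (v ++ [true]) (v ++ [false]) :=
    Inc.append_left_iff.2 (Inc.of_head (by decide) _ _)
  refine (pswap_ext _ (fun ω => ?_) (fun ω => ?_) (fun ω h1 h2 => ?_)).symm
  · rw [Equiv.Perm.mul_apply]
    rcases cone_cases ω with ⟨ω', rfl⟩ | ⟨ω', rfl⟩ <;> rw [← cone_append, ← cone_append]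
    · rw [sig_fix _ hu (h.symm.append _ _), sig_l]
    · rw [sig_l, sig_fix _ (h.append _ _) hv.symm]
  · rw [Equiv.Perm.mul_apply]
    rcases cone_cases ω with ⟨ω', rfl⟩ | ⟨ω', rfl⟩ <;> rw [← cone_append, ← cone_append]
    · rw [sig_fix _ (h.append _ _) hv, sig_r]
    · rw [sig_r, sig_fix _ hu.symm (h.symm.append _ _)]
  · rw [Equiv.Perm.mul_apply]
    have h3 : ∀ b ω', cone (u ++ [b]) ω' ≠ ω := fun b ω' e => h1 (cone [b] ω') (by
      rw [← cone_append, e])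
    have h4 : ∀ b ω', cone (v ++ [b]) ω' ≠ ω := fun b ω' e => h2 (cone [b] ω') (by
      rw [← cone_append, e])
    rw [show sig G (u ++ [true]) (v ++ [true]) (h.append _ _) ω = ω from
      pswap_of _ (h3 _) (h4 _)]
    exact pswap_of _ (h3 _) (h4 _)

variable [Group G]

/-- multiplication of the first letter -/
def Yg (g : G) : Equiv.Perm (Om G) where
  toFun ω := (ω.1, Stream'.cons (g * Stream'.head ω.2) (Stream'.tail ω.2))
  invFun ω := (ω.1, Stream'.cons (g⁻¹ * Stream'.head ω.2) (Stream'.tail ω.2))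
  left_inv ω := by simp [Stream'.eta]
  right_inv ω := by simp [Stream'.eta]

theorem Yg_push (g h : G) (ω : Om G) : Yg g (push h ω) = push (g * h) ω := rfl

theorem Yg_cone (g : G) (u : List Bool) (ω : Om G) : Yg g (cone u ω) = cone u (Yg g ω) := rfl

theorem Yg_mul (g h : G) : Yg (g * h) = Yg g * Yg h := by
  ext ω
  · rfl
  · simp [Yg, mul_assoc]

theorem inc_00_01 : Inc [false, false] [false, true] := by unfold Inc; decide

variable (G) in
/-- the second injection for `tau` -/
def cpush (ω : Om G) : Om G := cone [false, true] (push 1 ω)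

theorem dj_tau : Dj (cone (G := G) [false, false]) (cpush G) :=
  ⟨cone_injective _, (cone_injective _).comp (push_injective 1),
    fun _ _ => cone_ne inc_00_01 _ _⟩

variable (G) in
/-- the pushing element -/
noncomputable def tau : Equiv.Perm (Om G) := pswap (cone [false, false]) (cpush G) dj_tau

/-- the copy of `G` -/
noncomputable def gam (g : G) : Equiv.Perm (Om G) :=
  pact (cone [false, false]) (cone_injective _) (Yg g)

theorem gam_mul (g h : G) : gam (g * h) = gam g * gam h := by
  unfold gam
  rw [Yg_mul, pact_mul]

theorem gam_apply (g : G) (ω : Om G) :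
    gam g (cone [false, false] ω) = cone [false, false] (Yg g ω) := pact_apply _ _ _

variable (G) in
/-- generators of the simple group -/
inductive SGen : Equiv.Perm (Om G) → Prop
  | sig (u v h) : SGen (sig G u v h)
  | tau : SGen (tau G)
  | gam (g) : SGen (gam g)

variable (G) in
/-- the simple group -/
def SG : Subgroup (Equiv.Perm (Om G)) := Subgroup.closure {p | SGen G p}

theorem sig_mem {u v : List Bool} (h : Inc u v) : sig G u v h ∈ SG G :=
  Subgroup.subset_closure (SGen.sig u v h)
theorem tau_mem : tau G ∈ SG G := Subgroup.subset_closure SGen.tau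
theorem gam_mem (g : G) : gam g ∈ SG G := Subgroup.subset_closure (SGen.gam g)

/-- transitivity on cones -/
theorem cone_trans {H : Subgroup (Equiv.Perm (Om G))} (hH : ∀ u v h, sig G u v h ∈ H)
    {c d : List Bool} (hc : c ≠ []) (hd : d ≠ []) :
    ∃ t ∈ H, ∀ ω, t (cone c ω) = cone d ω := by
  by_cases h : Inc c d
  · exact ⟨_, hH _ _ h, sig_l h⟩
  · obtain ⟨a, c, rfl⟩ := List.exists_cons_of_ne_nil hc
    obtain ⟨b, d, rfl⟩ := List.exists_cons_of_ne_nil hd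
    have hab : a = b := by
      by_contra hab
      exact h (Inc.of_head hab _ _)
    subst hab
    have h1 : Inc (a :: c) [!a] := Inc.of_head (by cases a <;> decide) _ _
    have h2 : Inc [!a] (a :: d) := Inc.of_head (by cases a <;> decide) _ _
    refine ⟨_, H.mul_mem (hH _ _ h2) (hH _ _ h1), fun ω => ?_⟩
    rw [Equiv.Perm.mul_apply, sig_l, sig_l]

/-- bricks can be moved to a standard cone -/
theorem brick_trans (u : List Bool) (hu : u ≠ []) (ys : List G) :
    ∃ s ∈ SG G, ∀ ω, s (cc u ys ω) = cone [false, false] ω := by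
  induction ys generalizing u with
  | nil => exact cone_trans (fun _ _ => sig_mem) hu (by simp)
  | cons g ys ih =>
    obtain ⟨s, hs, h1⟩ := cone_trans (H := SG G) (fun _ _ => sig_mem) hu
      (show [false, false] ≠ [] by simp)
    obtain ⟨s', hs', h2⟩ := ih [false, false] (by simp)
    refine ⟨_, (SG G).mul_mem hs' ((SG G).mul_mem tau_mem ((SG G).mul_mem (sig_mem inc_00_01)
      ((SG G).mul_mem (gam_mem g⁻¹) hs))), fun ω => ?_⟩
    simp only [Equiv.Perm.mul_apply]
    rw [cc_cons, h1, gam_apply, sig_l, Yg_push, inv_mul_cancel]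
    have : tau G (cone [false, true] (push 1 (cc [] ys ω))) = cone [false, false] (cc [] ys ω) :=
      pswap_r dj_tau _
    rw [this, ← cc_eq, h2]

/-! #### locality -/

/-- elements act locally by replacing initial segments -/
def Loc (s : Equiv.Perm (Om G)) : Prop :=
  ∀ ω, ∃ u ys u' ys' ω₀, ω = cc u ys ω₀ ∧ ∀ ω', s (cc u ys ω') = cc u' ys' ω'

theorem cc_take (n m : ℕ) (ω : Om G) :
    ω = cc (ω.1.take n) (ω.2.take m) (ω.1.drop n, ω.2.drop m) := by
  simp [cc, Stream'.append_take_drop]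

theorem Loc.mul {s t : Equiv.Perm (Om G)} (hs : Loc s) (ht : Loc t) : Loc (s * t) := by
  intro ω
  obtain ⟨u, ys, u', ys', ω₀, rfl, h1⟩ := ht ω
  obtain ⟨p, ps, p', ps', η, h2, h3⟩ := hs (cc u' ys' ω₀)
  have h4 := cc_take p.length ps.length ω₀
  set e := ω₀.1.take p.length with he
  set es := ω₀.2.take ps.length with hes
  set ω₁ : Om G := (ω₀.1.drop p.length, ω₀.2.drop ps.length)
  rw [h4, ← cc_append] at h2
  obtain ⟨f, hf⟩ := append_stream_pre (Prod.ext_iff.1 h2).1.symm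
    (by simp [he])
  obtain ⟨fs, hfs⟩ := append_stream_pre (Prod.ext_iff.1 h2).2.symm
    (by simp [hes])
  refine ⟨u ++ e, ys ++ es, p' ++ f, ps' ++ fs, ω₁, ?_, fun ω' => ?_⟩
  · rw [cc_append, ← h4]
  · rw [Equiv.Perm.mul_apply, cc_append, h1, ← cc_append, ← hf, ← hfs, cc_append, h3, cc_append]

theorem loc_one : Loc (1 : Equiv.Perm (Om G)) := fun ω => ⟨[], [], [], [], ω, rfl, fun _ => rfl⟩

theorem loc_inv {s : Equiv.Perm (Om G)} (h : Loc s) : Loc s⁻¹ := by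
  intro ω
  obtain ⟨u, ys, u', ys', ω₀, h1, h2⟩ := h (s⁻¹ ω)
  refine ⟨u', ys', u, ys, ω₀, ?_, fun ω' => perm_inv_eq (h2 ω')⟩
  rw [← h2, ← h1]
  exact (Equiv.apply_symm_apply s ω).symm

theorem inc_take_of_not {u : List Bool} {ω : Om G} (h : ∀ ω', ω ≠ cone u ω') (n : ℕ)
    (hn : u.length ≤ n) : Inc u (ω.1.take n) := by
  have h1 : ¬ u <+: ω.1.take n := by
    rintro ⟨f, hf⟩
    apply h (f ++ₛ ω.1.drop n, ω.2)
    refine Prod.ext ?_ rfl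
    simp only [cone]
    rw [← Stream'.append_append_stream, hf, Stream'.append_take_drop]
  refine ⟨h1, fun h2 => h1 ?_⟩
  rw [h2.eq_of_length_le (by simpa using hn)]

theorem loc_sig {u v : List Bool} (h : Inc u v) : Loc (sig G u v h) := by
  intro ω
  by_cases h1 : ∃ ω', ω = cone u ω'
  · obtain ⟨ω', rfl⟩ := h1
    exact ⟨u, [], v, [], ω', rfl, sig_l h⟩
  by_cases h2 : ∃ ω', ω = cone v ω'
  · obtain ⟨ω', rfl⟩ := h2
    exact ⟨v, [], u, [], ω', rfl, sig_r h⟩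
  push Not at h1 h2
  have h3 := inc_take_of_not h1 (max u.length v.length) (le_max_left _ _)
  have h4 := inc_take_of_not h2 (max u.length v.length) (le_max_right _ _)
  exact ⟨_, [], _, [], _, cc_take (max u.length v.length) 0 ω, sig_fix h h3 h4⟩

theorem loc_tau : Loc (tau G) := by
  intro ω
  by_cases h1 : ∃ ω', ω = cone [false, false] ω'
  · obtain ⟨ω', rfl⟩ := h1
    exact ⟨_, [], [false, true], [1], ω', rfl, pswap_l dj_tau⟩
  by_cases h2 : ∃ ω', ω = cpush G ω'
  · obtain ⟨ω', rfl⟩ := h2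
    exact ⟨[false, true], [1], [false, false], [], ω', rfl, pswap_r dj_tau⟩
  push Not at h1 h2
  have h3 := inc_take_of_not h1 2 le_rfl
  refine ⟨ω.1.take 2, ω.2.take 1, ω.1.take 2, ω.2.take 1, _, cc_take 2 1 ω, fun ω' => ?_⟩
  refine pswap_of dj_tau (fun ω'' => cone_ne h3 ω'' (cc [] (ω.2.take 1) ω')) fun ω'' e => ?_
  apply h2 (ω.1.drop 2, ω.2.drop 1)
  have e1 := (Prod.ext_iff.1 e).1
  have e2 := (Prod.ext_iff.1 e).2
  have e3 : [false, true] = ω.1.take 2 := (append_stream_pre e1 (by simp)).eq_of_length (by simp)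
  have e4 : [1] = ω.2.take 1 := (append_stream_pre (u := [1]) e2 (by simp)).eq_of_length (by simp)
  have e5 := cc_take 2 1 ω
  rw [← e3, ← e4] at e5
  exact e5

theorem loc_gam (g : G) : Loc (gam g) := by
  intro ω
  by_cases h1 : ∃ ω', ω = cone [false, false] ω'
  · obtain ⟨ω', rfl⟩ := h1
    refine ⟨[false, false], ω'.2.take 1, [false, false], [g * ω'.2.head],
      (ω'.1, ω'.2.drop 1), ?_, fun η => ?_⟩
    · exact congrArg (cone [false, false]) (cc_take 0 1 ω')
    · rw [cc_eq, gam_apply]; rfl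
  push Not at h1
  have h3 := inc_take_of_not h1 2 le_rfl
  exact ⟨_, _, _, _, _, cc_take 2 0 ω, fun ω' => pact_of _ _ fun ω'' => cone_ne h3 _ _⟩

theorem loc_SG {s : Equiv.Perm (Om G)} (hs : s ∈ SG G) : Loc s := by
  induction hs using Subgroup.closure_induction with
  | mem p hp =>
    cases hp with
    | sig u v h => exact loc_sig h
    | tau => exact loc_tau
    | gam g => exact loc_gam g
  | one => exact loc_one
  | mul x y _ _ hx hy => exact hx.mul hy
  | inv x _ hx => exact loc_inv hx

theorem get_of_append_take {α : Type} {y z : Stream' α} {u : List α} {k n : ℕ} (hk : k < n)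
    (h : z = u ++ₛ y) (t : Stream' α) :
    (u ++ₛ (y.take n ++ₛ t)).get k = z.get k := by
  have h1 : ∀ t : Stream' α, (u ++ₛ (y.take n ++ₛ t)).get k = ((u ++ y.take n)[k]?).getD y.head := by
    intro t
    have hl : k < (u ++ y.take n).length := by simp; omega
    rw [← Stream'.append_append_stream, Stream'.get_append_left _ _ _ hl]
    simp [List.getElem?_eq_getElem hl]
  rw [h1, h, ← h1 (y.drop n), Stream'.append_take_drop]

/-- a nontrivial element displaces a brick -/
theorem displace {s : Equiv.Perm (Om G)} (hs : Loc s) (h1 : s ≠ 1) :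
    ∃ u ys, u ≠ [] ∧ ∀ ω ω' : Om G, s (cc u ys ω) ≠ cc u ys ω' := by
  obtain ⟨ω, hω⟩ : ∃ ω, s ω ≠ ω := by
    by_contra h
    push Not at h
    exact h1 (Equiv.ext h)
  obtain ⟨u, ys, u', ys', ω₀, h2, h3⟩ := hs ω
  have h4 : s ω = cc u' ys' ω₀ := by rw [h2, h3]
  obtain ⟨k, hk⟩ : ∃ k, (s ω).1.get k ≠ ω.1.get k ∨ (s ω).2.get k ≠ ω.2.get k := by
    by_contra h
    push Not at h
    exact hω (Prod.ext (Stream'.ext fun k => (h k).1) (Stream'.ext fun k => (h k).2))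
  refine ⟨u ++ ω₀.1.take (k + 1), ys ++ ω₀.2.take (k + 1), ?_, fun η η' e => ?_⟩
  · intro h
    have := congrArg List.length h
    simp at this
  · rw [cc_append, cc_append, h3] at e
    have e1 := congrArg (fun z : Om G => z.1.get k) e
    have e2 := congrArg (fun z : Om G => z.2.get k) e
    simp only [cc] at e1 e2
    rw [get_of_append_take (Nat.lt_succ_self k) (congrArg Prod.fst h4),
      get_of_append_take (Nat.lt_succ_self k) (congrArg Prod.fst h2)] at e1
    rw [get_of_append_take (Nat.lt_succ_self k) (congrArg Prod.snd h4),
      get_of_append_take (Nat.lt_succ_self k) (congrArg Prod.snd h2)] at e2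
    rcases hk with hk | hk
    · exact hk e1
    · exact hk e2

end simple

end QISimple


set_option linter.unusedSectionVars false

namespace QISimple

/-! ### Part 5c : simplicity -/

section simple

variable {G : Type} [Group G]

/-- subgroups of `SG` normalized by `SG` -/
structure NormIn (N : Subgroup (Equiv.Perm (Om G))) : Prop where
  le : N ≤ SG G
  conj : ∀ s ∈ SG G, ∀ n ∈ N, s * n * s⁻¹ ∈ N

variable {N : Subgroup (Equiv.Perm (Om G))}

theorem perm_fix_inv {Ω : Type} {a : Equiv.Perm Ω} {ω : Ω} (h : a ω = ω) : a⁻¹ ω = ω :=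
  perm_inv_eq h

/-- commutators of elements supported in a displaced set -/
theorem comm_displaced (hN : NormIn N) {n : Equiv.Perm (Om G)} (hn : n ∈ N) {U : Set (Om G)}
    (hU : ∀ ω ∈ U, n ω ∉ U) {a b : Equiv.Perm (Om G)} (ha : a ∈ SG G) (hb : b ∈ SG G)
    (ha' : ∀ ω, ω ∉ U → a ω = ω) (hb' : ∀ ω, ω ∉ U → b ω = ω) :
    a * b * a⁻¹ * b⁻¹ ∈ N := by
  -- `d = [a, n]` acts on `U` as `a`, up to an element supported off `U`
  have hd : a * (n * a⁻¹ * n⁻¹) ∈ N := by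
    have := N.mul_mem (hN.conj a ha n hn) (N.inv_mem hn)
    simpa [mul_assoc] using this
  have hcomm : (n * a⁻¹ * n⁻¹) * b = b * (n * a⁻¹ * n⁻¹) := by
    have key : ∀ ω ∈ U, (n * a⁻¹ * n⁻¹) ω = ω := by
      intro ω hω
      have h1 : n⁻¹ ω ∉ U := by
        intro h
        apply hU _ h
        rw [show n (n⁻¹ ω) = ω from Equiv.apply_symm_apply n ω]
        exact hω
      rw [Equiv.Perm.mul_apply, Equiv.Perm.mul_apply, perm_fix_inv (ha' _ h1)]
      exact Equiv.apply_symm_apply n ω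
    have keyb : ∀ ω, b ω ∈ U ↔ ω ∈ U := by
      intro ω
      constructor
      · intro h
        by_contra h1
        rw [hb' ω h1] at h
        exact h1 h
      · intro h
        by_contra h1
        have := hb' _ h1
        rw [b.injective this] at h1
        exact h1 h
    ext1 ω
    rw [Equiv.Perm.mul_apply, Equiv.Perm.mul_apply b]
    by_cases hω : ω ∈ U
    · rw [key ω hω, key _ ((keyb ω).2 hω)]
    · rw [hb' ω hω, hb' _ ?_]
      intro h
      have := key _ h
      exact hω ((n * a⁻¹ * n⁻¹).injective this ▸ h)
  set m := n * a⁻¹ * n⁻¹ with hm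
  have h2 := N.mul_mem hd (hN.conj b hb _ (N.inv_mem hd))
  have h3 : a * m * (b * (a * m)⁻¹ * b⁻¹) = a * b * a⁻¹ * b⁻¹ := by
    have : a * m * (b * (a * m)⁻¹ * b⁻¹) = a * (m * b) * m⁻¹ * a⁻¹ * b⁻¹ := by group
    rw [this, hcomm]
    group
  rwa [h3] at h2

/-- commutators of elements fixing a cone -/
theorem comm_cone (hN : NormIn N) (h1 : N ≠ ⊥) {c : List Bool} (hc : c ≠ [])
    {a b : Equiv.Perm (Om G)} (ha : a ∈ SG G) (hb : b ∈ SG G)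
    (ha' : ∀ ω, a (cone c ω) = cone c ω) (hb' : ∀ ω, b (cone c ω) = cone c ω) :
    a * b * a⁻¹ * b⁻¹ ∈ N := by
  obtain ⟨n, hn, hn1⟩ : ∃ n, n ∈ N ∧ n ≠ 1 := by
    obtain ⟨x, hx⟩ := Subgroup.ne_bot_iff_exists_ne_one.1 h1
    exact ⟨x.1, x.2, fun h => hx (Subtype.ext h)⟩
  obtain ⟨u, ys, hu, hd⟩ := displace (loc_SG (hN.le hn)) hn1
  obtain ⟨s, hs, hs'⟩ := brick_trans u hu ys
  obtain ⟨t, ht, ht'⟩ := cone_trans (H := SG G) (fun _ _ => sig_mem) hc (show [true] ≠ [] by simp)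
  obtain ⟨t₂, ht₂, ht₂'⟩ := cone_trans (H := SG G) (fun _ _ => sig_mem)
    (show [false] ≠ [] by simp) (show [false, false] ≠ [] by simp)
  -- `p` moves the complement of the cone into the brick
  set p := s⁻¹ * t₂ * t with hp
  have hpS : p ∈ SG G := (SG G).mul_mem ((SG G).mul_mem ((SG G).inv_mem hs) ht₂) ht
  have key : ∀ ω, (∃ ω', ω = cone c ω') ∨ ∃ ω', p ω = cc u ys ω' := by
    intro ω
    rcases cone_cases (t ω) with ⟨ω', h⟩ | ⟨ω', h⟩
    · right
      refine ⟨ω', ?_⟩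
      rw [hp, Equiv.Perm.mul_apply, Equiv.Perm.mul_apply, h, ht₂', perm_inv_eq (hs' ω')]
    · left
      refine ⟨ω', t.injective ?_⟩
      rw [h, ht']
  have supp : ∀ x : Equiv.Perm (Om G), (∀ ω, x (cone c ω) = cone c ω) →
      ∀ ω, ω ∉ Set.range (cc u ys) → (p * x * p⁻¹) ω = ω := by
    intro x hx ω hω
    rcases key (p⁻¹ ω) with ⟨ω', h⟩ | ⟨ω', h⟩
    · rw [Equiv.Perm.mul_apply, Equiv.Perm.mul_apply, h, hx, ← h]
      exact Equiv.apply_symm_apply p ω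
    · rw [show p (p⁻¹ ω) = ω from Equiv.apply_symm_apply p ω] at h
      exact absurd ⟨ω', h.symm⟩ hω
  have h3 := comm_displaced hN hn (U := Set.range (cc u ys))
    (by rintro _ ⟨ω, rfl⟩ ⟨ω', h⟩; exact hd ω ω' h.symm)
    ((SG G).mul_mem ((SG G).mul_mem hpS ha) ((SG G).inv_mem hpS))
    ((SG G).mul_mem ((SG G).mul_mem hpS hb) ((SG G).inv_mem hpS)) (supp a ha') (supp b hb')
  have h4 := hN.conj p⁻¹ ((SG G).inv_mem hpS) _ h3
  convert h4 using 1
  group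

theorem three_mem (hN : NormIn N) (h1 : N ≠ ⊥) {c : List Bool} (hc : c ≠ [])
    {i j k : Om G → Om G} (hij : Dj i j) (hjk : Dj j k) (hik : Dj i k)
    (hjkS : pswap j k hjk ∈ SG G) (hikS : pswap i k hik ∈ SG G)
    (hi : ∀ ω ω', i ω ≠ cone c ω') (hj : ∀ ω ω', j ω ≠ cone c ω')
    (hk : ∀ ω ω', k ω ≠ cone c ω') : pswap i j hij * pswap j k hjk ∈ N := by
  rw [pswap_comm hij hjk hik]
  exact comm_cone hN h1 hc hikS hjkS (fun ω => pswap_of _ (fun _ => hi _ _) fun _ => hk _ _)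
    (fun ω => pswap_of _ (fun _ => hj _ _) fun _ => hk _ _)

theorem sig_three (hN : NormIn N) (h1 : N ≠ ⊥) {p q r c : List Bool} (hpq : Inc p q)
    (hqr : Inc q r) (hpr : Inc p r) (hpc : Inc p c) (hqc : Inc q c) (hrc : Inc r c) :
    sig G p q hpq * sig G q r hqr ∈ N :=
  three_mem hN h1 hpc.symm.ne_nil (dj_cone hpq) (dj_cone hqr) (dj_cone hpr) (sig_mem hqr)
    (sig_mem hpr) (cone_ne hpc) (cone_ne hqc) (cone_ne hrc)

theorem sig_in (hN : NormIn N) (h1 : N ≠ ⊥) {u v : List Bool} (h : Inc u v) :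
    sig G u v h ∈ N := by
  have hu : Inc (u ++ [false]) (u ++ [true]) :=
    Inc.append_left_iff.2 (Inc.of_head (by decide) _ _)
  have hv : Inc (v ++ [false]) (v ++ [true]) :=
    Inc.append_left_iff.2 (Inc.of_head (by decide) _ _)
  have h2 := sig_three hN h1 (h.append [false] [false]) (h.symm.append [false] [true]) hu
    (h.append [false] [true]) hv (h.append [true] [true])
  have h3 := sig_three hN h1 (h.symm.append [false] [true]) (h.append [true] [true]) hv
    (h.symm.append [false] [false]) hu.symm (h.symm.append [true] [false])
  have h4 := N.mul_mem h2 h3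
  rw [sig_split h]
  convert h4 using 1
  rw [mul_assoc, ← mul_assoc (sig G (v ++ [false]) (u ++ [true]) _)]
  rw [show sig G (v ++ [false]) (u ++ [true]) (h.symm.append [false] [true]) *
    sig G (v ++ [false]) (u ++ [true]) (h.symm.append [false] [true]) = 1 from pswap_mul_self _,
    one_mul]

theorem inc_00_10 : Inc [false, false] [true, false] := by unfold Inc; decide
theorem inc_01_10 : Inc [false, true] [true, false] := by unfold Inc; decide
theorem inc_00_11 : Inc [false, false] [true, true] := by unfold Inc; decide
theorem inc_01_11 : Inc [false, true] [true, true] := by unfold Inc; decide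
theorem inc_10_11 : Inc [true, false] [true, true] := by unfold Inc; decide

theorem tau_in (hN : NormIn N) (h1 : N ≠ ⊥) : tau G ∈ N := by
  have hd : Dj (cpush G) (cone (G := G) [true, false]) :=
    ⟨dj_tau.2, cone_injective _, fun _ _ => cone_ne inc_01_10 _ _⟩
  have hS : pswap (cpush G) (cone [true, false]) hd ∈ SG G := by
    have := pswap_conj dj_tau (sig G _ _ inc_00_10) hd.symm (sig_l _) (fun ω =>
      pswap_of _ (fun _ => cone_ne inc_00_01 _ _) (fun _ => cone_ne inc_01_10.symm _ _))
    rw [pswap_symm, ← this]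
    exact (SG G).mul_mem ((SG G).mul_mem (sig_mem _) tau_mem) ((SG G).inv_mem (sig_mem _))
  have h2 := three_mem hN h1 (show [true, true] ≠ [] by simp) dj_tau.symm (dj_cone inc_00_10) hd
    (sig_mem inc_00_10) hS (fun _ _ => cone_ne inc_01_11 _ _) (cone_ne inc_00_11)
    (cone_ne inc_10_11)
  have h3 : pswap (cone [false, false]) (cone [true, false]) (dj_cone inc_00_10) ∈ N :=
    sig_in hN h1 inc_00_10
  have h4 := (Subgroup.mul_mem_cancel_right N h3).1 h2
  rwa [← pswap_symm] at h4

theorem gam_split (g : G) : gam g = pact (cone [false, false, false]) (cone_injective _) (Yg g) *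
    pact (cone [false, false, true]) (cone_injective _) (Yg g) := by
  have hI : Inc [false, false, false] [false, false, true] := by unfold Inc; decide
  refine (pact_ext _ _ (fun ω => ?_) fun ω h => ?_).symm
  · rw [Equiv.Perm.mul_apply]
    rcases cone_cases ω with ⟨ω', rfl⟩ | ⟨ω', rfl⟩
    · rw [Yg_cone, ← cone_append, ← cone_append]
      simp only [List.cons_append, List.nil_append]
      rw [pact_of (i := cone [false, false, true]) _ _ (fun _ => cone_ne hI.symm _ _)]
      exact pact_apply (cone_injective [false, false, false]) _ _
    · rw [Yg_cone, ← cone_append, ← cone_append]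
      have := pact_apply (cone_injective [false, false, true]) (Yg g) ω'
      simp only [List.cons_append, List.nil_append]
      rw [this]
      exact pact_of _ _ fun _ => cone_ne hI _ _
  · have h3 : ∀ b ω', cone [false, false, b] ω' ≠ ω := fun b ω' e => h (cone [b] ω') (by
      rw [← cone_append]; exact e)
    rw [Equiv.Perm.mul_apply, pact_of (i := cone [false, false, true]) _ _ (h3 _), pact_of _ _ (h3 _)]

theorem gam_in (hN : NormIn N) (h1 : N ≠ ⊥) (g : G) : gam g ∈ N := by
  have hH : ∀ u v h, sig G u v h ∈ N := fun _ _ h => sig_in hN h1 h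
  obtain ⟨t, ht, ht'⟩ := cone_trans hH (show [false, false] ≠ [] by simp)
    (show [false, false, false] ≠ [] by simp)
  obtain ⟨t₂, ht₂, ht₂'⟩ := cone_trans hH (show [false, false] ≠ [] by simp)
    (show [false, false, true] ≠ [] by simp)
  have h2 := gam_split g
  rw [← pact_conj (cone_injective _) (Yg g) t _ ht', ← pact_conj (cone_injective _) (Yg g) t₂ _ ht₂']
    at h2
  change gam g = t * gam g * t⁻¹ * (t₂ * gam g * t₂⁻¹) at h2
  set γ := gam g with hγ
  have hγS : γ ∈ SG G := gam_mem g
  have h3 : γ = (t * (γ * t⁻¹ * γ⁻¹)) * γ * (t₂ * (γ * t₂⁻¹ * γ⁻¹)) * γ := by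
    conv_lhs => rw [h2]
    group
  have h4 : 1 = (t * (γ * t⁻¹ * γ⁻¹)) * γ * (t₂ * (γ * t₂⁻¹ * γ⁻¹)) := by
    apply mul_right_cancel (b := γ)
    rw [one_mul]
    exact h3
  have h5 : t * (γ * t⁻¹ * γ⁻¹) ∈ N := N.mul_mem ht (hN.conj γ hγS _ (N.inv_mem ht))
  have h6 : t₂ * (γ * t₂⁻¹ * γ⁻¹) ∈ N := N.mul_mem ht₂ (hN.conj γ hγS _ (N.inv_mem ht₂))
  have h7 : γ = (t * (γ * t⁻¹ * γ⁻¹))⁻¹ * (t₂ * (γ * t₂⁻¹ * γ⁻¹))⁻¹ := by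
    rw [eq_inv_mul_iff_mul_eq, eq_inv_iff_mul_eq_one]
    exact h4.symm
  rw [h7]
  exact N.mul_mem (N.inv_mem h5) (N.inv_mem h6)

theorem eq_SG (hN : NormIn N) (h1 : N ≠ ⊥) : N = SG G := by
  refine le_antisymm hN.le ((Subgroup.closure_le N).2 ?_)
  intro p hp
  cases hp with
  | sig u v h => exact sig_in hN h1 h
  | tau => exact tau_in hN h1
  | gam g => exact gam_in hN h1 g

theorem inc_0_1 : Inc [false] [true] := by unfold Inc; decide

instance SG_simple : IsSimpleGroup (SG G) := by
  have hn : Nontrivial (SG G) := by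
    refine ⟨⟨⟨_, sig_mem inc_0_1⟩, 1, fun h => ?_⟩⟩
    have h1 : sig G _ _ inc_0_1 = 1 := congrArg Subtype.val h
    have h2 := sig_l (G := G) inc_0_1 (Stream'.const true, Stream'.const 1)
    rw [h1] at h2
    exact cone_ne inc_0_1 _ _ h2
  refine { eq_bot_or_eq_top_of_normal := fun H hH => ?_ }
  by_cases h : H = ⊥
  · exact Or.inl h
  right
  have hN : NormIn (H.map (SG G).subtype) := by
    refine ⟨Subgroup.map_subtype_le H, ?_⟩
    rintro s hs _ ⟨n, hn, rfl⟩
    exact ⟨⟨s, hs⟩ * n * ⟨s, hs⟩⁻¹, hH.conj_mem n hn ⟨s, hs⟩, rfl⟩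
  have h2 := eq_SG hN (by
    intro h3
    exact h ((Subgroup.map_eq_bot_iff_of_injective _ (SG G).subtype_injective).1 h3))
  rw [eq_top_iff]
  intro x _
  have h3 : x.1 ∈ H.map (SG G).subtype := by rw [h2]; exact x.2
  obtain ⟨y, hy, hxy⟩ := h3
  rwa [← Subtype.ext hxy]

end simple

end QISimple


set_option linter.unusedSectionVars false

namespace QISimple

/-! ### Part 5d : finite generation and distortion -/

/-- names of generators -/
abbrev Gn (A : Type) : Type := (List Bool × List Bool) ⊕ Option A

section fg

variable {G : Type} [Group G] {A : Type} (ev : A → G)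

open Classical in
/-- the element named by a generator name -/
noncomputable def gperm : Gn A → Equiv.Perm (Om G)
  | .inl (p, q) => if h : Inc p q then sig G p q h else 1
  | .inr none => tau G
  | .inr (some a) => gam (ev a)

/-- the finitely many generators used -/
def GOk : Gn A → Prop
  | .inl (p, q) => Inc p q ∧ p.length ≤ 3 ∧ q.length ≤ 3
  | .inr _ => True

theorem gperm_sig {p q : List Bool} (h : Inc p q) : gperm ev (.inl (p, q)) = sig G p q h := by
  simp only [gperm, dif_pos h]

theorem gperm_mem (c : Gn A) : gperm ev c ∈ SG G := by
  rcases c with ⟨p, q⟩ | (_ | a)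
  · simp only [gperm]
    split
    · exact sig_mem _
    · exact (SG G).one_mem
  · exact tau_mem
  · exact gam_mem _

theorem finite_GOk [Finite A] : {c : Gn A | GOk c}.Finite := by
  have h1 : {l : List Bool | l.length ≤ 3}.Finite := List.finite_length_le Bool 3
  have h2 : (Sum.inl '' ({l : List Bool | l.length ≤ 3} ×ˢ {l : List Bool | l.length ≤ 3}) ∪
      Set.range Sum.inr : Set (Gn A)).Finite :=
    ((h1.prod h1).image _).union (Set.finite_range _)
  refine h2.subset ?_
  rintro (⟨p, q⟩ | a) h
  · left
    exact ⟨(p, q), ⟨h.2.1, h.2.2⟩, rfl⟩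
  · right
    exact ⟨a, rfl⟩

theorem gam_one : gam (1 : G) = 1 := by
  have := gam_mul (1 : G) 1
  rw [mul_one] at this
  exact mul_eq_left.1 this.symm

theorem gam_inv (g : G) : gam g⁻¹ = (gam g)⁻¹ := by
  rw [eq_inv_iff_mul_eq_one, ← gam_mul, inv_mul_cancel, gam_one]

/-- products of named generators -/
def WProd (p : Equiv.Perm (Om G)) : Prop :=
  ∃ w : List (Gn A), (∀ c ∈ w, GOk c) ∧ (w.map (gperm ev)).prod = p

variable {ev}

theorem WProd.one : WProd ev 1 := ⟨[], by simp, by simp⟩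

theorem WProd.mul {p q : Equiv.Perm (Om G)} (hp : WProd ev p) (hq : WProd ev q) :
    WProd ev (p * q) := by
  obtain ⟨w, hw, rfl⟩ := hp
  obtain ⟨w', hw', rfl⟩ := hq
  refine ⟨w ++ w', ?_, by simp⟩
  intro c hc
  rcases List.mem_append.1 hc with h | h
  · exact hw c h
  · exact hw' c h

theorem WProd.gen {c : Gn A} (hc : GOk c) : WProd ev (gperm ev c) :=
  ⟨[c], by simpa using hc, by simp⟩

theorem WProd.inv {inv : A → A} (hinv : ∀ a, ev (inv a) = (ev a)⁻¹) {p : Equiv.Perm (Om G)}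
    (hp : WProd ev p) : WProd ev p⁻¹ := by
  obtain ⟨w, hw, rfl⟩ := hp
  induction w with
  | nil => simpa using WProd.one
  | cons c w ih =>
    rw [List.map_cons, List.prod_cons, mul_inv_rev]
    refine (ih fun c hc => hw c (List.mem_cons_of_mem _ hc)).mul ?_
    have hc := hw c List.mem_cons_self
    rcases c with ⟨p, q⟩ | (_ | a)
    · rw [gperm_sig ev hc.1, sig, pswap_inv]
      have := WProd.gen (ev := ev) hc
      rwa [gperm_sig ev hc.1] at this
    · change WProd ev (tau G)⁻¹
      rw [tau, pswap_inv]
      exact WProd.gen (c := .inr none) hc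
    · change WProd ev (gam (ev a))⁻¹
      rw [← gam_inv, ← hinv]
      exact WProd.gen (c := .inr (some (inv a))) trivial

theorem WProd.gam (hev : ∀ g, ∃ w : List A, (w.map ev).prod = g) (g : G) : WProd ev (gam g) := by
  obtain ⟨w, rfl⟩ := hev g
  induction w with
  | nil => simpa [gam_one] using WProd.one
  | cons a w ih =>
    rw [List.map_cons, List.prod_cons, gam_mul]
    exact (WProd.gen (c := .inr (some a)) trivial).mul ih

theorem sig_symm {u v : List Bool} (h : Inc u v) : sig G u v h = sig G v u h.symm := pswap_symm _

/-- a depth two word avoiding two given words -/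
theorem exists_avoid (a b : Bool) (v : List Bool) (c : Bool) (w : List Bool)
    (h : Inc (a :: b :: c :: w) v) (hv : ¬ [a, b, c] <+: v) :
    ∃ d e, Inc [a, b, c] [d, e] ∧ Inc [d, e] v := by
  rcases v with _ | ⟨x, _ | ⟨y, v⟩⟩
  · exact absurd rfl h.symm.ne_nil
  · have hxa : a ≠ x := by
      rintro rfl
      exact h.2 ⟨b :: c :: w, rfl⟩
    refine ⟨a, !b, ?_, Inc.of_head hxa _ _⟩
    rw [Inc.cons_iff]
    exact Inc.of_head (by cases b <;> decide) _ _
  · have : ∃ d e, Inc [a, b] [d, e] ∧ Inc [d, e] [x, y] := by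
      unfold Inc
      cases a <;> cases b <;> cases x <;> cases y <;> decide
    obtain ⟨d, e, h1, h2⟩ := this
    exact ⟨d, e, h1.append [c] [], h2.append [] v⟩

theorem WProd.sig {u v : List Bool} (h : Inc u v) : WProd ev (sig G u v h) := by
  induction hn : u.length + v.length using Nat.strong_induction_on generalizing u v with
  | _ n ih =>
    subst hn
    have main : ∀ (u v : List Bool) (h : Inc u v), 4 ≤ u.length →
        (∀ m < u.length + v.length, ∀ {u v : List Bool} (h : Inc u v), u.length + v.length = m →
          WProd ev (QISimple.sig G u v h)) → WProd ev (QISimple.sig G u v h) := by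
      clear ih h u v
      intro u v h hu ih
      rcases u with _ | ⟨a, _ | ⟨b, _ | ⟨c, w⟩⟩⟩ <;> try (simp at hu; done)
      have fin : ∀ (d e : Bool) (hd : Inc [a, b, c] [d, e]) (v' : List Bool)
          (h' : Inc (d :: e :: w) v') (hl : v'.length ≤ v.length)
          (h4 : ∀ ω : Om G, QISimple.sig G _ _ hd (cone v' ω) = cone v ω),
          WProd ev (QISimple.sig G (a :: b :: c :: w) v h) := by
        intro d e hd v' h' hl h4
        have h5 := pswap_conj (dj_cone h') (QISimple.sig G _ _ hd) (dj_cone h) (fun ω => by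
          rw [show d :: e :: w = [d, e] ++ w from rfl, cone_append, sig_r, ← cone_append]; rfl) h4
        have h6 : WProd ev (QISimple.sig G _ _ hd) := by
          have := WProd.gen (ev := ev) (c := .inl ([a, b, c], [d, e])) ⟨hd, by simp, by simp⟩
          rwa [gperm_sig ev hd] at this
        change WProd ev (pswap _ _ _)
        rw [← h5]
        refine (h6.mul (ih _ ?_ h' rfl)).mul ?_
        · simp only [List.length_cons]; omega
        · unfold QISimple.sig at h6 ⊢
          rw [pswap_inv]; exact h6
      by_cases hv : [a, b, c] <+: v
      · obtain ⟨w', rfl⟩ := hv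
        have hd : Inc [a, b, c] [!a, b] := Inc.of_head (by cases a <;> decide) _ _
        refine fin _ _ hd ([!a, b] ++ w') ?_ (by simp) (fun ω => ?_)
        · have h0 : Inc ([a, b, c] ++ w) ([a, b, c] ++ w') := h
          rw [Inc.append_left_iff] at h0
          have h1 : Inc ([!a, b] ++ w) ([!a, b] ++ w') := Inc.append_left_iff.2 h0
          exact h1
        · rw [cone_append, sig_r, ← cone_append]
      · obtain ⟨d, e, h1, h2⟩ := exists_avoid a b v c w h hv
        refine fin d e h1 v (by have := h2.append w []; simpa using this) le_rfl (fun ω => ?_)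
        refine sig_fix h1 ⟨hv, fun h3 => h.2 (h3.trans ⟨w, rfl⟩)⟩ h2 ω
    by_cases hu : 4 ≤ u.length
    · exact main u v h hu ih
    by_cases hv : 4 ≤ v.length
    · rw [sig_symm]
      refine main v u h.symm hv fun m hm => ih m (by omega)
    have := WProd.gen (ev := ev) (c := .inl (u, v)) ⟨h, by omega, by omega⟩
    rwa [gperm_sig ev h] at this

theorem WProd.all {inv : A → A} (hinv : ∀ a, ev (inv a) = (ev a)⁻¹)
    (hev : ∀ g, ∃ w : List A, (w.map ev).prod = g) {p : Equiv.Perm (Om G)} (hp : p ∈ SG G) :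
    WProd ev p := by
  induction hp using Subgroup.closure_induction with
  | mem p hp =>
    cases hp with
    | sig u v h => exact WProd.sig h
    | tau => exact WProd.gen (c := .inr none) trivial
    | gam g => exact WProd.gam hev g
  | one => exact WProd.one
  | mul x y _ _ hx hy => exact hx.mul hy
  | inv x _ hx => exact hx.inv hinv

/-! #### the potential -/

/-- eventual product of a stream -/
def HP (y : Stream' G) (g : G) : Prop := ∃ m, ∀ n, m ≤ n → (y.take n).prod = g

theorem HP.unique {y : Stream' G} {g h : G} (h1 : HP y g) (h2 : HP y h) : g = h := by
  obtain ⟨m, hm⟩ := h1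
  obtain ⟨m', hm'⟩ := h2
  rw [← hm (max m m') (le_max_left _ _), hm' (max m m') (le_max_right _ _)]

theorem HP_cons {y : Stream' G} {g h : G} : HP (Stream'.cons h y) (h * g) ↔ HP y g := by
  constructor
  · rintro ⟨m, hm⟩
    refine ⟨m, fun n hn => ?_⟩
    have := hm (n + 1) (by omega)
    rw [Stream'.take_succ_cons, List.prod_cons] at this
    exact mul_left_cancel this
  · rintro ⟨m, hm⟩
    refine ⟨m + 1, fun n hn => ?_⟩
    obtain ⟨k, rfl⟩ : ∃ k, n = k + 1 := ⟨n - 1, by omega⟩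
    rw [Stream'.take_succ_cons, List.prod_cons, hm k (by omega)]

theorem HP_Yg {ω : Om G} {g h : G} (hp : HP ω.2 g) : HP (Yg h ω).2 (h * g) := by
  rw [← Stream'.eta ω.2] at hp
  have h1 : HP ω.2.tail (ω.2.head⁻¹ * g) := by
    rw [← HP_cons (h := ω.2.head), mul_inv_cancel_left]
    exact hp
  have h2 := (HP_cons (h := h * ω.2.head)).2 h1
  rwa [mul_assoc, mul_inv_cancel_left] at h2

theorem sig_snd {u v : List Bool} (h : Inc u v) (ω : Om G) : (QISimple.sig G u v h ω).2 = ω.2 := by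
  by_cases h1 : ∃ ω', cone u ω' = ω
  · obtain ⟨ω', rfl⟩ := h1
    rw [sig_l]; rfl
  by_cases h2 : ∃ ω', cone v ω' = ω
  · obtain ⟨ω', rfl⟩ := h2
    rw [sig_r]; rfl
  push Not at h1 h2
  rw [QISimple.sig, pswap_of _ h1 h2]

theorem HP_gperm (c : Gn A) {ω : Om G} {g : G} (hp : HP ω.2 g) :
    ∃ v : List A, v.length ≤ 1 ∧ HP (gperm ev c ω).2 ((v.map ev).prod * g) := by
  rcases c with ⟨p, q⟩ | (_ | a)
  · refine ⟨[], by simp, ?_⟩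
    simp only [gperm]
    split
    · rw [sig_snd]; simpa using hp
    · simpa using hp
  · refine ⟨[], by simp, ?_⟩
    simp only [List.map_nil, List.prod_nil, one_mul]
    change HP (tau G ω).2 g
    by_cases h1 : ∃ ω', cone [false, false] ω' = ω
    · obtain ⟨ω', rfl⟩ := h1
      rw [tau, pswap_l]
      have := (HP_cons (h := (1 : G))).2 hp
      rwa [one_mul] at this
    by_cases h2 : ∃ ω', cpush G ω' = ω
    · obtain ⟨ω', rfl⟩ := h2
      rw [tau, pswap_r]
      rw [← one_mul g] at hp
      exact (HP_cons (h := (1 : G))).1 hp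
    push Not at h1 h2
    rw [tau, pswap_of _ h1 h2]
    exact hp
  · change ∃ v : List A, v.length ≤ 1 ∧ HP (QISimple.gam (ev a) ω).2 ((v.map ev).prod * g)
    by_cases h1 : ∃ ω', cone [false, false] ω' = ω
    · obtain ⟨ω', rfl⟩ := h1
      refine ⟨[a], by simp, ?_⟩
      rw [gam_apply]
      change HP (Yg (ev a) ω').2 _
      simpa using HP_Yg (h := ev a) (ω := ω') hp
    · push Not at h1
      refine ⟨[], by simp, ?_⟩
      rw [QISimple.gam, pact_of _ _ h1]
      simpa using hp

theorem HP_word (w : List (Gn A)) {ω : Om G} {g : G} (hp : HP ω.2 g) :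
    ∃ v : List A, v.length ≤ w.length ∧ HP ((w.map (gperm ev)).prod ω).2 ((v.map ev).prod * g) := by
  induction w with
  | nil => exact ⟨[], by simp, by simpa using hp⟩
  | cons c w ih =>
    obtain ⟨v, hv, h1⟩ := ih
    obtain ⟨v', hv', h2⟩ := HP_gperm (ev := ev) c h1
    refine ⟨v' ++ v, by simp; omega, ?_⟩
    rw [List.map_cons, List.prod_cons, Equiv.Perm.mul_apply, List.map_append, List.prod_append,
      mul_assoc]
    exact h2

/-- `G` is isometrically embedded -/
theorem gam_length {w : List (Gn A)} {g : G} (h : (w.map (gperm ev)).prod = QISimple.gam g) :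
    ∃ v : List A, v.length ≤ w.length ∧ (v.map ev).prod = g := by
  have h0 : HP (Stream'.const (1 : G)) 1 := by
    refine ⟨0, fun n _ => List.prod_eq_one fun x hx => ?_⟩
    obtain ⟨i, hi, rfl⟩ := List.getElem_of_mem hx
    simp
  obtain ⟨v, hv, h1⟩ := HP_word (ev := ev) w
    (ω := cone [false, false] (Stream'.const true, Stream'.const 1)) h0
  rw [h, gam_apply] at h1
  refine ⟨v, hv, ?_⟩
  have h2 : HP (cone [false, false] (Yg g (Stream'.const true, Stream'.const 1))).2 (g * 1) :=
    HP_Yg (ω := (Stream'.const true, Stream'.const 1)) h0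
  have := h1.unique h2
  simpa using this

theorem gam_injective : Function.Injective (QISimple.gam (G := G)) := by
  intro g h e
  have h0 : (Stream'.const true, Stream'.const (1 : G)) = ((Stream'.const true, Stream'.const 1) : Om G) :=
    rfl
  have h1 := gam_apply g (Stream'.const true, Stream'.const (1 : G))
  rw [e, gam_apply] at h1
  have h2 := cone_injective _ h1
  have h3 := congrArg (fun z : Om G => z.2.head) h2
  simpa [Yg] using h3.symm

end fg

end QISimple


set_option linter.unusedSectionVars false

namespace QISimple

/-! ### Part 6a : the finite form of the action -/

section sact

variable {A L : Type} (one : L) (mu : A → L → L) (isOne : L → Bool)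

/-- initial segment test -/
def pfx (p u : List Bool) : Bool := decide (p ++ u.drop p.length = u)

/-- one step on finite tapes; the Boolean tells whether the first letter is one -/
def gb (c : Gn A) (st : List Bool × List L) (b : Bool) : List Bool × List L :=
  match c with
  | .inl pq =>
    bif pfx pq.1 st.1 then (pq.2 ++ st.1.drop pq.1.length, st.2)
    else bif pfx pq.2 st.1 then (pq.1 ++ st.1.drop pq.2.length, st.2) else st
  | .inr oa =>
    match oa with
    | none =>
      bif pfx [false, false] st.1 then ([false, true] ++ st.1.drop 2, one :: st.2)
      else bif pfx [false, true] st.1 && b then ([false, false] ++ st.1.drop 2, st.2.tail) else st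
    | some a => bif pfx [false, false] st.1 then (st.1, st.2.modifyHead (mu a)) else st

/-- one step on finite tapes -/
def gact (c : Gn A) (st : List Bool × List L) : List Bool × List L :=
  gb one mu c st (isOne (st.2.head?.getD one))

/-- a run on finite tapes -/
def grun (w : List (Gn A)) (st : List Bool × List L) : List Bool × List L :=
  w.foldr (gact one mu isOne) st

theorem pfx_iff {p u : List Bool} : pfx p u = true ↔ ∃ v, u = p ++ v := by
  unfold pfx
  rw [decide_eq_true_iff]
  constructor
  · intro h
    exact ⟨_, h.symm⟩
  · rintro ⟨v, rfl⟩
    simp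

theorem pfx_append (p v : List Bool) : pfx p (p ++ v) = true := pfx_iff.2 ⟨v, rfl⟩

theorem pfx_false {p u : List Bool} : pfx p u = false ↔ ¬ p <+: u := by
  rw [← Bool.not_eq_true, pfx_iff]
  exact not_congr ⟨fun ⟨v, h⟩ => ⟨v, h.symm⟩, fun ⟨v, h⟩ => ⟨v, h.symm⟩⟩

variable {L' : Type} (one' : L') (mu' : A → L' → L') (isOne' : L' → Bool)

theorem grun_map (f : L → L') (h1 : f one = one') (h2 : ∀ a x, f (mu a x) = mu' a (f x))
    (h3 : ∀ x, isOne' (f x) = isOne x) (w : List (Gn A)) (u : List Bool) (ys : List L) :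
    grun one' mu' isOne' w (u, ys.map f) =
      ((grun one mu isOne w (u, ys)).1, (grun one mu isOne w (u, ys)).2.map f) := by
  induction w with
  | nil => rfl
  | cons c w ih =>
    change gact one' mu' isOne' c (grun one' mu' isOne' w (u, ys.map f)) = 
      ((gact one mu isOne c (grun one mu isOne w (u, ys))).1,
        (gact one mu isOne c (grun one mu isOne w (u, ys))).2.map f)
    rw [ih]
    generalize grun one mu isOne w (u, ys) = st
    obtain ⟨u, ys⟩ := st
    have hb : isOne' ((ys.map f).head?.getD one') = isOne (ys.head?.getD one) := by
      cases ys <;> simp [← h1, h3]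
    unfold gact
    simp only [hb]
    generalize isOne (ys.head?.getD one) = b
    rcases c with ⟨p, q⟩ | (_ | a)
    · simp only [gb]
      cases pfx p u <;> cases pfx q u <;> rfl
    · simp only [gb]
      cases pfx [false, false] u <;> cases pfx [false, true] u <;> cases b <;> simp [h1]
    · simp only [gb]
      cases pfx [false, false] u <;> cases ys <;> simp [h2]

end sact

section crit

variable {G : Type} [Group G] {A : Type} (ev : A → G)

open Classical in
/-- the run for the group itself -/
noncomputable def Grun (w : List (Gn A)) (st : List Bool × List G) : List Bool × List G :=
  grun (1 : G) (fun a x => ev a * x) (fun x => decide (x = 1)) w st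

open Classical in
/-- the step for the group itself -/
noncomputable def Gact (c : Gn A) (st : List Bool × List G) : List Bool × List G :=
  gact (1 : G) (fun a x => ev a * x) (fun x => decide (x = 1)) c st

theorem Grun_cons (c : Gn A) (w : List (Gn A)) (st : List Bool × List G) :
    Grun ev (c :: w) st = Gact ev c (Grun ev w st) := rfl

theorem inc_of_len {p u : List Bool} (h : ¬ p <+: u) (hl : p.length ≤ u.length) : Inc p u :=
  ⟨h, fun h' => h (by rw [h'.eq_of_length_le hl])⟩

theorem Gact_apply {c : Gn A} (hc : GOk c) (u : List Bool) (hu : 3 ≤ u.length) (ys : List G)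
    (hys : 1 ≤ ys.length) :
    (∀ ω : Om G, gperm ev c (cc u ys ω) = cc (Gact ev c (u, ys)).1 (Gact ev c (u, ys)).2 ω) ∧
      u.length ≤ (Gact ev c (u, ys)).1.length + 3 ∧ ys.length ≤ (Gact ev c (u, ys)).2.length + 1 := by
  classical
  unfold Gact gact
  rcases c with ⟨p, q⟩ | (_ | a)
  · obtain ⟨hi, hp, hq⟩ := hc
    rw [gperm_sig ev hi]
    simp only [gb]
    cases h1 : pfx p u
    · cases h2 : pfx q u
      · rw [pfx_false] at h1 h2
        refine ⟨fun ω => ?_, by simp, by simp⟩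
        exact sig_fix hi (inc_of_len h1 (by omega)) (inc_of_len h2 (by omega)) (cc [] ys ω)
      · obtain ⟨v, rfl⟩ := pfx_iff.1 h2
        refine ⟨fun ω => ?_, by simp; omega, by simp⟩
        simp only [cond_false, cond_true, List.drop_left]
        rw [cc_eq, cone_append, sig_r, ← cone_append]; rfl
    · obtain ⟨v, rfl⟩ := pfx_iff.1 h1
      refine ⟨fun ω => ?_, by simp; omega, by simp⟩
      simp only [cond_true, List.drop_left]
      rw [cc_eq, cone_append, sig_l, ← cone_append]; rfl
  · obtain ⟨y, ys, rfl⟩ : ∃ y ys', ys = y :: ys' := by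
      cases ys with
      | nil => simp at hys
      | cons y ys => exact ⟨y, ys, rfl⟩
    change (∀ ω : Om G, tau G _ = _) ∧ _
    simp only [gb]
    cases h1 : pfx [false, false] u
    · rw [pfx_false] at h1
      have h1' := inc_of_len h1 (by simp; omega)
      cases h2 : pfx [false, true] u
      · rw [pfx_false] at h2
        have h2' := inc_of_len h2 (by simp; omega)
        refine ⟨fun ω => ?_, by simp, by simp⟩
        exact pswap_of _ (fun _ => cone_ne h1' _ (cc [] (y :: ys) ω))
          (fun ω' => cone_ne h2' (push 1 ω') (cc [] (y :: ys) ω))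
      · obtain ⟨v, rfl⟩ := pfx_iff.1 h2
        by_cases hy : y = 1
        · subst hy
          refine ⟨fun ω => ?_, by simp, by simp⟩
          have := pswap_r (dj_tau (G := G)) (cc v ys ω)
          simp only [List.head?_cons, Option.getD_some, decide_true, Bool.and_true, cond_false,
            cond_true]
          exact this
        · refine ⟨fun ω => ?_, by simp [hy], by simp [hy]⟩
          simp only [List.head?_cons, Option.getD_some, hy, decide_false, Bool.and_false, cond_false]
          refine pswap_of _ (fun _ => cone_ne h1' _ (cc [] (y :: ys) ω)) (fun ω' e => hy ?_)
          have e2 := congrArg (fun z : Om G => z.2.head) e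
          exact e2.symm
    · obtain ⟨v, rfl⟩ := pfx_iff.1 h1
      refine ⟨fun ω => ?_, by simp, by simp⟩
      have := pswap_l (dj_tau (G := G)) (cc v (y :: ys) ω)
      exact this
  · obtain ⟨y, ys, rfl⟩ : ∃ y ys', ys = y :: ys' := by
      cases ys with
      | nil => simp at hys
      | cons y ys => exact ⟨y, ys, rfl⟩
    change (∀ ω : Om G, gam (ev a) _ = _) ∧ _
    simp only [gb]
    cases h1 : pfx [false, false] u
    · rw [pfx_false] at h1
      have h1' := inc_of_len h1 (by simp; omega)
      refine ⟨fun ω => ?_, by simp, by simp⟩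
      exact pact_of _ _ (fun _ => cone_ne h1' _ (cc [] (y :: ys) ω))
    · obtain ⟨v, rfl⟩ := pfx_iff.1 h1
      refine ⟨fun ω => ?_, by simp, by simp⟩
      have := gam_apply (ev a) (cc v (y :: ys) ω)
      exact this

theorem Grun_apply {w : List (Gn A)} (hw : ∀ c ∈ w, GOk c) (k j : ℕ) (u : List Bool)
    (hu : 3 * w.length + k ≤ u.length) (ys : List G) (hys : w.length + j ≤ ys.length) :
    (∀ ω : Om G, (w.map (gperm ev)).prod (cc u ys ω) =
      cc (Grun ev w (u, ys)).1 (Grun ev w (u, ys)).2 ω) ∧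
      k ≤ (Grun ev w (u, ys)).1.length ∧ j ≤ (Grun ev w (u, ys)).2.length := by
  induction w generalizing k j with
  | nil => exact ⟨fun ω => rfl, by simpa [Grun, grun] using hu, by simpa [Grun, grun] using hys⟩
  | cons c w ih =>
    simp only [List.length_cons] at hu hys
    obtain ⟨h1, h2, h3⟩ := ih (fun c hc => hw c (List.mem_cons_of_mem _ hc)) (k + 3) (j + 1)
      (by omega) (by omega)
    rw [Grun_cons]
    obtain ⟨h4, h5, h6⟩ := Gact_apply ev (hw c List.mem_cons_self) (Grun ev w (u, ys)).1 (by omega)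
      (Grun ev w (u, ys)).2 (by omega)
    rw [Prod.mk.eta] at h4 h5 h6
    refine ⟨fun ω => ?_, by omega, by omega⟩
    rw [List.map_cons, List.prod_cons, Equiv.Perm.mul_apply, h1, h4]

theorem stream_pad_eq {α : Type} [Nontrivial α] {u u' : List α}
    (h : ∀ x : Stream' α, u ++ₛ x = u' ++ₛ x) : u = u' := by
  have key : ∀ {u u' : List α}, (∀ x : Stream' α, u ++ₛ x = u' ++ₛ x) → u <+: u' → u = u' := by
    rintro u _ h ⟨t, rfl⟩
    cases t with
    | nil => simp
    | cons a t =>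
      obtain ⟨b, hb⟩ := exists_ne a
      have h1 := h (Stream'.const b)
      rw [Stream'.append_append_stream] at h1
      have h2 := append_stream_inj u h1
      exact absurd (congrArg Stream'.head h2) (by simpa using hb)
  rcases append_stream_comparable (h (Stream'.const (Classical.arbitrary α))) with h1 | h1
  · exact key h h1
  · exact (key (fun x => (h x).symm) h1).symm

/-- the check for one finite tape -/
def Fixes (w : List (Gn A)) (u : List Bool) (ys : List G) : Prop :=
  (Grun ev w (u, ys)).1 = u ∧ (Subsingleton G ∨ (Grun ev w (u, ys)).2 = ys)

theorem prod_eq_one_iff {w : List (Gn A)} (hw : ∀ c ∈ w, GOk c) :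
    (w.map (gperm ev)).prod = 1 ↔ ∀ (u : List Bool) (ys : List G), u.length = 3 * w.length →
      ys.length = w.length → Fixes ev w u ys := by
  constructor
  · intro h u ys hu hys
    obtain ⟨h1, -⟩ := Grun_apply ev hw 0 0 u (by omega) ys (by omega)
    rw [h] at h1
    refine ⟨?_, ?_⟩
    · refine stream_pad_eq fun x => ?_
      exact (congrArg Prod.fst (h1 (x, Stream'.const 1))).symm
    · rcases subsingleton_or_nontrivial G with hG | hG
      · exact Or.inl hG
      · right
        refine stream_pad_eq fun x => ?_
        exact (congrArg Prod.snd (h1 (Stream'.const true, x))).symm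
  · intro h
    ext1 ω
    rw [cc_take (3 * w.length) w.length ω]
    obtain ⟨h1, -⟩ := Grun_apply ev hw 0 0 (ω.1.take (3 * w.length)) (by simp)
      (ω.2.take w.length) (by simp)
    rw [h1]
    obtain ⟨h2, h3⟩ := h (ω.1.take (3 * w.length)) (ω.2.take w.length) (by simp) (by simp)
    rw [h2]
    rcases h3 with h3 | h3
    · refine Prod.ext rfl ?_
      funext n
      exact Subsingleton.elim _ _
    · rw [h3]; rfl

/-- the ball -/
def near (n : ℕ) (g : G) : Prop := ∃ v : List A, v.length ≤ n ∧ (v.map ev).prod = g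

variable {ev}

theorem near_cons {n : ℕ} {g : G} (h : near ev n g) (a : A) : near ev (n + 1) (ev a * g) := by
  obtain ⟨v, h1, rfl⟩ := h
  exact ⟨a :: v, by simpa using h1, by simp⟩

theorem near_mono {n m : ℕ} (h : n ≤ m) {g : G} (hg : near ev n g) : near ev m g := by
  obtain ⟨v, h1, h2⟩ := hg
  exact ⟨v, h1.trans h, h2⟩

theorem near_one (n : ℕ) : near ev n (1 : G) := ⟨[], by simp, by simp⟩

theorem near_inv {inv : A → A} (hinv : ∀ a, ev (inv a) = (ev a)⁻¹) {n : ℕ} {g : G}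
    (h : near ev n g) : near ev n g⁻¹ := by
  obtain ⟨v, h1, rfl⟩ := h
  refine ⟨(v.map inv).reverse, by simpa using h1, ?_⟩
  rw [List.prod_inv_reverse, List.map_reverse, List.map_map, List.map_map]
  congr 2
  exact List.map_congr_left fun a _ => hinv a

theorem exists_edge (hev : ∀ g, ∃ w : List A, (w.map ev).prod = g) {n : ℕ} {h : G}
    (hh : ¬ near ev n h) : ∃ e : G, near ev (n + 1) e ∧ ¬ near ev n e := by
  by_contra hc
  push Not at hc
  apply hh
  obtain ⟨w, rfl⟩ := hev h
  clear hh
  induction w with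
  | nil => exact near_one n
  | cons a w ih =>
    rw [List.map_cons, List.prod_cons]
    exact hc _ (near_cons ih a)

theorem sim {inv : A → A} (hinv : ∀ a, ev (inv a) = (ev a)⁻¹) {n : ℕ} {h e : G}
    (hh : ¬ near ev n h) (he : ¬ near ev n e) (z z' : List G) (w : List (Gn A))
    (hw : w.length ≤ n) (u : List Bool) (ys : List G) :
    ∃ u' ys' g, near ev w.length g ∧ Grun ev w (u, ys ++ h :: z) = (u', ys' ++ (g * h) :: z) ∧
      Grun ev w (u, ys ++ e :: z') = (u', ys' ++ (g * e) :: z') := by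
  classical
  induction w with
  | nil => exact ⟨u, ys, 1, near_one _, by simp [Grun, grun], by simp [Grun, grun]⟩
  | cons c w ih =>
    rw [List.length_cons] at hw
    obtain ⟨u', ys', g, hg, h1, h2⟩ := ih (by omega)
    rw [Grun_cons, Grun_cons, h1, h2]
    have hne : ∀ {k : G}, ¬ near ev n k → g * k ≠ 1 := fun {k} hk hk' => hk (by
      rw [← eq_inv_iff_mul_eq_one, ← inv_eq_iff_eq_inv] at hk'
      rw [← hk']
      exact near_inv hinv (near_mono (by omega) hg))
    have hg' : near ev (c :: w).length g := near_mono (by simp) hg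
    unfold Gact gact
    rcases c with ⟨p, q⟩ | (_ | a)
    · simp only [gb]
      cases pfx p u' <;> cases pfx q u' <;> exact ⟨_, _, g, hg', rfl, rfl⟩
    · cases ys' with
      | nil =>
        simp only [gb, List.nil_append, List.head?_cons, Option.getD_some, hne hh, hne he,
          decide_false, Bool.and_false, cond_false]
        cases pfx [false, false] u'
        · exact ⟨u', [], g, hg', rfl, rfl⟩
        · exact ⟨_, [1], g, hg', rfl, rfl⟩
      | cons y ys' =>
        simp only [gb, List.cons_append, List.head?_cons, Option.getD_some]
        cases pfx [false, false] u'
        · by_cases hy : y = 1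
          · simp only [hy, decide_true, Bool.and_true]
            cases pfx [false, true] u'
            · exact ⟨_, 1 :: ys', g, hg', rfl, rfl⟩
            · exact ⟨_, ys', g, hg', rfl, rfl⟩
          · simp only [hy, decide_false, Bool.and_false]
            exact ⟨_, y :: ys', g, hg', rfl, rfl⟩
        · exact ⟨_, 1 :: y :: ys', g, hg', rfl, rfl⟩
    · simp only [gb]
      cases pfx [false, false] u'
      · exact ⟨_, ys', g, hg', rfl, rfl⟩
      · cases ys' with
        | nil =>
          refine ⟨u', [], ev a * g, ?_, ?_, ?_⟩
          · rw [List.length_cons]; exact near_cons hg a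
          · simp [mul_assoc]
          · simp [mul_assoc]
        | cons y ys' => exact ⟨u', (ev a * y) :: ys', g, hg', rfl, rfl⟩

theorem split_far (n : ℕ) (ys : List G) (h : ¬ ∀ y ∈ ys, near ev n y) :
    ∃ as h' z, ys = as ++ h' :: z ∧ (∀ y ∈ as, near ev n y) ∧ ¬ near ev n h' := by
  induction ys with
  | nil => simp at h
  | cons y ys ih =>
    by_cases hy : near ev n y
    · obtain ⟨as, h', z, h1, h2, h3⟩ := ih fun h' => h (by simpa [hy] using h')
      refine ⟨y :: as, h', z, by rw [h1]; rfl, ?_, h3⟩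
      intro x hx
      rcases List.mem_cons.1 hx with rfl | hx
      · exact hy
      · exact h2 x hx
    · exact ⟨[], y, ys, rfl, by simp, hy⟩

/-- finite criterion for triviality -/
theorem prod_eq_one_iff' {inv : A → A} (hinv : ∀ a, ev (inv a) = (ev a)⁻¹)
    (hev : ∀ g, ∃ w : List A, (w.map ev).prod = g) {w : List (Gn A)} (hw : ∀ c ∈ w, GOk c) :
    (w.map (gperm ev)).prod = 1 ↔ ∀ (u : List Bool) (ys : List G), u.length = 3 * w.length →
      ys.length = w.length → (∀ y ∈ ys, near ev (w.length + 1) y) → Fixes ev w u ys := by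
  rw [prod_eq_one_iff ev hw]
  constructor
  · intro h u ys hu hys _
    exact h u ys hu hys
  · intro h u ys hu hys
    by_cases hn : ∀ y ∈ ys, near ev w.length y
    · exact h u ys hu hys fun y hy => near_mono (by omega) (hn y hy)
    · obtain ⟨as, k, z, rfl, h2, h3⟩ := split_far _ _ hn
      obtain ⟨e, he, he'⟩ := exists_edge hev h3
      obtain ⟨u', ys', g, -, h4, h5⟩ := sim hinv h3 he' z (z.map fun _ => 1) w le_rfl u as
      have h6 := h u (as ++ e :: z.map fun _ => 1) hu (by simpa using hys) (by
        intro y hy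
        rcases List.mem_append.1 hy with hy | hy
        · exact near_mono (by omega) (h2 y hy)
        · rcases List.mem_cons.1 hy with rfl | hy
          · exact he
          · obtain ⟨_, -, rfl⟩ := List.mem_map.1 hy
            exact near_one _)
      obtain ⟨h7, h8⟩ := h6
      rw [h5] at h7 h8
      have hu' : u' = u := h7
      rcases h8 with h8 | h8
      · exact absurd (Subsingleton.elim 1 k ▸ near_one _) h3
      · have h9 : ys' ++ g * e :: z.map (fun _ => 1) = as ++ e :: z.map fun _ => 1 := h8
        obtain ⟨ha, hb⟩ := List.append_inj' h9 (by simp)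
        obtain ⟨hc, -⟩ := List.cons_eq_cons.1 hb
        have hg : g = 1 := mul_eq_right.1 hc
        refine ⟨?_, Or.inr ?_⟩ 
        · rw [h4]; exact hu'
        · rw [h4, hg, ha]; simp

end crit

end QISimple


set_option linter.unusedSectionVars false

namespace QISimple

/-! ### Part 6b : the word problem of the simple group is r.e. -/

section compu

variable {α β σ : Type*} [Primcodable α] [Primcodable β] [Primcodable σ]

theorem comp_foldl {f : α → List β} {g : α → σ} {h : α → σ × β → σ} (hf : Computable f)
    (hg : Computable g) (hh : Computable₂ h) :
    Computable fun a => (f a).foldl (fun s b => h a (s, b)) (g a) := by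
  have h1 : Computable fun a => (Nat.rec (g a)
      (fun k s => (((f a)[k]?).map fun b => h a (s, b)).getD s) (f a).length : σ) := by
    refine Computable.nat_rec (h := fun a (p : ℕ × σ) =>
      (((f a)[p.1]?).map fun b => h a (p.2, b)).getD p.2) (Computable.list_length.comp hf) hg ?_
    refine Computable.option_getD (Computable.option_map (Computable.list_getElem?.comp
      (hf.comp Computable.fst) (Computable.fst.comp Computable.snd)) ?_)
      (Computable.snd.comp Computable.snd)
    exact hh.comp (Computable.fst.comp Computable.fst)
      ((Computable.snd.comp (Computable.snd.comp Computable.fst)).pair Computable.snd)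
  refine h1.of_eq fun a => ?_
  have key : ∀ n ≤ (f a).length, (Nat.rec (g a)
      (fun k s => (((f a)[k]?).map fun b => h a (s, b)).getD s) n : σ) =
      ((f a).take n).foldl (fun s b => h a (s, b)) (g a) := by
    intro n hn
    induction n with
    | zero => simp
    | succ n ih =>
      have hlt : n < (f a).length := by omega
      simp only [ih (by omega), List.getElem?_eq_getElem hlt, Option.map_some, Option.getD_some]
      rw [List.take_succ_eq_append_getElem hlt, List.foldl_append]
      rfl
  have := key _ le_rfl
  rwa [List.take_length] at this

theorem comp_foldr {f : α → List β} {g : α → σ} {h : α → σ × β → σ} (hf : Computable f)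
    (hg : Computable g) (hh : Computable₂ h) :
    Computable fun a => (f a).foldr (fun b s => h a (s, b)) (g a) := by
  refine (comp_foldl (Computable.list_reverse.comp hf) hg hh).of_eq fun a => ?_
  rw [List.foldl_reverse]

theorem comp_all {f : α → List β} {p : α → β → Bool} (hf : Computable f) (hp : Computable₂ p) :
    Computable fun a => (f a).all (p a) := by
  refine (comp_foldr (h := fun a (x : Bool × β) => p a x.2 && x.1) hf (Computable.const true)
    (Primrec.and.to_comp.comp (hp.comp Computable.fst (Computable.snd.comp Computable.snd))
      (Computable.fst.comp Computable.snd))).of_eq fun a => ?_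
  induction f a with
  | nil => rfl
  | cons b l ih => simp [ih]

/-- all tuples of a given length with entries from a list -/
def tup {β : Type*} (l : List β) : ℕ → List (List β)
  | 0 => [[]]
  | n + 1 => (tup l n).flatMap fun t => l.map fun x => x :: t

theorem mem_tup {β : Type*} {l : List β} {n : ℕ} {t : List β} :
    t ∈ tup l n ↔ t.length = n ∧ ∀ x ∈ t, x ∈ l := by
  induction n generalizing t with
  | zero =>
    simp only [tup, List.mem_singleton]
    constructor
    · rintro rfl; simp
    · rintro ⟨h, -⟩; exact List.length_eq_zero_iff.1 h
  | succ n ih =>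
    simp only [tup, List.mem_flatMap, List.mem_map]
    constructor
    · rintro ⟨t', h1, x, hx, rfl⟩
      obtain ⟨h2, h3⟩ := ih.1 h1
      refine ⟨by simp [h2], ?_⟩
      intro y hy
      rcases List.mem_cons.1 hy with rfl | hy
      · exact hx
      · exact h3 y hy
    · rintro ⟨h1, h2⟩
      cases t with
      | nil => simp at h1
      | cons x t =>
        exact ⟨t, ih.2 ⟨by simpa using h1, fun y hy => h2 y (List.mem_cons_of_mem _ hy)⟩, x,
          h2 x List.mem_cons_self, rfl⟩

theorem primrec_tup : Primrec₂ (tup (β := β)) := by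
  have h1 : Primrec fun x : List β × ℕ => (Nat.rec [[]]
      (fun _ (s : List (List β)) => s.flatMap fun t => x.1.map fun y => y :: t) x.2 :
        List (List β)) := by
    refine Primrec.nat_rec' (h := fun (x : List β × ℕ) (p : ℕ × List (List β)) =>
      p.2.flatMap fun t => x.1.map fun y => y :: t) Primrec.snd (Primrec.const _) ?_
    refine Primrec.list_flatMap (Primrec.snd.comp Primrec.snd) ?_
    refine Primrec.list_map (Primrec.fst.comp (Primrec.fst.comp Primrec.fst)) ?_
    exact Primrec.list_cons.comp Primrec.snd (Primrec.snd.comp Primrec.fst)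
  refine h1.of_eq fun x => ?_
  obtain ⟨l, n⟩ := x
  induction n with
  | zero => rfl
  | succ n ih =>
    change (Nat.rec [[]] _ n : List (List β)).flatMap _ = _
    rw [ih]
    rfl

end compu

section wp

variable {A : Type} [Primcodable A]

theorem primrec_pfx : Primrec₂ pfx := by
  have : PrimrecPred fun x : List Bool × List Bool => x.1 ++ x.2.drop x.1.length = x.2 :=
    Primrec.eq.comp (Primrec.list_append.comp Primrec.fst
      (Primrec.list_drop.comp (Primrec.list_length.comp Primrec.fst) Primrec.snd)) Primrec.snd
  exact this.decide

theorem primrec_gb : Primrec fun x : Gn A × (List Bool × List (List A)) × Bool =>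
    gb [] (fun a l => a :: l) x.1 x.2.1 x.2.2 := by
  have hu : Primrec fun x : Gn A × (List Bool × List (List A)) × Bool => x.2.1.1 :=
    Primrec.fst.comp (Primrec.fst.comp Primrec.snd)
  have hy : Primrec fun x : Gn A × (List Bool × List (List A)) × Bool => x.2.1.2 :=
    Primrec.snd.comp (Primrec.fst.comp Primrec.snd)
  have hb : Primrec fun x : Gn A × (List Bool × List (List A)) × Bool => x.2.2 :=
    Primrec.snd.comp Primrec.snd
  have hs : Primrec fun x : Gn A × (List Bool × List (List A)) × Bool => x.2.1 :=
    Primrec.fst.comp Primrec.snd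
  have key : Primrec fun x : Gn A × (List Bool × List (List A)) × Bool =>
      (Sum.casesOn x.1
        (fun pq => bif pfx pq.1 x.2.1.1 then (pq.2 ++ x.2.1.1.drop pq.1.length, x.2.1.2)
          else bif pfx pq.2 x.2.1.1 then (pq.1 ++ x.2.1.1.drop pq.2.length, x.2.1.2) else x.2.1)
        (fun oa => Option.casesOn oa 
          (bif pfx [false, false] x.2.1.1 then ([false, true] ++ x.2.1.1.drop 2, [] :: x.2.1.2)
            else bif pfx [false, true] x.2.1.1 && x.2.2 then
              ([false, false] ++ x.2.1.1.drop 2, x.2.1.2.tail) else x.2.1)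
          (fun a => bif pfx [false, false] x.2.1.1 then
            (x.2.1.1, x.2.1.2.modifyHead (fun l => a :: l)) else x.2.1)) :
          List Bool × List (List A)) := by
    refine Primrec.sumCasesOn Primrec.fst ?_ ?_
    · have hp : Primrec fun x : (Gn A × (List Bool × List (List A)) × Bool) ×
          (List Bool × List Bool) => x.2.1 := Primrec.fst.comp Primrec.snd
      have hq : Primrec fun x : (Gn A × (List Bool × List (List A)) × Bool) ×
          (List Bool × List Bool) => x.2.2 := Primrec.snd.comp Primrec.snd
      have hu' := hu.comp (Primrec.fst (α := Gn A × (List Bool × List (List A)) × Bool)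
        (β := List Bool × List Bool))
      have hy' := hy.comp (Primrec.fst (α := Gn A × (List Bool × List (List A)) × Bool)
        (β := List Bool × List Bool))
      have hs' := hs.comp (Primrec.fst (α := Gn A × (List Bool × List (List A)) × Bool)
        (β := List Bool × List Bool))
      refine Primrec.cond (primrec_pfx.comp hp hu') ((Primrec.list_append.comp hq
        (Primrec.list_drop.comp (Primrec.list_length.comp hp) hu')).pair hy') ?_
      exact Primrec.cond (primrec_pfx.comp hq hu') ((Primrec.list_append.comp hp
        (Primrec.list_drop.comp (Primrec.list_length.comp hq) hu')).pair hy') hs'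
    · have hu' := hu.comp (Primrec.fst (α := Gn A × (List Bool × List (List A)) × Bool)
        (β := Option A))
      have hy' := hy.comp (Primrec.fst (α := Gn A × (List Bool × List (List A)) × Bool)
        (β := Option A))
      have hs' := hs.comp (Primrec.fst (α := Gn A × (List Bool × List (List A)) × Bool)
        (β := Option A))
      have hb' := hb.comp (Primrec.fst (α := Gn A × (List Bool × List (List A)) × Bool)
        (β := Option A))
      refine Primrec.option_casesOn Primrec.snd ?_ ?_
      · refine Primrec.cond (primrec_pfx.comp (Primrec.const _) hu')
          ((Primrec.list_append.comp (Primrec.const _)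
            (Primrec.list_drop.comp (Primrec.const 2) hu')).pair
            (Primrec.list_cons.comp (Primrec.const []) hy')) ?_
        exact Primrec.cond (Primrec.and.comp (primrec_pfx.comp (Primrec.const _) hu') hb')
          ((Primrec.list_append.comp (Primrec.const _)
            (Primrec.list_drop.comp (Primrec.const 2) hu')).pair
            (Primrec.list_tail.comp hy')) hs'
      · refine Primrec.cond (primrec_pfx.comp (Primrec.const _) (hu'.comp Primrec.fst))
          ((hu'.comp Primrec.fst).pair ?_) (hs'.comp Primrec.fst)
        exact (Primrec.list_modifyHead' (g := fun (a : A) (l : List A) => a :: l)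
          Primrec.list_cons).comp (hy'.comp Primrec.fst) Primrec.snd
  refine key.of_eq fun x => ?_
  obtain ⟨⟨p, q⟩ | (_ | a), ⟨u, ys⟩, b⟩ := x <;> rfl

theorem comp_gact {t : List A → Bool} (ht : Computable t) :
    Computable₂ (gact (A := A) [] (fun a l => a :: l) t) := by
  have h1 : Primrec fun x : Gn A × (List Bool × List (List A)) => x.2.2.head?.getD [] :=
    Primrec.option_getD.comp (Primrec.list_head?.comp (Primrec.snd.comp Primrec.snd))
      (Primrec.const [])
  have h2 : Computable fun x : Gn A × (List Bool × List (List A)) => t (x.2.2.head?.getD []) :=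
    ht.comp h1.to_comp
  have h3 : Computable fun x : Gn A × (List Bool × List (List A)) =>
      (x.1, x.2, t (x.2.2.head?.getD [])) := Computable.fst.pair (Computable.snd.pair h2)
  have h4 := Computable.comp (primrec_gb (A := A)).to_comp h3
  refine h4.of_eq fun x => ?_
  unfold gact
  rfl

theorem comp_grun {t : List A → Bool} (ht : Computable t) {r : ℕ} (code : Fin r → Gn A) :
    Computable₂ fun (w : List (Fin r)) (st : List Bool × List (List A)) =>
      grun [] (fun a l => a :: l) t (w.map code) st := by
  have hc : Computable code := (Primrec.dom_finite code).to_comp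
  have h1 := comp_foldr (α := List (Fin r) × (List Bool × List (List A)))
    (h := fun _ (x : (List Bool × List (List A)) × Fin r) =>
      gact [] (fun a l => a :: l) t (code x.2) x.1)
    (Computable.fst) Computable.snd
    ((comp_gact ht).comp (hc.comp (Computable.snd.comp Computable.snd))
      (Computable.fst.comp Computable.snd))
  refine h1.of_eq fun x => ?_
  exact (List.foldr_map (f := code) (g := gact [] (fun a l => a :: l) t)).symm

/-- letterwise comparison -/
def eqv (inv : A → A) (t : List A → Bool) (ys zs : List (List A)) : Bool :=
  decide (ys.length = zs.length) &&
    (List.range ys.length).all fun i =>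
      t (((ys.getD i []).map inv).reverse ++ zs.getD i [])

theorem comp_eqv [Finite A] (inv : A → A) {t : List A → Bool} (ht : Computable t) :
    Computable₂ (eqv inv t) := by
  have hi : Primrec inv := Primrec.dom_finite inv
  have h1 : Primrec fun x : List (List A) × List (List A) => decide (x.1.length = x.2.length) :=
    (Primrec.eq.comp (Primrec.list_length.comp Primrec.fst)
      (Primrec.list_length.comp Primrec.snd)).decide
  refine Primrec.and.to_comp.comp h1.to_comp ?_
  refine comp_all (f := fun x : List (List A) × List (List A) => List.range x.1.length)
    (Primrec.list_range.comp (Primrec.list_length.comp Primrec.fst)).to_comp ?_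
  refine ht.comp (Primrec.to_comp ?_)
  refine Primrec.list_append.comp (Primrec.list_reverse.comp (Primrec.list_map
    ((Primrec.list_getD []).comp (Primrec.fst.comp Primrec.fst) Primrec.snd)
    (hi.comp Primrec.snd))) 
    ((Primrec.list_getD []).comp (Primrec.snd.comp Primrec.fst) Primrec.snd)

variable {G : Type} [Group G] {ev : A → G}

theorem eqv_iff {inv : A → A} (hinv : ∀ a, ev (inv a) = (ev a)⁻¹) {t : List A → Bool}
    (ht : ∀ v, t v = true ↔ (v.map ev).prod = 1) (ys zs : List (List A)) :
    eqv inv t ys zs = true ↔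
      ys.map (fun v => (v.map ev).prod) = zs.map fun v => (v.map ev).prod := by
  have hi : ∀ v : List A, (((v.map inv).reverse).map ev).prod = ((v.map ev).prod)⁻¹ := by
    intro v
    rw [List.prod_inv_reverse, List.map_reverse, List.map_map, List.map_map]
    congr 2
    exact List.map_congr_left fun a _ => hinv a
  unfold eqv
  rw [Bool.and_eq_true, decide_eq_true_iff, List.all_eq_true]
  constructor
  · rintro ⟨h1, h2⟩
    refine List.ext_getElem (by simpa using h1) fun i h3 h4 => ?_
    simp only [List.length_map] at h3 h4
    have h5 := h2 i (List.mem_range.2 h3)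
    rw [ht, List.map_append, List.prod_append, hi, inv_mul_eq_one] at h5
    simpa [List.getD_eq_getElem, h3, h4] using h5
  · intro h
    have h1 : ys.length = zs.length := by simpa using congrArg List.length h
    refine ⟨h1, fun i hi' => ?_⟩
    rw [List.mem_range] at hi'
    have h3 : i < zs.length := by omega
    rw [ht, List.map_append, List.prod_append, hi, inv_mul_eq_one]
    have := List.getElem_of_eq h (i := i) (by simpa using hi')
    simpa [List.getD_eq_getElem, hi', h3] using this

/-- the r.e. word problem -/
theorem wp_re [Finite A] {inv : A → A} (hinv : ∀ a, ev (inv a) = (ev a)⁻¹)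
    (hev : ∀ g, ∃ w : List A, (w.map ev).prod = g) (e0 : A) (he0 : ev e0 = 1)
    {t : List A → Bool} (htc : Computable t) (ht : ∀ v, t v = true ↔ (v.map ev).prod = 1)
    {r : ℕ} (code : Fin r → Gn A) (hcode : ∀ i, GOk (code i)) :
    REPred fun w : List (Fin r) => (w.map fun i => gperm ev (code i)).prod = 1 := by
  classical
  have : Fintype A := Fintype.ofFinite A
  let evp : List A → G := fun v => (v.map ev).prod
  let b0 : Bool := decide (Subsingleton G)
  let chk : List (Fin r) → (List Bool × List (List A)) → Bool := fun w st =>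
    decide ((grun [] (fun a l => a :: l) t (w.map code) st).1 = st.1) &&
      (b0 || eqv inv t (grun [] (fun a l => a :: l) t (w.map code) st).2 st.2)
  have hchk : Computable₂ chk := by
    have h1 := comp_grun htc code
    refine Primrec.and.to_comp.comp ?_ (Primrec.or.to_comp.comp (Computable.const _)
      ((comp_eqv inv htc).comp (Computable.snd.comp h1) (Computable.snd.comp Computable.snd)))
    have h2 : Computable₂ fun a b : List Bool => decide (a = b) := Primrec.eq.decide.to_comp
    exact h2.comp (Computable.fst.comp h1) (Computable.fst.comp Computable.snd)
  let dom : List (Fin r) → List (List Bool × List (List A)) := fun w =>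
    (tup [false, true] (3 * w.length)).flatMap fun u =>
      (tup (tup (Finset.univ : Finset A).toList (w.length + 1)) w.length).map fun ys => (u, ys)
  have hdom : Primrec dom := by
    have hl : Primrec fun w : List (Fin r) => w.length := Primrec.list_length
    refine Primrec.list_flatMap (primrec_tup.comp (Primrec.const _)
      (Primrec.nat_mul.comp (Primrec.const 3) hl)) ?_
    refine Primrec.list_map ?_ ((Primrec.snd.comp Primrec.fst).pair Primrec.snd)
    exact primrec_tup.comp (primrec_tup.comp (Primrec.const _)
      (Primrec.succ.comp (hl.comp Primrec.fst))) (hl.comp Primrec.fst)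
  have hall : Computable fun w => (dom w).all (chk w) := comp_all hdom.to_comp hchk
  have hre : REPred fun w => (dom w).all (chk w) = true :=
    ComputablePred.to_re ⟨inferInstance, hall.of_eq fun x => Bool.decide_eq_true.symm⟩
  refine hre.of_eq fun w => ?_
  have hw : ∀ c ∈ w.map code, GOk c := by
    intro c hc
    obtain ⟨i, -, rfl⟩ := List.mem_map.1 hc
    exact hcode i
  have hcrit := prod_eq_one_iff' hinv hev hw
  rw [List.map_map] at hcrit
  change _ ↔ (w.map (gperm ev ∘ code)).prod = 1
  rw [hcrit, List.all_eq_true, List.length_map]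
  have hfix : ∀ u ys, chk w (u, ys) = true ↔ Fixes ev (w.map code) u (ys.map evp) := by
    intro u ys
    have h1 := grun_map (A := A) [] (fun a l => a :: l) t (1 : G) (fun a x => ev a * x)
      (fun x => decide (x = 1)) evp (by simp [evp]) (by simp [evp])
      (fun x => by rw [Bool.eq_iff_iff, decide_eq_true_iff, ht]) (w.map code) u ys
    have h2 : Grun ev (w.map code) (u, ys.map evp) = _ := h1
    unfold Fixes
    rw [h2]
    simp only [chk, Bool.and_eq_true, Bool.or_eq_true, decide_eq_true_iff, b0, eqv_iff hinv ht]
    rfl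
  constructor
  · intro h u ys hu hys hn
    have h1 : ∃ zs : List (List A), zs.map evp = ys ∧ zs.length = ys.length ∧
        ∀ z ∈ zs, z.length = w.length + 1 := by
      clear hys
      induction ys with
      | nil => exact ⟨[], rfl, rfl, by simp⟩
      | cons y ys ih =>
        obtain ⟨zs, h1, h2, h3⟩ := ih fun y hy => hn y (List.mem_cons_of_mem _ hy)
        obtain ⟨v, hv, hv'⟩ := hn y List.mem_cons_self
        refine ⟨(v ++ List.replicate (w.length + 1 - v.length) e0) :: zs, ?_, by simp [h2], ?_⟩
        · simp [h1, evp, hv', he0]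
        · intro z hz
          rcases List.mem_cons.1 hz with rfl | hz
          · simp; omega
          · exact h3 z hz
    obtain ⟨zs, rfl, h2, h3⟩ := h1
    rw [← hfix]
    refine h _ (List.mem_flatMap.2 ⟨u, mem_tup.2 ⟨hu, by simp⟩, List.mem_map.2 ⟨zs, ?_, rfl⟩⟩)
    refine mem_tup.2 ⟨by rw [h2, hys], fun z hz => mem_tup.2 ⟨h3 z hz, by simp⟩⟩
  · intro h st hst
    obtain ⟨u, hu, hst⟩ := List.mem_flatMap.1 hst
    obtain ⟨ys, hys, rfl⟩ := List.mem_map.1 hst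
    rw [mem_tup] at hu hys
    rw [hfix]
    refine h u _ hu.1 (by simpa using hys.1) ?_
    intro y hy
    obtain ⟨v, hv, rfl⟩ := List.mem_map.1 hy
    exact ⟨v, (mem_tup.1 (hys.2 v hv)).1.le, rfl⟩

end wp

end QISimple


set_option linter.unusedSectionVars false

namespace QISimple

/-! ### Part 1 : subgroups of simple subgroups of finitely presented groups -/

section kuz

/-- elements of a normal closure as products of conjugates -/
theorem mem_normalClosure_list {H : Type*} [Group H] {s : Set H} {x : H} :
    x ∈ Subgroup.normalClosure s ↔ ∃ l : List (H × H), (∀ p ∈ l, p.2 ∈ s ∨ p.2⁻¹ ∈ s) ∧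
      (l.map fun p => p.1 * p.2 * p.1⁻¹).prod = x := by
  constructor
  · intro hx
    unfold Subgroup.normalClosure at hx
    induction hx using Subgroup.closure_induction with
    | mem x hx =>
      obtain ⟨a, ha, h⟩ := Group.mem_conjugatesOfSet_iff.1 hx
      obtain ⟨c, rfl⟩ := isConj_iff.1 h
      exact ⟨[(c, a)], by simp [ha], by simp⟩
    | one => exact ⟨[], by simp, by simp⟩
    | mul x y _ _ hx hy =>
      obtain ⟨l, h1, rfl⟩ := hx
      obtain ⟨l', h1', rfl⟩ := hy
      refine ⟨l ++ l', ?_, by simp⟩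
      intro p hp
      rcases List.mem_append.1 hp with h | h
      · exact h1 p h
      · exact h1' p h
    | inv x _ hx =>
      obtain ⟨l, h1, rfl⟩ := hx
      refine ⟨(l.map fun p => (p.1, p.2⁻¹)).reverse, ?_, ?_⟩
      · intro p hp
        rw [List.mem_reverse, List.mem_map] at hp
        obtain ⟨q, hq, rfl⟩ := hp
        rcases h1 q hq with h | h
        · right; simpa using h
        · left; exact h
      · rw [List.prod_inv_reverse, List.map_reverse, List.map_map, List.map_map]
        congr 2
        refine List.map_congr_left fun p _ => ?_
        simp [mul_assoc]
  · rintro ⟨l, h1, rfl⟩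
    refine Subgroup.list_prod_mem _ fun y hy => ?_
    obtain ⟨p, hp, rfl⟩ := List.mem_map.1 hy
    refine Subgroup.normalClosure_normal.conj_mem _ ?_ _
    rcases h1 p hp with h | h
    · exact Subgroup.subset_normalClosure h
    · exact inv_mem_iff.1 (Subgroup.subset_normalClosure h)

variable {n : ℕ}

/-- words -/
abbrev Wd (n : ℕ) : Type := List (Fin n × Bool)

theorem primrec_invRev : Primrec (FreeGroup.invRev : Wd n → Wd n) := by
  refine Primrec.list_reverse.comp (Primrec.list_map Primrec.id ?_)
  exact (Primrec.fst.comp Primrec.snd).pair (Primrec.not.comp (Primrec.snd.comp Primrec.snd))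

theorem primrec_reduce : Primrec (FreeGroup.reduce : Wd n → Wd n) := by
  have h1 : PrimrecPred fun x : (Wd n × (Fin n × Bool) × Wd n) × ((Fin n × Bool) × Wd n) =>
      x.1.2.1.1 = x.2.1.1 ∧ x.1.2.1.2 = !x.2.1.2 := by
    refine PrimrecPred.and ?_ ?_
    · exact Primrec.eq.comp (Primrec.fst.comp (Primrec.fst.comp (Primrec.snd.comp Primrec.fst)))
        (Primrec.fst.comp (Primrec.fst.comp Primrec.snd))
    · exact Primrec.eq.comp (Primrec.snd.comp (Primrec.fst.comp (Primrec.snd.comp Primrec.fst)))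
        (Primrec.not.comp (Primrec.snd.comp (Primrec.fst.comp Primrec.snd)))
  have h2 : Primrec fun w : Wd n => w.foldr (fun a (s : Wd n) =>
      (List.casesOn s [a] fun hd tl => if a.1 = hd.1 ∧ a.2 = !hd.2 then tl else a :: hd :: tl :
        Wd n)) [] := by
    refine Primrec.list_foldr (h := fun _ (x : (Fin n × Bool) × Wd n) =>
      (List.casesOn x.2 [x.1] fun hd tl =>
        if x.1.1 = hd.1 ∧ x.1.2 = !hd.2 then tl else x.1 :: hd :: tl : Wd n))
      Primrec.id (Primrec.const []) ?_
    have f1 : Primrec fun x : Wd n × (Fin n × Bool) × Wd n => x.2.2 :=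
      Primrec.snd.comp Primrec.snd
    have f2 : Primrec fun x : Wd n × (Fin n × Bool) × Wd n => ([x.2.1] : Wd n) :=
      Primrec.list_cons.comp (Primrec.fst.comp Primrec.snd) (Primrec.const [])
    refine Primrec.list_casesOn (h := fun (x : Wd n × (Fin n × Bool) × Wd n)
      (y : (Fin n × Bool) × Wd n) =>
        if x.2.1.1 = y.1.1 ∧ x.2.1.2 = !y.1.2 then y.2 else x.2.1 :: y.1 :: y.2) f1 f2 ?_
    refine Primrec.ite h1 (Primrec.snd.comp Primrec.snd) ?_
    exact Primrec.list_cons.comp (Primrec.fst.comp (Primrec.snd.comp Primrec.fst))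
      (Primrec.list_cons.comp (Primrec.fst.comp Primrec.snd) (Primrec.snd.comp Primrec.snd))
  refine h2.of_eq fun w => ?_
  induction w with
  | nil => rfl
  | cons a w ih =>
    rw [List.foldr_cons, ih]
    rfl

theorem mk_cons (p : Fin n × Bool) (w : Wd n) :
    FreeGroup.mk (p :: w) = FreeGroup.mk [p] * FreeGroup.mk w := rfl

theorem exists_mk (x : FreeGroup (Fin n)) : ∃ w : Wd n, FreeGroup.mk w = x :=
  ⟨x.toWord, FreeGroup.mk_toWord⟩

variable {K : Type*} [Group K] (π : FreeGroup (Fin n) →* K)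

theorem mk_flatMap {β : Type*} (l : List β) (f : β → Wd n) :
    π (FreeGroup.mk (l.flatMap f)) = (l.map fun b => π (FreeGroup.mk (f b))).prod := by
  induction l with
  | nil => exact map_one π
  | cons b l ih =>
    rw [List.flatMap_cons, ← FreeGroup.mul_mk, map_mul, ih]
    simp

theorem mk_conj (c r : Wd n) : π (FreeGroup.mk (c ++ r ++ FreeGroup.invRev c)) =
    π (FreeGroup.mk c) * π (FreeGroup.mk r) * (π (FreeGroup.mk c))⁻¹ := by
  rw [← FreeGroup.mul_mk, ← FreeGroup.mul_mk, ← FreeGroup.inv_mk, map_mul, map_mul, map_inv]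

/-- The word problem of a finitely presented group is r.e. -/
theorem fp_re {R : Finset (FreeGroup (Fin n))}
    (hR : π.ker = Subgroup.normalClosure (R : Set (FreeGroup (Fin n)))) :
    REPred fun w : Wd n => π (FreeGroup.mk w) = 1 := by
  classical
  obtain ⟨k, rel, hrel⟩ : ∃ (k : ℕ) (rel : Fin k → FreeGroup (Fin n)),
      Set.range rel = {x | x ∈ R ∨ x⁻¹ ∈ R} := by
    have hfin : {x : FreeGroup (Fin n) | x ∈ R ∨ x⁻¹ ∈ R}.Finite := by
      refine (R ∪ R.image (·⁻¹)).finite_toSet.subset ?_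
      rintro x (h | h)
      · simp [h]
      · simp [h]
    have := hfin.to_subtype
    refine ⟨_, fun i => ((Finite.equivFin {x : FreeGroup (Fin n) | x ∈ R ∨ x⁻¹ ∈ R}).symm i).1, ?_⟩
    ext x
    constructor
    · rintro ⟨i, rfl⟩
      exact ((Finite.equivFin {x : FreeGroup (Fin n) | x ∈ R ∨ x⁻¹ ∈ R}).symm i).2
    · intro hx
      exact ⟨Finite.equivFin _ ⟨x, hx⟩, congrArg Subtype.val (Equiv.symm_apply_apply _ _)⟩
  choose rw' hrw using fun i => exists_mk (rel i)
  let fl : List (Wd n × Fin k) → Wd n := fun l =>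
    l.flatMap fun p => p.1 ++ rw' p.2 ++ FreeGroup.invRev p.1
  have hfl : Primrec fl := by
    refine Primrec.list_flatMap Primrec.id ?_
    have hc : Primrec fun x : List (Wd n × Fin k) × (Wd n × Fin k) => x.2.1 :=
      Primrec.fst.comp Primrec.snd
    exact Primrec.list_append.comp (Primrec.list_append.comp hc
      ((Primrec.dom_finite rw').comp (Primrec.snd.comp Primrec.snd))) (primrec_invRev.comp hc)
  have hp : PrimrecPred fun x : Wd n × List (Wd n × Fin k) =>
      FreeGroup.reduce (fl x.2) = FreeGroup.reduce x.1 :=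
    Primrec.eq.comp (primrec_reduce.comp (hfl.comp Primrec.snd)) (primrec_reduce.comp Primrec.fst)
  refine (re_exists (p := fun (w : Wd n) (c : List (Wd n × Fin k)) =>
    FreeGroup.reduce (fl c) = FreeGroup.reduce w) hp.computablePred.to_re).of_eq fun w => ?_
  rw [← MonoidHom.mem_ker, hR, mem_normalClosure_list]
  have hfl' : ∀ c, FreeGroup.mk (fl c) = (c.map fun p => FreeGroup.mk p.1 * rel p.2 *
      (FreeGroup.mk p.1)⁻¹).prod := by
    intro c
    have := mk_flatMap (MonoidHom.id _) c fun p => p.1 ++ rw' p.2 ++ FreeGroup.invRev p.1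
    simp only [mk_conj] at this
    simp only [hrw, MonoidHom.id_apply] at this
    exact this
  constructor
  · rintro ⟨c, hc⟩
    have h1 := FreeGroup.reduce.exact hc
    rw [hfl'] at h1
    refine ⟨c.map fun p => (FreeGroup.mk p.1, rel p.2), ?_, ?_⟩
    · intro p hp
      obtain ⟨q, -, rfl⟩ := List.mem_map.1 hp
      have : rel q.2 ∈ Set.range rel := ⟨_, rfl⟩
      rw [hrel] at this
      exact this
    · rw [List.map_map, ← h1]; rfl
  · rintro ⟨l, h1, h2⟩
    have h3 : ∃ c : List (Wd n × Fin k), FreeGroup.mk (fl c) =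
        (l.map fun p => p.1 * p.2 * p.1⁻¹).prod := by
      clear h2
      simp only [hfl']
      induction l with
      | nil => exact ⟨[], rfl⟩
      | cons p l ih =>
        obtain ⟨c, hc⟩ := ih fun p hp => h1 p (List.mem_cons_of_mem _ hp)
        obtain ⟨v, hv⟩ := exists_mk p.1
        have : p.2 ∈ Set.range rel := by rw [hrel]; exact h1 p List.mem_cons_self
        obtain ⟨i, hi⟩ := this
        refine ⟨(v, i) :: c, ?_⟩
        rw [List.map_cons, List.prod_cons, List.map_cons, List.prod_cons, hc, hv, hi]
    obtain ⟨c, hc⟩ := h3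
    exact ⟨c, FreeGroup.reduce.sound (hc.trans h2)⟩

variable {π}

theorem exists_subst (hπ : Function.Surjective π) {m : ℕ} (ψ : FreeGroup (Fin m) →* K) :
    ∃ f : Wd m → Wd n, Primrec f ∧ ∀ w, π (FreeGroup.mk (f w)) = ψ (FreeGroup.mk w) := by
  have h1 : ∀ p : Fin m × Bool, ∃ v : Wd n, π (FreeGroup.mk v) = ψ (FreeGroup.mk [p]) := by
    intro p
    obtain ⟨x, hx⟩ := hπ (ψ (FreeGroup.mk [p]))
    obtain ⟨v, rfl⟩ := exists_mk x
    exact ⟨v, hx⟩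
  choose b hb using h1
  refine ⟨fun w => w.flatMap b, Primrec.list_flatMap Primrec.id
    ((Primrec.dom_finite b).comp Primrec.snd), fun w => ?_⟩
  rw [mk_flatMap]
  simp only [hb]
  induction w with
  | nil => exact (map_one ψ).symm
  | cons p w ih => rw [List.map_cons, List.prod_cons, ih, ← map_mul]; rfl

theorem exists_pres {H : Type*} [Group H] (hH : Group.FG H) :
    ∃ (m : ℕ) (ρ : FreeGroup (Fin m) →* H), Function.Surjective ρ := by
  obtain ⟨S, hS, ρ, hρ⟩ := Group.fg_iff_exists_freeGroup_hom_surjective_finite.1 hH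
  have e := Finite.equivFin S
  refine ⟨_, ρ.comp (FreeGroup.freeGroupCongr e.symm).toMonoidHom, ?_⟩
  exact hρ.comp (FreeGroup.freeGroupCongr e.symm).surjective

/-- Kuznetsov's argument -/
theorem kuznetsov {G : Type*} [Group G] (hπ : Function.Surjective π)
    {R : Finset (FreeGroup (Fin n))}
    (hR : π.ker = Subgroup.normalClosure (R : Set (FreeGroup (Fin n))))
    (S : Subgroup K) (hS : Group.FG S) [hs : IsSimpleGroup S] (φ : G →* S)
    (hφ : Function.Injective φ) {m : ℕ} (ρ : FreeGroup (Fin m) →* G) :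
    ComputablePred fun w : Wd m => ρ (FreeGroup.mk w) = 1 := by
  have hre := fp_re π hR
  obtain ⟨f, hf, hf'⟩ := exists_subst hπ (S.subtype.comp (φ.comp ρ))
  obtain ⟨q, θ, hθ⟩ := exists_pres hS
  obtain ⟨g, hg, hg'⟩ := exists_subst hπ (S.subtype.comp θ)
  obtain ⟨s0, hs0⟩ := exists_ne (1 : S)
  obtain ⟨x0, hx0⟩ := hπ (s0 : K)
  obtain ⟨v0, rfl⟩ := exists_mk x0
  rw [ComputablePred.computable_iff_re_compl_re']
  constructor
  · refine (re_comp hre hf.to_comp).of_eq fun w => ?_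
    rw [hf']
    simp only [MonoidHom.comp_apply, Subgroup.coe_subtype, OneMemClass.coe_eq_one]
    exact map_eq_one_iff φ hφ
  · let F : Wd m → List (Wd q × Bool) → Wd n := fun w l =>
      (l.flatMap fun p => g p.1 ++ (bif p.2 then f w else FreeGroup.invRev (f w)) ++
        FreeGroup.invRev (g p.1)) ++ FreeGroup.invRev v0
    have hF : Primrec fun x : Wd m × List (Wd q × Bool) => F x.1 x.2 := by
      refine Primrec.list_append.comp (Primrec.list_flatMap Primrec.snd ?_) (Primrec.const _)
      have h1 : Primrec fun x : (Wd m × List (Wd q × Bool)) × (Wd q × Bool) => g x.2.1 :=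
        hg.comp (Primrec.fst.comp Primrec.snd)
      have h2 : Primrec fun x : (Wd m × List (Wd q × Bool)) × (Wd q × Bool) => f x.1.1 :=
        hf.comp (Primrec.fst.comp Primrec.fst)
      exact Primrec.list_append.comp (Primrec.list_append.comp h1
        (Primrec.cond (Primrec.snd.comp Primrec.snd) h2 (primrec_invRev.comp h2)))
        (primrec_invRev.comp h1)
    refine (re_exists (p := fun w l => π (FreeGroup.mk (F w l)) = 1)
      (re_comp hre hF.to_comp)).of_eq fun w => ?_
    have key : ∀ l, π (FreeGroup.mk (F w l)) = 1 ↔ (l.map fun p : Wd q × Bool =>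
        θ (FreeGroup.mk p.1) * (bif p.2 then φ (ρ (FreeGroup.mk w)) else
          (φ (ρ (FreeGroup.mk w)))⁻¹) * (θ (FreeGroup.mk p.1))⁻¹).prod = s0 := by
      intro l
      rw [← FreeGroup.mul_mk, map_mul, ← FreeGroup.inv_mk, map_inv, hx0, mul_inv_eq_one,
        mk_flatMap]
      have : (l.map fun b => π (FreeGroup.mk (g b.1 ++ (bif b.2 then f w else
          FreeGroup.invRev (f w)) ++ FreeGroup.invRev (g b.1)))) = 
          (l.map fun p : Wd q × Bool =>
            θ (FreeGroup.mk p.1) * (bif p.2 then φ (ρ (FreeGroup.mk w)) else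
          (φ (ρ (FreeGroup.mk w)))⁻¹) * (θ (FreeGroup.mk p.1))⁻¹).map S.subtype := by
        rw [List.map_map]
        refine List.map_congr_left fun p _ => ?_
        rw [mk_conj, hg']
        obtain ⟨c, b⟩ := p
        cases b
        · simp [← FreeGroup.inv_mk, hf']
        · simp [hf']
      rw [this, ← map_list_prod]
      exact Subtype.coe_inj
    have hnc : ¬ ρ (FreeGroup.mk w) = 1 ↔
        s0 ∈ Subgroup.normalClosure {φ (ρ (FreeGroup.mk w))} := by
      rw [← map_eq_one_iff φ hφ]
      generalize φ (ρ (FreeGroup.mk w)) = x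
      constructor
      · intro hx
        rcases (Subgroup.normalClosure_normal (s := {x})).eq_bot_or_eq_top with h | h
        · exact absurd (Subgroup.mem_bot.1 (h ▸ Subgroup.subset_normalClosure rfl)) hx
        · rw [h]; trivial
      · rintro h rfl
        apply hs0
        have h1 : Subgroup.normalClosure {(1 : S)} ≤ ⊥ :=
          Subgroup.normalClosure_le_normal (by simp)
        exact Subgroup.mem_bot.1 (h1 h)
    rw [hnc, mem_normalClosure_list]
    simp only [key]
    constructor
    · rintro ⟨l, rfl⟩
      refine ⟨l.map fun p => (θ (FreeGroup.mk p.1), (bif p.2 then φ (ρ (FreeGroup.mk w)) else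
          (φ (ρ (FreeGroup.mk w)))⁻¹)), ?_, by rw [List.map_map]; rfl⟩
      intro p hp
      obtain ⟨⟨c, b⟩, -, rfl⟩ := List.mem_map.1 hp
      cases b <;> simp
    · rintro ⟨l, h1, rfl⟩
      clear hnc key hs0 hx0
      induction l with
      | nil => exact ⟨[], rfl⟩
      | cons p l ih =>
        obtain ⟨c, hc⟩ := ih fun p hp => h1 p (List.mem_cons_of_mem _ hp)
        obtain ⟨y, hy⟩ := hθ p.1
        obtain ⟨v, rfl⟩ := exists_mk y
        rcases h1 p List.mem_cons_self with h | h
        · refine ⟨(v, true) :: c, ?_⟩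
          rw [List.map_cons, List.prod_cons, hc, List.map_cons, List.prod_cons, hy,
            Set.mem_singleton_iff.1 h]
          rfl
        · refine ⟨(v, false) :: c, ?_⟩
          rw [List.map_cons, List.prod_cons, hc, List.map_cons, List.prod_cons, hy,
            ← Set.mem_singleton_iff.1 h, inv_inv]
          rfl

end kuz

end QISimple


set_option linter.unusedSectionVars false

namespace QISimple

/-! ### Part 7 : word lengths and assembly -/

section wl

variable {G H : Type*} [Group G] [Group H]

theorem wl_spec {X : Finset G} (hX : Generates X) (g : G) :
    ∃ w : List G, w.length = wordLength X g ∧ (∀ a ∈ w, a ∈ X ∨ a⁻¹ ∈ X) ∧ w.prod = g := by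
  have hg : g ∈ Subgroup.closure (X : Set G) := by
    rw [show Subgroup.closure (X : Set G) = ⊤ from hX]; trivial
  rw [← Subgroup.mem_toSubmonoid, Subgroup.closure_toSubmonoid] at hg
  obtain ⟨l, h1, h2⟩ := Submonoid.exists_list_of_mem_closure hg
  exact Nat.sInf_mem (s := {n | ∃ w : List G, w.length = n ∧
    (∀ a ∈ w, a ∈ X ∨ a⁻¹ ∈ X) ∧ w.prod = g}) ⟨_, l, rfl, h1, h2⟩

theorem wl_le {X : Finset G} {w : List G} (h : ∀ a ∈ w, a ∈ X ∨ a⁻¹ ∈ X) :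
    wordLength X w.prod ≤ w.length := Nat.sInf_le ⟨w, rfl, h, rfl⟩

theorem wl_norm {X : Finset G} (hX : Generates X) : IsNorm (wordLength X) := by
  have hone : wordLength X 1 = 0 := by
    have := wl_le (X := X) (w := []) (by simp)
    simpa using this
  have hinv : ∀ a, wordLength X a⁻¹ ≤ wordLength X a := by
    intro a
    obtain ⟨w, h1, h2, h3⟩ := wl_spec hX a
    rw [← h1, ← h3, List.prod_inv_reverse]
    refine (wl_le ?_).trans (by simp)
    intro b hb
    rw [List.mem_reverse, List.mem_map] at hb
    obtain ⟨c, hc, rfl⟩ := hb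
    rw [inv_inv]
    exact (h2 c hc).symm
  refine ⟨hone, ?_, ?_, ?_⟩
  · intro a b
    obtain ⟨w, h1, h2, h3⟩ := wl_spec hX a
    obtain ⟨w', h1', h2', h3'⟩ := wl_spec hX b
    rw [← h1, ← h1', ← h3, ← h3', ← List.prod_append, ← List.length_append]
    refine wl_le fun c hc => ?_
    rcases List.mem_append.1 hc with h | h
    · exact h2 c h
    · exact h2' c h
  · intro a
    refine le_antisymm (hinv a) ?_
    have := hinv a⁻¹
    rwa [inv_inv] at this
  · intro a ha
    obtain ⟨w, h1, h2, h3⟩ := wl_spec hX a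
    rw [ha, List.length_eq_zero_iff] at h1
    rw [← h3, h1, List.prod_nil]

theorem wl_map {X : Finset G} (hX : Generates X) {Y : Finset H} (φ : G →* H)
    (h : ∀ x ∈ X, φ x ∈ Y) (g : G) : wordLength Y (φ g) ≤ wordLength X g := by
  obtain ⟨w, h1, h2, h3⟩ := wl_spec hX g
  rw [← h1, ← h3, map_list_prod]
  refine (wl_le ?_).trans (by simp)
  intro b hb
  obtain ⟨c, hc, rfl⟩ := List.mem_map.1 hb
  rcases h2 c hc with h' | h'
  · exact Or.inl (h _ h')
  · right
    rw [← map_inv]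
    exact h _ h'

theorem qi_of {X : Finset G} {Y : Finset H} {φ : G →* H} (hφ : Function.Injective φ) (C : ℕ)
    (h1 : ∀ g, wordLength X g ≤ C * wordLength Y (φ g))
    (h2 : ∀ g, wordLength Y (φ g) ≤ wordLength X g) : IsQIEmbedding X Y φ := by
  refine ⟨hφ, C + 1, 1, by positivity, one_pos, fun g => ⟨?_, ?_⟩⟩
  · have h : (wordLength X g : ℝ) ≤ C * wordLength Y (φ g) := by exact_mod_cast h1 g
    have h0 : (0 : ℝ) ≤ wordLength Y (φ g) := Nat.cast_nonneg _
    have hC : (0 : ℝ) < C + 1 := by positivity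
    have : 1 / ((C : ℝ) + 1) * (wordLength X g : ℝ) ≤ wordLength Y (φ g) := by
      rw [one_div, inv_mul_le_iff₀ hC]
      nlinarith
    linarith
  · have h : (wordLength Y (φ g) : ℝ) ≤ wordLength X g := by exact_mod_cast h2 g
    have h0 : (0 : ℝ) ≤ wordLength X g := Nat.cast_nonneg _
    have hC : (0 : ℝ) ≤ C := Nat.cast_nonneg _
    nlinarith

theorem generates_of_list {ι : Type*} {X : Finset G} (s : ι → G) (hs : ∀ i, s i ∈ X)
    (h : ∀ g, ∃ w : List ι, (w.map s).prod = g) : Generates X := by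
  refine (Subgroup.eq_top_iff' _).2 fun g => ?_
  obtain ⟨w, rfl⟩ := h g
  refine Subgroup.list_prod_mem _ fun x hx => ?_
  obtain ⟨i, -, rfl⟩ := List.mem_map.1 hx
  exact Subgroup.subset_closure (hs i)

theorem generates_map_equiv [DecidableEq H] {X : Finset G} (hX : Generates X) (e : G ≃* H) :
    Generates (X.image e) := by
  have hX' : Subgroup.closure (X : Set G) = ⊤ := hX
  change Subgroup.closure ((X.image e : Finset H) : Set H) = ⊤
  rw [Finset.coe_image]
  have := MonoidHom.map_closure e.toMonoidHom (X : Set G)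
  rw [hX', Subgroup.map_top_of_surjective _ e.surjective] at this
  exact this.symm

end wl

section asm

variable {G : Type} [Group G]

/-- letters evaluated in `G` -/
def evO {m : ℕ} (π : FreeGroup (Fin m) →* G) : Option (Fin m × Bool) → G
  | none => 1
  | some p => π (FreeGroup.mk [p])

/-- formal inverse of a letter -/
def invO {m : ℕ} : Option (Fin m × Bool) → Option (Fin m × Bool)
  | none => none
  | some p => some (p.1, !p.2)

theorem evO_invO {m : ℕ} (π : FreeGroup (Fin m) →* G) (a) : evO π (invO a) = (evO π a)⁻¹ := by
  rcases a with _ | p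
  · exact inv_one.symm
  · change π _ = (π _)⁻¹
    rw [← map_inv, FreeGroup.inv_mk]
    rfl

theorem evO_word {m : ℕ} (π : FreeGroup (Fin m) →* G) (v : List (Option (Fin m × Bool))) :
    (v.map (evO π)).prod = π (FreeGroup.mk (v.filterMap id)) := by
  induction v with
  | nil => exact (map_one π).symm
  | cons a v ih =>
    rw [List.map_cons, List.prod_cons, ih]
    rcases a with _ | p
    · rw [List.filterMap_cons_none rfl]
      exact one_mul _
    · exact (map_mul π (FreeGroup.mk [p]) (FreeGroup.mk (v.filterMap id))).symm

theorem exists_test {m : ℕ} {π : FreeGroup (Fin m) →* G}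
    (h : ComputablePred fun w : Wd m => π (FreeGroup.mk w) = 1) :
    ∃ t : List (Option (Fin m × Bool)) → Bool, Computable t ∧
      ∀ v, t v = true ↔ (v.map (evO π)).prod = 1 := by
  obtain ⟨hd, hc⟩ := h
  have hf : Primrec fun v : List (Option (Fin m × Bool)) => v.filterMap id :=
    Primrec.listFilterMap Primrec.id Primrec.snd
  refine ⟨_, hc.comp hf.to_comp, fun v => ?_⟩
  rw [evO_word]
  exact decide_eq_true_iff

theorem gperm_inv {A : Type} {ev : A → G} {inv : A → A} (hinv : ∀ a, ev (inv a) = (ev a)⁻¹)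
    {c : Gn A} (hc : GOk c) : ∃ c', gperm ev c' = (gperm ev c)⁻¹ := by
  rcases c with ⟨p, q⟩ | (_ | a)
  · refine ⟨.inl (p, q), ?_⟩
    rw [gperm_sig ev hc.1, sig, pswap_inv]
  · refine ⟨.inr none, ?_⟩
    change tau G = (tau G)⁻¹
    rw [tau, pswap_inv]
  · refine ⟨.inr (some (inv a)), ?_⟩
    change gam (ev (inv a)) = (gam (ev a))⁻¹
    rw [← gam_inv, ← hinv]

/-- `gam` as a homomorphism -/
noncomputable def gamHom : G →* SG G where
  toFun g := ⟨gam g, gam_mem g⟩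
  map_one' := Subtype.ext gam_one
  map_mul' a b := Subtype.ext (gam_mul a b)

theorem forward {m : ℕ} (π : FreeGroup (Fin m) →* G) (hπ : Function.Surjective π)
    (hd : ComputablePred fun w : Wd m => π (FreeGroup.mk w) = 1) :
    ∃ (K : Type) (_ : Group K) (S : Subgroup K) (X : Finset G) (Y : Finset ↥S)
        (Z : Finset K) (φ : G →* ↥S),
        IsFinitelyPresented K ∧ Group.FG ↥S ∧ IsSimpleGroup ↥S ∧
        Generates X ∧ Generates Y ∧ Generates Z ∧
        IsQIEmbedding Y Z S.subtype ∧ IsQIEmbedding X Y φ := by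
  classical
  set ev := evO π with hevdef
  have hinv : ∀ a, ev (invO a) = (ev a)⁻¹ := evO_invO π
  have hev : ∀ g, ∃ w : List (Option (Fin m × Bool)), (w.map ev).prod = g := by
    intro g
    obtain ⟨x, rfl⟩ := hπ g
    obtain ⟨w, rfl⟩ := exists_mk x
    refine ⟨w.map some, ?_⟩
    rw [hevdef, evO_word, List.filterMap_map]
    simp
  obtain ⟨t, htc, ht⟩ := exists_test hd
  have hfin := (finite_GOk (A := Option (Fin m × Bool))).to_subtype
  let E := Finite.equivFin {c : Gn (Option (Fin m × Bool)) | GOk c}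
  let code : Fin (Nat.card {c : Gn (Option (Fin m × Bool)) | GOk c}) →
    Gn (Option (Fin m × Bool)) := fun i => (E.symm i).1
  have hcode : ∀ i, GOk (code i) := fun i => (E.symm i).2
  have hcode' : ∀ c, GOk c → ∃ i, code i = c := fun c hc =>
    ⟨E ⟨c, hc⟩, congrArg Subtype.val (Equiv.symm_apply_apply _ _)⟩
  let s : Fin (Nat.card {c : Gn (Option (Fin m × Bool)) | GOk c}) → SG G :=
    fun i => ⟨gperm ev (code i), gperm_mem ev _⟩
  have hsprod : ∀ w : List (Fin _), (((w.map s).prod : SG G) : Equiv.Perm (Om G)) =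
      (w.map fun i => gperm ev (code i)).prod := by
    intro w
    rw [← Subgroup.coe_subtype, map_list_prod, List.map_map]
    rfl
  have hgen : ∀ g : SG G, ∃ w : List (Fin _), (w.map s).prod = g := by
    rintro ⟨p, hp⟩
    obtain ⟨w, hw, h⟩ := WProd.all hinv hev hp
    have : ∃ w' : List (Fin _), w'.map code = w := by
      clear h
      induction w with
      | nil => exact ⟨[], rfl⟩
      | cons c w ih =>
        obtain ⟨w', rfl⟩ := ih fun c hc => hw c (List.mem_cons_of_mem _ hc)
        obtain ⟨i, rfl⟩ := hcode' c (hw c List.mem_cons_self)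
        exact ⟨i :: w', rfl⟩
    obtain ⟨w', rfl⟩ := this
    refine ⟨w', Subtype.ext ?_⟩
    rw [hsprod]
    rw [List.map_map] at h
    exact h
  obtain ⟨M, hM⟩ := exists_machine (wp_re hinv hev none rfl htc ht code hcode)
  let Y0 : Finset (SG G) := Finset.univ.image s
  have hsY : ∀ i, s i ∈ Y0 := fun i => Finset.mem_image_of_mem _ (Finset.mem_univ _)
  have hY0 : Generates Y0 := generates_of_list s hsY hgen
  have hs1 : ∀ i, wordLength Y0 (s i) ≤ 1 := by
    intro i
    have := wl_le (X := Y0) (w := [s i]) (by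
      intro a ha
      rw [List.mem_singleton] at ha
      exact Or.inl (ha ▸ hsY i))
    simpa using this
  obtain ⟨K, gK, n, θ, R, hθ, hR, V, hV, hVs, C, hC⟩ := embed_of_machine M s hgen (wl_norm hY0) hs1
    (fun w => by rw [← hM, ← hsprod, OneMemClass.coe_eq_one])
  let e : SG G ≃* V.range := MonoidHom.ofInjective hV
  have he : ∀ g, ((e g : V.range) : K) = V g := fun g => rfl
  let Y : Finset V.range := Y0.image e
  let X : Finset G := Finset.univ.image ev
  let Z : Finset K := Finset.univ.image fun i => θ (FreeGroup.of i)
  have hY : Generates Y := generates_map_equiv hY0 e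
  have hX : Generates X := generates_of_list ev
    (fun i => Finset.mem_image_of_mem _ (Finset.mem_univ _)) hev
  have hZθ : ∀ i, θ (FreeGroup.of i) ∈ Z := fun i =>
    Finset.mem_image_of_mem (fun i => θ (FreeGroup.of i)) (Finset.mem_univ i)
  have hZ : Generates Z := by
    refine (Subgroup.eq_top_iff' _).2 fun g => ?_
    obtain ⟨x, rfl⟩ := hθ g
    induction x using FreeGroup.induction_on with
    | C1 => rw [map_one]; exact one_mem _
    | of i => exact Subgroup.subset_closure (hZθ i)
    | inv_of i h => rw [map_inv]; exact inv_mem h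
    | mul x y hx hy => rw [map_mul]; exact mul_mem hx hy
  have hYe : ∀ g, wordLength Y (e g) = wordLength Y0 g := by
    intro g
    refine le_antisymm (wl_map hY0 e.toMonoidHom
      (fun x hx => Finset.mem_image_of_mem _ hx) g) ?_
    have := wl_map hY (Y := Y0) e.symm.toMonoidHom (fun x hx => by
      obtain ⟨y, hy, rfl⟩ := Finset.mem_image.1 hx
      have h1 : e.symm.toMonoidHom (e y) = y := e.symm_apply_apply y
      rw [h1]; exact hy) (e g)
    have h1 : e.symm.toMonoidHom (e g) = g := e.symm_apply_apply g
    rwa [h1] at this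
  have hsimp : IsSimpleGroup (SG G) := SG_simple
  refine ⟨K, gK, V.range, X, Y, Z, e.toMonoidHom.comp gamHom, ⟨n, θ, R, hθ, hR⟩, ⟨⟨Y, hY⟩⟩, ?_, hX,
    hY, hZ, qi_of (Subgroup.subtype_injective _) C ?_ (wl_map hY _ ?_), qi_of ?_ 1 ?_
    (wl_map hX _ ?_)⟩
  · have : Nontrivial V.range := e.symm.toEquiv.nontrivial
    exact IsSimpleGroup.isSimpleGroup_of_surjective e.toMonoidHom e.surjective
  · intro y
    obtain ⟨g, rfl⟩ := e.surjective y
    rw [hYe]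
    change _ ≤ C * wordLength Z (V g)
    obtain ⟨w, h1, h2, h3⟩ := wl_spec hZ (V g)
    have : ∃ v : List (Fin n × Bool), v.length = w.length ∧ θ (FreeGroup.mk v) = w.prod := by
      clear h1 h3
      induction w with
      | nil => exact ⟨[], rfl, map_one θ⟩
      | cons a w ih =>
        obtain ⟨v, hv1, hv2⟩ := ih fun c hc => h2 c (List.mem_cons_of_mem _ hc)
        have : ∃ p : Fin n × Bool, θ (FreeGroup.mk [p]) = a := by
          rcases h2 a List.mem_cons_self with h | h
          · obtain ⟨i, -, hi⟩ := Finset.mem_image.1 h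
            exact ⟨(i, true), hi⟩
          · obtain ⟨i, -, hi⟩ := Finset.mem_image.1 h
            refine ⟨(i, false), ?_⟩
            rw [← inv_inv a, ← hi, ← map_inv]
            rfl
        obtain ⟨p, hp⟩ := this
        refine ⟨p :: v, by simp [hv1], ?_⟩
        rw [List.prod_cons, ← hv2, ← hp, ← map_mul]
        rfl
    obtain ⟨v, hv1, hv2⟩ := this
    rw [← h1, ← hv1]
    exact hC v g (by rw [hv2, h3])
  · intro y hy
    obtain ⟨z, hz, rfl⟩ := Finset.mem_image.1 hy
    obtain ⟨a, -, rfl⟩ := Finset.mem_image.1 hz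
    obtain ⟨i, hi⟩ := hVs a
    change V (s a) ∈ Z
    rw [hi]
    exact hZθ i
  · refine e.injective.comp fun a b hab => ?_
    exact gam_injective (congrArg Subtype.val hab)
  · intro g
    change _ ≤ 1 * wordLength Y (e (gamHom g))
    rw [hYe, one_mul]
    obtain ⟨w, h1, h2, h3⟩ := wl_spec hY0 (gamHom g)
    have : ∃ v : List (Gn (Option (Fin m × Bool))), v.length = w.length ∧
        (v.map (gperm ev)).prod = ((w.prod : SG G) : Equiv.Perm (Om G)) := by
      clear h1 h3
      induction w with
      | nil => exact ⟨[], rfl, rfl⟩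
      | cons a w ih =>
        obtain ⟨v, hv1, hv2⟩ := ih fun c hc => h2 c (List.mem_cons_of_mem _ hc)
        have : ∃ c : Gn (Option (Fin m × Bool)), gperm ev c = (a : Equiv.Perm (Om G)) := by
          rcases h2 a List.mem_cons_self with h | h
          · obtain ⟨i, -, hi⟩ := Finset.mem_image.1 h
            exact ⟨code i, congrArg Subtype.val hi⟩
          · obtain ⟨i, -, hi⟩ := Finset.mem_image.1 h
            obtain ⟨c', hc'⟩ := gperm_inv hinv (hcode i)
            have hi' : gperm ev (code i) = (a : Equiv.Perm (Om G))⁻¹ := congrArg Subtype.val hi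
            exact ⟨c', by rw [hc', hi', inv_inv]⟩
        obtain ⟨c, hc⟩ := this
        refine ⟨c :: v, by simp [hv1], ?_⟩
        rw [List.map_cons, List.prod_cons, List.prod_cons, hv2, hc]
        rfl
    obtain ⟨v, hv1, hv2⟩ := this
    obtain ⟨u, hu1, hu2⟩ := gam_length (ev := ev) (w := v) (g := g) (by rw [hv2, h3]; rfl)
    rw [← h1, ← hv1, ← hu2]
    refine (wl_le ?_).trans ((List.length_map _).trans_le hu1)
    intro b hb
    obtain ⟨c, -, rfl⟩ := List.mem_map.1 hb
    exact Or.inl (Finset.mem_image_of_mem _ (Finset.mem_univ _))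
  · intro x hx
    obtain ⟨a, -, rfl⟩ := Finset.mem_image.1 hx
    obtain ⟨i, hi⟩ := hcode' (.inr (some a)) trivial
    refine Finset.mem_image_of_mem _ ?_
    have : gamHom (ev a) = s i := Subtype.ext (by
      change gam (ev a) = gperm ev (code i)
      rw [hi]; rfl)
    rw [this]
    exact hsY i

end asm

end QISimple


theorem decidable_word_problem_iff_qi_embedding_via_simple_into_fp
    (G : Type) [Group G] (hGfg : Group.FG G) :
    (∃ (m : ℕ) (π : FreeGroup (Fin m) →* G),
        Function.Surjective π ∧ DecidableWordProblemVia π) ↔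
      ∃ (K : Type) (_ : Group K) (S : Subgroup K) (X : Finset G) (Y : Finset ↥S)
        (Z : Finset K) (φ : G →* ↥S),
        IsFinitelyPresented K ∧ Group.FG ↥S ∧ IsSimpleGroup ↥S ∧
        Generates X ∧ Generates Y ∧ Generates Z ∧
        IsQIEmbedding Y Z S.subtype ∧ IsQIEmbedding X Y φ := by
  constructor
  · rintro ⟨m, π, hπ, hd⟩
    exact QISimple.forward π hπ hd
  · rintro ⟨K, gK, S, X, Y, Z, φ, ⟨n, π, R, hπ, hR⟩, hS, hs, -, -, -, -, hφ⟩
    obtain ⟨m, ρ, hρ⟩ := QISimple.exists_pres hGfg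
    exact ⟨m, ρ, hρ, QISimple.kuznetsov hπ hR S hS φ hφ.1 ρ⟩
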